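/- Let f = Σ_{λ∈Λ} Σ_k p_k(λ) D^k δ_λ (k ∈ (ℕ∪{0})^d) be a tempered distribution on ℝ^d whose support Λ and spectrum Γ = supp f̂ are both uniformly discrete. Suppose there exist nonnegative integers h(k) and constants 0 < c ≤ C < ∞ such that c ≤ sup_k |p_k(λ)|(1+|λ|)^{−h(k)} ≤ C for every λ ∈ Λ. Then there exist J ∈ ℕ, full-rank lattices L_1, …, L_J, points λ_1, …, λ_J ∈ ℝ^d, a finite set of triples (k, m, ω) with k, m ∈ (ℕ∪{0})^d and ω ∈ ℝ^d, and complex numbers c(j,k,m,ω) such that f = Σ_{j=1}^J Σ_{λ ∈ λ_j + L_j} Σ_{(k,m,ω)} c(j,k,m,ω) λ^m e^{2πi⟨λ,ω⟩} D^k δ_λ, where λ^m = λ_1^{m_1}⋯λ_d^{m_d}. -/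

import Mathlib

open MeasureTheory SchwartzMap Metric Set
open scoped Pointwise RealInnerProductSpace ENNReal NNReal

noncomputable section

/-- Euclidean space `ℝ^d`. -/
abbrev Rd (d : ℕ) : Type := EuclideanSpace ℝ (Fin d)

/-- The space `S*(ℝ^d)` of tempered distributions: continuous linear functionals
on the Schwartz space `S(ℝ^d)`. -/
abbrev TemperedDist (d : ℕ) : Type := SchwartzMap (Rd d) ℂ →L[ℂ] ℂ

/-- The Fourier transform of a tempered distribution: `f̂(φ) = f(φ̂)`. -/
def fourierTD {d : ℕ} (f : TemperedDist d) : TemperedDist d :=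
  f.comp (fourierTransformCLM ℂ)

/-- The support of a tempered distribution: `x ∈ supp f` iff for every open
neighbourhood `U` of `x` there is a smooth compactly supported test function
supported in `U` on which `f` does not vanish. -/
def tdSupport {d : ℕ} (f : TemperedDist d) : Set (Rd d) :=
  {x | ∀ U : Set (Rd d), IsOpen U → x ∈ U →
    ∃ φ : SchwartzMap (Rd d) ℂ, HasCompactSupport (⇑φ) ∧ tsupport (⇑φ) ⊆ U ∧ f φ ≠ 0}

/-- A set is locally finite if its intersection with every ball is finite. -/
def LocFinite {d : ℕ} (A : Set (Rd d)) : Prop :=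
  ∀ (x : Rd d) (r : ℝ), (A ∩ Metric.ball x r).Finite

/-- A set is uniformly discrete if distances between distinct points are
bounded below by a positive constant. -/
def UniformlyDiscrete {d : ℕ} (A : Set (Rd d)) : Prop :=
  ∃ η > (0:ℝ), ∀ x ∈ A, ∀ y ∈ A, x ≠ y → η ≤ dist x y

/-- A set is polynomially discrete (p-discrete) if
`|x - x'| ≥ c min{1, |x|^{-h}}` for distinct points `x, x'` of the set. -/
def PDiscrete {d : ℕ} (A : Set (Rd d)) : Prop :=
  ∃ c > (0:ℝ), ∃ h > (0:ℝ), ∀ x ∈ A, ∀ y ∈ A, x ≠ y →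
    c * (if ‖x‖ ≤ 1 then 1 else ‖x‖ ^ (-h)) ≤ dist x y

/-- A set has bounded density if it is locally finite and the number of its
points in balls of radius 1 is uniformly bounded. -/
def BoundedDensity {d : ℕ} (A : Set (Rd d)) : Prop :=
  LocFinite A ∧ ∃ N : ℕ, ∀ x : Rd d, (A ∩ Metric.ball x 1).ncard ≤ N

/-- A set is relatively dense if it intersects every ball of some fixed radius `R`. -/
def RelDense {d : ℕ} (A : Set (Rd d)) : Prop :=
  ∃ R : ℝ, 0 < R ∧ ∀ x : Rd d, ∃ a ∈ A, dist x a ≤ R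

/-- A full-rank lattice in `ℝ^d` is the image of `ℤ^d` under an invertible
linear operator. -/
def IsFullRankLattice {d : ℕ} (L : Set (Rd d)) : Prop :=
  ∃ T : Rd d →ₗ[ℝ] Rd d, Function.Bijective T ∧
    L = T '' {x : Rd d | ∀ i, ∃ n : ℤ, x i = (n : ℝ)}

/-- The multi-indices `k ∈ (ℕ ∪ {0})^d` with `‖k‖ = k₁ + ⋯ + k_d ≤ K`. -/
def mIdx (d K : ℕ) : Finset (Fin d → ℕ) :=
  (Finset.Iic fun _ => K).filter fun k => (∑ i, k i) ≤ K

/-- Partial derivative in the `i`-th coordinate direction. -/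
def pderiv' {d : ℕ} (i : Fin d) (φ : Rd d → ℂ) : Rd d → ℂ :=
  fun x => fderiv ℝ φ x (EuclideanSpace.single i (1:ℝ))

/-- The mixed partial derivative `D^k = ∂^{k₁}_{x₁} ⋯ ∂^{k_d}_{x_d}`. -/
def Dmulti {d : ℕ} (k : Fin d → ℕ) : (Rd d → ℂ) → (Rd d → ℂ) :=
  ((List.finRange d).map fun i => (pderiv' i)^[k i]).foldr (· ∘ ·) id

/-- The action of `D^k δ_λ` on a test function: `φ ↦ (-1)^{‖k‖} (D^k φ)(λ)`. -/
def dkDelta {d : ℕ} (k : Fin d → ℕ) (lam : Rd d) (φ : SchwartzMap (Rd d) ℂ) : ℂ :=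
  (-1 : ℂ) ^ (∑ i, k i) * Dmulti k (⇑φ) lam

/-- The exponential `e^{2πi⟨x,w⟩}`. -/
def e2pi {d : ℕ} (x w : Rd d) : ℂ :=
  Complex.exp (((2 * Real.pi : ℝ) : ℂ) * Complex.I * ((⟪x, w⟫ : ℝ) : ℂ))

/-- A trigonometric polynomial: a finite sum `Σ c_ω e^{2πi⟨x,ω⟩}`. -/
def IsTrigPoly {d : ℕ} (P : Rd d → ℂ) : Prop :=
  ∃ (n : ℕ) (cc : Fin n → ℂ) (w : Fin n → Rd d),
    ∀ x, P x = ∑ i, cc i * e2pi x (w i)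

/-- The monomial `x^m = x₁^{m₁} ⋯ x_d^{m_d}` (as a complex number). -/
def monom {d : ℕ} (m : Fin d → ℕ) (x : Rd d) : ℂ := ((∏ i, (x i) ^ (m i) : ℝ) : ℂ)

/-- The total variation of the pure point measure with masses `b` on the open
ball `B(0,r)`: `Σ_{|γ| < r} |b(γ)|` (as an extended nonnegative real). -/
def ballVar {d : ℕ} (b : Rd d → ℂ) (r : ℝ) : ℝ≥0∞ :=
  ∑' γ : Rd d, if ‖γ‖ < r then (‖b γ‖₊ : ℝ≥0∞) else 0

/-- The pure point measure `μ = Σ_λ a(λ) δ_λ` belongs to `S*(ℝ^d)` and is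
represented there by the tempered distribution `f`: its support is countable,
`Σ_λ |a(λ)| |φ(λ)| < ∞` for every Schwartz function `φ`, and the (automatically
continuous) functional `φ ↦ Σ_λ a(λ) φ(λ)` coincides with `f`. -/
def RepMeasure {d : ℕ} (a : Rd d → ℂ) (f : TemperedDist d) : Prop :=
  {x | a x ≠ 0}.Countable ∧
  (∀ φ : SchwartzMap (Rd d) ℂ, Summable fun lam => ‖a lam‖ * ‖φ lam‖) ∧
  (∀ φ : SchwartzMap (Rd d) ℂ, f φ = ∑' lam, a lam * φ lam)

/-- A continuous function on `ℝ^d` is almost periodic if for every `ε > 0` its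
set of `ε`-almost periods is relatively dense. -/
def APFunction {d : ℕ} (g : Rd d → ℂ) : Prop :=
  Continuous g ∧ ∀ ε > (0:ℝ), RelDense {τ : Rd d | ∀ t, ‖g (t + τ) - g t‖ < ε}

/-- A tempered distribution is almost periodic if for every smooth compactly
supported `ψ` the function `t ↦ f(ψ(t - ·))` is almost periodic. -/
def APDistribution {d : ℕ} (f : TemperedDist d) : Prop :=
  ∀ ψ : Rd d → ℂ, ContDiff ℝ (⊤ : ℕ∞) ψ → HasCompactSupport ψ →
    ∀ Φ : Rd d → SchwartzMap (Rd d) ℂ, (∀ t y, Φ t y = ψ (t - y)) →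
      APFunction fun t => f (Φ t)

section Sys
open Filter Topology

/-- limit along an ultrafilter -/
def ulim {ι : Type} {V : Type*} [TopologicalSpace V] [Nonempty V] (U : Ultrafilter ι) (u : ι → V) : V :=
  limUnder (U : Filter ι) u

theorem ulim_tendsto {ι : Type} {V : Type*} [NormedAddCommGroup V] [ProperSpace V]
    (U : Ultrafilter ι) (u : ι → V) (C : ℝ) (h : ∀ᶠ i in (U : Filter ι), ‖u i‖ ≤ C) :
    Tendsto u (U : Filter ι) (𝓝 (ulim U u)) := by
  apply tendsto_nhds_limUnder
  have hc : IsCompact (closedBall (0 : V) C) := isCompact_closedBall 0 C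
  have h2 : closedBall (0 : V) C ∈ (U.map u) := by
    rw [Ultrafilter.mem_map]
    filter_upwards [h] with i hi
    simpa using hi
  obtain ⟨x, -, hx⟩ := hc.ultrafilter_le_nhds' (U.map u) h2
  exact ⟨x, hx⟩

theorem ulim_eq {ι : Type} {V : Type*} [TopologicalSpace V] [T2Space V] [Nonempty V]
    {U : Ultrafilter ι} {u : ι → V} {a : V} (h : Tendsto u (U : Filter ι) (𝓝 a)) :
    ulim U u = a := h.limUnder_eq

/-- product of ultrafilters -/
def uprod {ι κ : Type} (U : Ultrafilter ι) (V : Ultrafilter κ) : Ultrafilter (ι × κ) :=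
  U.bind fun i => V.map (Prod.mk i)

theorem eventually_uprod {ι κ : Type} {U : Ultrafilter ι} {V : Ultrafilter κ} {p : ι × κ → Prop} :
    (∀ᶠ x in (uprod U V : Filter (ι × κ)), p x) ↔
      ∀ᶠ i in (U : Filter ι), ∀ᶠ j in (V : Filter κ), p (i, j) := by
  change {x | p x} ∈ (uprod U V) ↔ _
  rfl

/-- iterated limits -/
theorem tendsto_uprod {ι κ : Type} {X : Type*} [TopologicalSpace X] [RegularSpace X]
    {U : Ultrafilter ι} {V : Ultrafilter κ} {F : ι × κ → X} {G : ι → X} {a : X}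
    (h1 : ∀ i, Tendsto (fun j => F (i, j)) (V : Filter κ) (𝓝 (G i)))
    (h2 : Tendsto G (U : Filter ι) (𝓝 a)) : Tendsto F (uprod U V : Filter (ι × κ)) (𝓝 a) := by
  rw [(closed_nhds_basis a).tendsto_right_iff]
  rintro s ⟨hs, hsc⟩
  rw [eventually_uprod]
  have h3 : ∀ᶠ i in (U : Filter ι), G i ∈ interior s := h2 (interior_mem_nhds.2 hs)
  filter_upwards [h3] with i hi
  exact (h1 i) (mem_interior_iff_mem_nhds.1 hi)

/-- A recurrent system. -/
structure IsSys {ι : Type} (U : Ultrafilter ι) (m : ι → ℕ) : Prop where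
  top : Tendsto m (U : Filter ι) atTop
  one : ∀ z : ℂ, ‖z‖ = 1 → Tendsto (fun i => z ^ (m i)) (U : Filter ι) (𝓝 1)

theorem IsSys.prod {ι κ : Type} {U : Ultrafilter ι} {V : Ultrafilter κ} {m : ι → ℕ} {n : κ → ℕ}
    (h : IsSys U m) (h' : IsSys V n) : IsSys (uprod U V) fun x => m x.1 + n x.2 := by
  constructor
  · rw [Filter.tendsto_atTop]
    intro b
    rw [eventually_uprod]
    filter_upwards [(Filter.tendsto_atTop.1 h.top) b] with i hi
    exact Eventually.of_forall fun j => by omega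
  · intro z hz
    refine tendsto_uprod (G := fun i => z ^ m i) ?_ (h.one z hz)
    intro i
    simp only [pow_add]
    simpa using (h'.one z hz).const_mul (z ^ m i)

theorem exists_isSys : ∃ (U : Ultrafilter (ℕ × ℕ)) (m : ℕ × ℕ → ℕ), IsSys U m := by
  obtain ⟨U, hU⟩ := Ultrafilter.exists_le (atTop : Filter ℕ)
  refine ⟨uprod U U, fun x => x.2 - x.1, ?_, ?_⟩
  · rw [Filter.tendsto_atTop]
    intro b
    rw [eventually_uprod]
    refine Eventually.of_forall fun i => hU ?_
    filter_upwards [eventually_ge_atTop (b + i)] with j hj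
    omega
  · intro z hz
    have hz0 : z ≠ 0 := by rintro rfl; simp at hz
    have hw := ulim_tendsto U (fun i => z ^ i) 1 (Eventually.of_forall fun i => by simp [hz])
    set w := ulim U (fun i => z ^ i)
    have hw1 : ‖w‖ = 1 := by
      have := hw.norm
      simp only [norm_pow, hz, one_pow] at this
      exact (tendsto_nhds_unique this tendsto_const_nhds)
    have hw0 : w ≠ 0 := by rintro h; simp [h] at hw1
    refine tendsto_uprod (G := fun i => w * (z ^ i)⁻¹) ?_ ?_
    · intro i
      refine (hw.mul_const ((z ^ i)⁻¹)).congr' ?_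
      refine hU ?_
      filter_upwards [eventually_ge_atTop i] with j hj
      rw [pow_sub₀ z hz0 hj]
    · have := (hw.inv₀ hw0).const_mul w
      rwa [mul_inv_cancel₀ hw0] at this

end Sys

section Ext
open Filter Topology

theorem ext_one {ι : Type*} (z : ι → ℂ) (hz : ∀ i, ‖z i‖ = 1) (n : ℕ) :
    ∀ (c : ℕ → ι → ℂ) (_ : ∀ l, Summable (c l))
      (_ : ∀ j : ℕ, ∑ l ∈ Finset.range (n + 1), (j : ℂ) ^ l * ∑' i, c l i * z i ^ j = 0),
      ∑' i, (if z i = 1 then c 0 i else 0) = 0 := by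
  have hsz : ∀ (c : ι → ℂ), Summable c → ∀ j : ℕ, Summable fun i => c i * z i ^ j := by
    intro c hc j
    apply Summable.of_norm
    simpa [hz] using hc.norm
  induction n with
  | zero =>
    intro c hc h
    simp only [zero_add, Finset.range_one, Finset.sum_singleton, pow_zero, one_mul] at h
    have key : Tendsto (fun N : ℕ => ∑' i, c 0 i * ((∑ j ∈ Finset.range N, z i ^ j) / N)) atTop
        (𝓝 (∑' i, (if z i = 1 then c 0 i else 0))) := by
      apply tendsto_tsum_of_dominated_convergence (bound := fun i => ‖c 0 i‖) (hc 0).norm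
      · intro i
        by_cases h1 : z i = 1
        · simp only [h1, one_pow, Finset.sum_const, Finset.card_range, nsmul_eq_mul, mul_one, if_true]
          refine tendsto_const_nhds.congr' ?_
          filter_upwards [eventually_gt_atTop 0] with N hN
          have : (N : ℂ) ≠ 0 := by exact_mod_cast hN.ne'
          field_simp
        · simp only [h1, if_false]
          have h2 : Tendsto (fun N : ℕ => (z i ^ N - 1) / (z i - 1) / N) atTop (𝓝 0) := by
            rw [tendsto_zero_iff_norm_tendsto_zero]
            have h3 : Tendsto (fun N : ℕ => (2 / ‖z i - 1‖) * (1 / (N : ℝ))) atTop (𝓝 0) := by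
              simpa using (tendsto_one_div_atTop_nhds_zero_nat (𝕜 := ℝ)).const_mul (2 / ‖z i - 1‖)
            refine squeeze_zero (fun _ => norm_nonneg _) (fun N => ?_) h3
            rw [norm_div, norm_div, div_eq_mul_one_div _ (‖(N : ℂ)‖), Complex.norm_natCast]
            gcongr
            calc ‖z i ^ N - 1‖ ≤ ‖z i ^ N‖ + ‖(1 : ℂ)‖ := norm_sub_le _ _
              _ = 2 := by rw [norm_pow, hz]; norm_num
          have h4 := h2.const_mul (c 0 i)
          rw [mul_zero] at h4
          refine h4.congr fun N => ?_
          rw [geom_sum_eq h1]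
      · refine Eventually.of_forall fun N i => ?_
        rw [norm_mul]
        refine mul_le_of_le_one_right (norm_nonneg _) ?_
        rw [norm_div, Complex.norm_natCast]
        refine div_le_one_of_le₀ ?_ (Nat.cast_nonneg _)
        refine (norm_sum_le _ _).trans ?_
        simp [hz]
    refine tendsto_nhds_unique key ?_
    refine tendsto_const_nhds.congr fun N => ?_
    have : ∀ i, c 0 i * ((∑ j ∈ Finset.range N, z i ^ j) / N)
        = ∑ j ∈ Finset.range N, (c 0 i * z i ^ j) * (1 / N) := by
      intro i
      rw [← Finset.sum_mul, ← Finset.mul_sum]; ring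
    simp_rw [this]
    rw [Summable.tsum_finsetSum (fun j _ => (hsz _ (hc 0) j).mul_right _)]
    simp_rw [tsum_mul_right, h]
    simp
  | succ n ih =>
    intro c hc h
    refine ih c hc fun j => ?_
    set A : ℕ → ℂ := fun j => ∑' i, c (n + 1) i * z i ^ j with hA
    suffices hA0 : ∀ j, A j = 0 by
      have := h j
      rw [Finset.sum_range_succ] at this
      have h0 : ∑' i, c (n + 1) i * z i ^ j = 0 := hA0 j
      rwa [h0, mul_zero, add_zero] at this
    have hAt : Tendsto A atTop (𝓝 0) := by
      rw [tendsto_zero_iff_norm_tendsto_zero]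
      set C : ℝ := ∑ l ∈ Finset.range (n + 1), ∑' i, ‖c l i‖ with hC
      have h3 : Tendsto (fun N : ℕ => C * (1 / (N : ℝ))) atTop (𝓝 0) := by
        simpa using (tendsto_one_div_atTop_nhds_zero_nat (𝕜 := ℝ)).const_mul C
      refine squeeze_zero' (Eventually.of_forall fun _ => norm_nonneg _) ?_ h3
      filter_upwards [eventually_ge_atTop 1] with N hN
      have hN0 : (1 : ℝ) ≤ N := by exact_mod_cast hN
      have h4 := h N
      rw [Finset.sum_range_succ] at h4
      have h5 : (N : ℂ) ^ (n + 1) * A N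
          = - ∑ l ∈ Finset.range (n + 1), (N : ℂ) ^ l * ∑' i, c l i * z i ^ N := by
        rw [eq_neg_iff_add_eq_zero, add_comm]; exact h4
      have h6 : (N : ℝ) ^ (n + 1) * ‖A N‖ ≤ (N : ℝ) ^ n * C := by
        have := congrArg norm h5
        rw [norm_mul, norm_neg, norm_pow, Complex.norm_natCast] at this
        rw [this, hC, Finset.mul_sum]
        refine (norm_sum_le _ _).trans (Finset.sum_le_sum fun l hl => ?_)
        rw [norm_mul, norm_pow, Complex.norm_natCast]
        have hl' : l ≤ n := by rw [Finset.mem_range] at hl; omega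
        refine mul_le_mul (pow_le_pow_right₀ hN0 hl') ?_ (norm_nonneg _) (by positivity)
        have h7 : (fun i => ‖c l i * z i ^ N‖) = fun i => ‖c l i‖ := by
          funext i; simp [hz]
        calc _ ≤ ∑' i, ‖c l i * z i ^ N‖ := norm_tsum_le_tsum_norm (by rw [h7]; exact (hc l).norm)
          _ = _ := by rw [h7]
      have h8 : (0 : ℝ) < (N : ℝ) ^ n := by positivity
      rw [pow_succ, mul_assoc] at h6
      have h9 := le_of_mul_le_mul_left h6 h8
      rw [mul_one_div, le_div_iff₀ (by linarith)]
      linarith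
    intro j
    obtain ⟨U, m, hU⟩ := exists_isSys
    have h1 : Tendsto (fun x => A (j + m x)) (U : Filter (ℕ × ℕ)) (𝓝 (A j)) := by
      apply tendsto_tsum_of_dominated_convergence (bound := fun i => ‖c (n + 1) i‖) (hc _).norm
      · intro i
        have := ((hU.one (z i) (hz i)).const_mul (c (n + 1) i * z i ^ j))
        rw [mul_one] at this
        refine this.congr fun x => ?_
        rw [pow_add]; ring
      · exact Eventually.of_forall fun x i => by simp [hz]
    have h2 : Tendsto (fun x => A (j + m x)) (U : Filter (ℕ × ℕ)) (𝓝 0) :=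
      hAt.comp (tendsto_atTop_mono (fun x => Nat.le_add_left _ _) hU.top)
    exact tendsto_nhds_unique h1 h2

variable {d : ℕ}

theorem norm_e2pi (x w : Rd d) : ‖e2pi x w‖ = 1 := by
  rw [e2pi, show ((2 * Real.pi : ℝ) : ℂ) * Complex.I * ((⟪x, w⟫ : ℝ) : ℂ)
    = ((2 * Real.pi * ⟪x, w⟫ : ℝ) : ℂ) * Complex.I by push_cast; ring]
  exact Complex.norm_exp_ofReal_mul_I _

theorem e2pi_add_left (x y w : Rd d) : e2pi (x + y) w = e2pi x w * e2pi y w := by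
  rw [e2pi, e2pi, e2pi, ← Complex.exp_add, inner_add_left]; congr 1; push_cast; ring

theorem e2pi_comm (x w : Rd d) : e2pi x w = e2pi w x := by
  rw [e2pi, e2pi, real_inner_comm]

theorem e2pi_add_right (x y w : Rd d) : e2pi w (x + y) = e2pi w x * e2pi w y := by
  rw [e2pi_comm, e2pi_add_left, e2pi_comm x, e2pi_comm y]

theorem e2pi_zero_left (w : Rd d) : e2pi 0 w = 1 := by simp [e2pi]

theorem e2pi_zero_right (w : Rd d) : e2pi w 0 = 1 := by simp [e2pi]

theorem e2pi_neg_left (x w : Rd d) : e2pi (-x) w = (starRingEnd ℂ) (e2pi x w) := by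
  rw [e2pi, e2pi, ← Complex.exp_conj, inner_neg_left]; congr 1; simp only [map_mul, Complex.conj_ofReal, Complex.conj_I]; push_cast; ring

theorem e2pi_neg_right (x w : Rd d) : e2pi x (-w) = (starRingEnd ℂ) (e2pi x w) := by
  rw [e2pi_comm, e2pi_neg_left, e2pi_comm]

theorem e2pi_nsmul_left (j : ℕ) (x w : Rd d) : e2pi ((j : ℝ) • x) w = e2pi x w ^ j := by
  rw [e2pi, e2pi, ← Complex.exp_nat_mul, real_inner_smul_left]; congr 1; push_cast; ring

theorem e2pi_ne_zero (x w : Rd d) : e2pi x w ≠ 0 := Complex.exp_ne_zero _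

theorem e2pi_mul_conj (x w : Rd d) : e2pi x w * (starRingEnd ℂ) (e2pi x w) = 1 := by
  rw [Complex.mul_conj, Complex.normSq_eq_norm_sq, norm_e2pi]; simp

theorem e2pi_eq_one {x w : Rd d} (h : e2pi x w = 1) : ∃ k : ℤ, ⟪x, w⟫ = (k : ℝ) := by
  rw [e2pi, Complex.exp_eq_one_iff] at h
  obtain ⟨k, hk⟩ := h
  refine ⟨k, ?_⟩
  have h2 : (2 * Real.pi * Complex.I : ℂ) ≠ 0 := Complex.two_pi_I_ne_zero
  have : (2 * Real.pi * Complex.I : ℂ) * ((⟪x, w⟫ : ℝ) : ℂ) = (2 * Real.pi * Complex.I : ℂ) * (k : ℂ) := by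
    rw [mul_comm _ (k : ℂ), ← hk]; push_cast; ring
  exact_mod_cast mul_left_cancel₀ h2 this

theorem exists_generic (A : Set (Rd d)) (hA : A.Countable) :
    ∃ ω : Rd d, ∀ s ∈ A, s ≠ 0 → e2pi ω s ≠ 1 := by
  have hnull : ∀ s : Rd d, s ≠ 0 → ∀ k : ℤ, volume {ω : Rd d | ⟪ω, s⟫ = (k : ℝ)} = 0 := by
    intro s hs k
    let P : AffineSubspace ℝ (Rd d) :=
      { carrier := {ω : Rd d | ⟪ω, s⟫ = (k : ℝ)}
        smul_vsub_vadd_mem' := by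
          intro c p1 p2 p3 h1 h2 h3
          simp only [mem_ofPred_eq] at *
          rw [vsub_eq_sub, vadd_eq_add, inner_add_left, real_inner_smul_left, inner_sub_left, h1, h2, h3]
          ring }
    have hP : P ≠ ⊤ := by
      intro h
      have h0 : (0 : Rd d) ∈ P := by rw [h]; trivial
      have h1 : s ∈ P := by rw [h]; trivial
      have h0' : ⟪(0 : Rd d), s⟫ = (k : ℝ) := h0
      have h1' : ⟪s, s⟫ = (k : ℝ) := h1
      rw [inner_zero_left] at h0'
      rw [← h0'] at h1'
      exact hs (inner_self_eq_zero.1 h1')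
    exact Measure.addHaar_affineSubspace volume P hP
  have h1 : volume (⋃ s ∈ (A \ {0}), ⋃ k : ℤ, {ω : Rd d | ⟪ω, s⟫ = (k : ℝ)}) = 0 := by
    rw [measure_biUnion_null_iff (hA.mono sdiff_subset)]
    intro s hs
    rw [measure_iUnion_null_iff]
    exact hnull s (by simpa using hs.2)
  have h2 : (⋃ s ∈ (A \ {0}), ⋃ k : ℤ, {ω : Rd d | ⟪ω, s⟫ = (k : ℝ)}) ≠ univ := by
    intro h
    rw [h] at h1
    exact (NeZero.ne (volume : Measure (Rd d))) (Measure.measure_univ_eq_zero.1 h1)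
  obtain ⟨ω, hω⟩ := (ne_univ_iff_exists_notMem _).1 h2
  refine ⟨ω, fun s hs hs0 h => hω ?_⟩
  obtain ⟨k, hk⟩ := e2pi_eq_one h
  simp only [mem_iUnion]
  exact ⟨s, ⟨hs, by simpa using hs0⟩, k, hk⟩

theorem monom_smul (m : Fin d → ℕ) (r : ℝ) (x : Rd d) :
    monom m (r • x) = (r : ℂ) ^ (∑ i, m i) * monom m x := by
  simp only [monom, PiLp.smul_apply, smul_eq_mul, mul_pow, Finset.prod_mul_distrib,
    Finset.prod_pow_eq_pow_sum]
  push_cast; rfl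

/-- polynomial summable family -/
def PSF {ι : Type*} (F : Rd d → ι → ℂ) : Prop :=
  ∃ (T : Finset (Fin d → ℕ)) (c : (Fin d → ℕ) → ι → ℂ), (∀ m, Summable (c m)) ∧
    ∀ η i, F η i = ∑ m ∈ T, monom m η * c m i

theorem PSF.summable {ι : Type*} {F : Rd d → ι → ℂ} (h : PSF F) (η : Rd d) : Summable (F η) := by
  obtain ⟨T, c, hc, hF⟩ := h
  have : F η = fun i => ∑ m ∈ T, monom m η * c m i := funext fun i => hF η i
  rw [this]
  exact summable_sum fun m _ => (hc m).mul_left _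

theorem summable_mul_e2pi {ι : Type*} {F : ι → ℂ} (h : Summable F) (η : Rd d) (s : ι → Rd d) :
    Summable fun i => F i * e2pi η (s i) := by
  apply Summable.of_norm
  simpa [norm_e2pi] using h.norm

/-- `E` is a polynomially weighted almost periodic function with zero mean coefficient `b`. -/
def IsM (E : Rd d → ℂ) (b : ℂ) : Prop :=
  ∃ (ι : Type) (F : Rd d → ι → ℂ) (s : ι → Rd d), PSF F ∧
    (∀ η, E η = ∑' i, F η i * e2pi η (s i)) ∧ b = ∑' i, (if s i = 0 then F 0 i else 0)

theorem IsM.eq_zero {E : Rd d → ℂ} {b : ℂ} (h : IsM E b) (h0 : ∀ η, E η = 0) : b = 0 := by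
  obtain ⟨ι, F, s, ⟨T, c, hc, hF⟩, hE, rfl⟩ := h
  obtain ⟨ω, hω⟩ := exists_generic (⋃ m ∈ T, s '' (Function.support (c m))) (by
    refine Countable.biUnion T.countable_toSet fun m _ => Countable.image ?_ _
    exact (hc m).countable_support)
  set c' : ℕ → ι → ℂ := fun l i => ∑ m ∈ T with (∑ a, m a) = l, monom m ω * c m i with hc'
  have hs' : ∀ l, Summable (c' l) := fun l => summable_sum fun m _ => (hc m).mul_left _
  set n := T.sup fun m => ∑ a, m a with hn
  have key := ext_one (fun i => e2pi ω (s i)) (fun i => norm_e2pi _ _) n c' hs' ?_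
  · refine Eq.trans ?_ key
    refine tsum_congr fun i => ?_
    have h1 : F 0 i = c' 0 i := by
      rw [hF, hc']
      simp only
      rw [Finset.sum_filter]
      refine Finset.sum_congr rfl fun m _ => ?_
      have := monom_smul m 0 ω
      rw [zero_smul] at this
      rw [this]
      split_ifs with hm
      · rw [hm]; simp
      · simp [hm]
    by_cases hci : c' 0 i = 0
    · simp [h1, hci]
    have : ∃ m ∈ T, c m i ≠ 0 := by
      by_contra! hcon
      apply hci
      refine Finset.sum_eq_zero fun m hm => ?_
      rw [hcon m (Finset.mem_filter.1 hm).1, mul_zero]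
    obtain ⟨m, hm, hmi⟩ := this
    have hsi : s i ∈ (⋃ m ∈ T, s '' (Function.support (c m))) := by
      simp only [mem_iUnion]
      exact ⟨m, hm, i, hmi, rfl⟩
    by_cases hs0 : s i = 0
    · simp [hs0, e2pi_zero_right, h1]
    · simp [hs0, hω _ hsi hs0]
  · intro j
    have h1 := h0 ((j : ℝ) • ω)
    rw [hE] at h1
    rw [← h1]
    have h2 : ∀ l, (j : ℂ) ^ l * ∑' i, c' l i * e2pi ω (s i) ^ j
        = ∑' i, (j : ℂ) ^ l * c' l i * e2pi ((j : ℝ) • ω) (s i) := by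
      intro l
      rw [← tsum_mul_left]
      simp_rw [e2pi_nsmul_left, mul_assoc]
    simp_rw [h2]
    rw [← Summable.tsum_finsetSum]
    · refine tsum_congr fun i => ?_
      rw [← Finset.sum_mul, hF]
      congr 1
      simp only [hc', Finset.mul_sum, monom_smul]
      rw [← Finset.sum_fiberwise_of_maps_to (s := T) (t := Finset.range (n + 1)) (g := fun m => ∑ a, m a)]
      · refine Finset.sum_congr rfl fun l _ => Finset.sum_congr rfl fun m hm => ?_
        rw [(Finset.mem_filter.1 hm).2]; push_cast; ring
      · intro m hm
        rw [Finset.mem_range]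
        exact Nat.lt_succ_of_le (Finset.le_sup (f := fun m => ∑ a, m a) hm)
    · intro l _
      exact summable_mul_e2pi ((hs' l).mul_left _) _ _

theorem PSF.smul {ι : Type*} {F : Rd d → ι → ℂ} (h : PSF F) (a : ℂ) : PSF fun η i => a * F η i := by
  obtain ⟨T, c, hc, hF⟩ := h
  refine ⟨T, fun m i => a * c m i, fun m => (hc m).mul_left _, fun η i => ?_⟩
  simp only [hF, Finset.mul_sum]
  exact Finset.sum_congr rfl fun m _ => by ring

theorem IsM.smul {E : Rd d → ℂ} {b : ℂ} (h : IsM E b) (a : ℂ) : IsM (fun η => a * E η) (a * b) := by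
  obtain ⟨ι, F, s, hF, hE, rfl⟩ := h
  refine ⟨ι, fun η i => a * F η i, s, hF.smul a, fun η => ?_, ?_⟩
  · simp only [hE, ← tsum_mul_left, mul_assoc]
  · simp only [← tsum_mul_left, mul_ite, mul_zero]

theorem PSF.sum_elim {ι κ : Type*} {F : Rd d → ι → ℂ} {G : Rd d → κ → ℂ} (h : PSF F) (h' : PSF G) :
    PSF fun η => Sum.elim (F η) (G η) := by
  classical
  obtain ⟨T, c, hc, hF⟩ := h
  obtain ⟨T', c', hc', hG⟩ := h'
  refine ⟨T ∪ T', fun m => Sum.elim (if m ∈ T then c m else 0) (if m ∈ T' then c' m else 0), fun m => ?_, ?_⟩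
  · have h1 : Summable (if m ∈ T then c m else 0) := by split_ifs; exacts [hc m, summable_zero]
    have h2 : Summable (if m ∈ T' then c' m else 0) := by split_ifs; exacts [hc' m, summable_zero]
    exact (HasSum.sum (f := Sum.elim (if m ∈ T then c m else 0) (if m ∈ T' then c' m else 0))
      h1.hasSum h2.hasSum).summable
  · rintro η (i | i)
    · simp only [Sum.elim_inl, hF]
      rw [← Finset.sum_subset (Finset.subset_union_left (s₁ := T) (s₂ := T'))]
      · exact Finset.sum_congr rfl fun m hm => by simp [hm]
      · intro m _ hm; simp [hm]
    · simp only [Sum.elim_inr, hG]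
      rw [← Finset.sum_subset (Finset.subset_union_right (s₁ := T) (s₂ := T'))]
      · exact Finset.sum_congr rfl fun m hm => by simp [hm]
      · intro m _ hm; simp [hm]

theorem summable_ite {ι : Type*} {F : ι → ℂ} (h : Summable F) (p : ι → Prop) [DecidablePred p] :
    Summable fun i => if p i then F i else 0 := by
  apply Summable.of_norm_bounded h.norm
  intro i
  split_ifs <;> simp

theorem IsM.add {E E' : Rd d → ℂ} {b b' : ℂ} (h : IsM E b) (h' : IsM E' b') :
    IsM (fun η => E η + E' η) (b + b') := by
  obtain ⟨ι, F, s, hF, hE, rfl⟩ := h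
  obtain ⟨κ, G, s', hG, hE', rfl⟩ := h'
  refine ⟨ι ⊕ κ, fun η => Sum.elim (F η) (G η), Sum.elim s s', hF.sum_elim hG, fun η => ?_, ?_⟩
  · rw [Summable.tsum_sum]
    · simp only [Sum.elim_inl, Sum.elim_inr, hE, hE']
    · exact summable_mul_e2pi (hF.summable η) η s
    · exact summable_mul_e2pi (hG.summable η) η s'
  · rw [Summable.tsum_sum]
    · rfl
    · exact summable_ite (hF.summable 0) (fun i => s i = 0)
    · exact summable_ite (hG.summable 0) (fun i => s' i = 0)

theorem IsM.zero : IsM (fun _ : Rd d => 0) 0 :=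
  ⟨Empty, fun _ _ => 0, fun _ => 0, ⟨∅, fun _ _ => 0, fun _ => summable_zero, by simp⟩, by simp, by simp⟩

theorem IsM.sum {κ : Type*} (T : Finset κ) (E : κ → Rd d → ℂ) (b : κ → ℂ) (h : ∀ l ∈ T, IsM (E l) (b l)) :
    IsM (fun η => ∑ l ∈ T, E l η) (∑ l ∈ T, b l) := by
  classical
  induction T using Finset.induction_on with
  | empty => simpa using IsM.zero
  | insert a T ha ih =>
    simp only [Finset.sum_insert ha]
    exact (h a (by simp)).add (ih fun l hl => h l (by simp [hl]))

end Ext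

section Weight
open Filter Topology
variable {d : ℕ}

def W0 (x : Rd d) : ℝ := ((1 + ‖x‖) ^ (d + 1))⁻¹

theorem W0_pos (x : Rd d) : 0 < W0 x := by unfold W0; positivity

theorem W0_le_one (x : Rd d) : W0 x ≤ 1 := by
  unfold W0
  exact inv_le_one_of_one_le₀ (one_le_pow₀ (by linarith [norm_nonneg x]))

theorem W0_zero : W0 (0 : Rd d) = 1 := by simp [W0]

theorem W0_neg (x : Rd d) : W0 (-x) = W0 x := by simp [W0]

theorem W0_continuous : Continuous (W0 : Rd d → ℝ) := by
  unfold W0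
  refine Continuous.inv₀ (by fun_prop) fun x => by positivity

theorem W0_shift (x s : Rd d) (hs : ‖s‖ ≤ 1) : W0 x ≤ 2 ^ (d + 1) * W0 (x + s) := by
  unfold W0
  rw [← div_eq_mul_inv, inv_eq_one_div, div_le_div_iff₀ (by positivity) (by positivity), one_mul, ← mul_pow]
  refine pow_le_pow_left₀ (by positivity) ?_ _
  have := norm_add_le x s
  linarith [norm_nonneg x]

/-- bounded density of a set in terms of weights -/
def BD (D : ℝ) (A : Set (Rd d)) : Prop :=
  ∀ (h : Rd d) (F : Finset (Rd d)), (∀ x ∈ F, x + h ∈ A) → ∑ x ∈ F, W0 x ≤ D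

theorem BD.nonneg {D : ℝ} {A : Set (Rd d)} (h : BD D A) : 0 ≤ D := by
  simpa using h 0 ∅ (by simp)

theorem BD.mono {D : ℝ} {A B : Set (Rd d)} (h : BD D A) (hB : B ⊆ A) : BD D B :=
  fun g F hF => h g F fun x hx => hB (hF x hx)

theorem BD.union {D D' : ℝ} {A B : Set (Rd d)} (h : BD D A) (h' : BD D' B) : BD (D + D') (A ∪ B) := by
  classical
  intro g F hF
  rw [← Finset.sum_filter_add_sum_filter_not F (fun x => x + g ∈ A)]
  refine add_le_add (h g _ fun x hx => (Finset.mem_filter.1 hx).2) (h' g _ fun x hx => ?_)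
  have := Finset.mem_filter.1 hx
  exact (hF x this.1).resolve_left this.2

theorem BD.shift {D : ℝ} {A : Set (Rd d)} (h : BD D A) (g : Rd d) : BD D {x | x + g ∈ A} := by
  intro k F hF
  refine h (k + g) F fun x hx => ?_
  rw [← add_assoc]
  exact hF x hx

theorem BD.sum_le {D : ℝ} {A : Set (Rd d)} (h : BD D A) {V : Type*} [NormedAddCommGroup V]
    (b : Rd d → V) (hb : ∀ x, b x ≠ 0 → x ∈ A) (C : ℝ) (hC : 0 ≤ C) (t : Rd d)
    (hbC : ∀ x, ‖b x‖ ≤ C * W0 (t - x)) (F : Finset (Rd d)) : ∑ x ∈ F, ‖b x‖ ≤ C * D := by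
  classical
  rw [← Finset.sum_filter_add_sum_filter_not F (fun x => b x ≠ 0)]
  have h2 : ∑ x ∈ F with ¬ b x ≠ 0, ‖b x‖ = 0 :=
    Finset.sum_eq_zero fun x hx => by
      have := (Finset.mem_filter.1 hx).2
      simpa using this
  rw [h2, add_zero]
  refine (Finset.sum_le_sum fun x _ => hbC x).trans ?_
  rw [← Finset.mul_sum]
  refine mul_le_mul_of_nonneg_left ?_ hC
  have h3 := h t ((F.filter fun x => b x ≠ 0).image fun x => x - t) (by
    intro x hx
    rw [Finset.mem_image] at hx
    obtain ⟨y, hy, rfl⟩ := hx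
    rw [sub_add_cancel]
    exact hb y (Finset.mem_filter.1 hy).2)
  rw [Finset.sum_image (by intro x _ y _ hxy; simpa using hxy)] at h3
  refine le_trans (le_of_eq ?_) h3
  exact Finset.sum_congr rfl fun x _ => by rw [← W0_neg, neg_sub]

theorem BD.summable {D : ℝ} {A : Set (Rd d)} (h : BD D A) {V : Type*} [NormedAddCommGroup V]
    (b : Rd d → V) (hb : ∀ x, b x ≠ 0 → x ∈ A) (C : ℝ) (hC : 0 ≤ C) (t : Rd d)
    (hbC : ∀ x, ‖b x‖ ≤ C * W0 (t - x)) : Summable (fun x => ‖b x‖) ∧ ∑' x, ‖b x‖ ≤ C * D := by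
  have := h.sum_le b hb C hC t hbC
  have hs := summable_of_sum_le (fun x => norm_nonneg (b x)) this
  exact ⟨hs, hs.tsum_le_of_sum_le this⟩

theorem W0_integrable : Integrable (W0 : Rd d → ℝ) := by
  have := integrable_one_add_norm (E := Rd d) (μ := volume) (r := (d + 1 : ℝ)) (by simp)
  refine this.congr (Eventually.of_forall fun x => ?_)
  simp only [W0]
  rw [Real.rpow_neg (by positivity)]
  congr 1
  exact_mod_cast Real.rpow_natCast (1 + ‖x‖) (d + 1)

theorem UniformlyDiscrete.bd {A : Set (Rd d)} (hA : UniformlyDiscrete A) : ∃ D, BD D A := by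
  obtain ⟨η, hη, hA⟩ := hA
  set ρ : ℝ := min (η / 2) 1 with hρ
  have hρ0 : 0 < ρ := by positivity
  set v : ℝ := (volume : Measure (Rd d)).real (ball 0 ρ) with hv
  have hv0 : 0 < v := by
    rw [hv, Measure.real]
    exact ENNReal.toReal_pos (measure_ball_pos _ _ hρ0).ne' measure_ball_lt_top.ne
  refine ⟨v⁻¹ * (2 ^ (d + 1) * ∫ x : Rd d, W0 x), fun h F hF => ?_⟩
  rw [← div_eq_inv_mul, le_div_iff₀ hv0]
  have h1 : ∀ x : Rd d, W0 x * v ≤ 2 ^ (d + 1) * ∫ z in ball x ρ, W0 z := by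
    intro x
    have h2 : ∫ z in ball x ρ, W0 x = W0 x * v := by
      rw [setIntegral_const, hv, smul_eq_mul, mul_comm, Measure.real, Measure.real,
        Measure.addHaar_ball_center]
    rw [← h2, ← integral_const_mul]
    refine setIntegral_mono_on (integrable_const_iff.2 ?_) (W0_integrable.const_mul _).integrableOn
      measurableSet_ball fun z hz => ?_
    · right
      rw [isFiniteMeasure_restrict]
      exact measure_ball_lt_top.ne
    · have := W0_shift x (z - x) (by
        rw [← dist_eq_norm]
        exact ((mem_ball.1 hz).le).trans (min_le_right _ _))
      simpa using this
  rw [Finset.sum_mul]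
  refine (Finset.sum_le_sum fun x _ => h1 x).trans ?_
  rw [← Finset.mul_sum]
  refine mul_le_mul_of_nonneg_left ?_ (by positivity)
  rw [← integral_biUnion_finset (f := W0)]
  · exact setIntegral_le_integral W0_integrable (Eventually.of_forall fun x => (W0_pos x).le)
  · exact fun x _ => measurableSet_ball
  · intro x hx y hy hxy
    refine ball_disjoint_ball ?_
    have h3 := hA _ (hF x hx) _ (hF y hy) (by simpa using hxy)
    rw [dist_add_right] at h3
    have : ρ ≤ η / 2 := min_le_left _ _
    linarith
  · exact fun x _ => W0_integrable.integrableOn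

theorem one_add_norm_le (x y : Rd d) : 1 + ‖x‖ ≤ (1 + ‖y‖) * (1 + ‖y - x‖) := by
  have : ‖x‖ ≤ ‖y‖ + ‖y - x‖ := by
    have := norm_sub_le y (y - x)
    rwa [sub_sub_cancel] at this
  nlinarith [norm_nonneg y, norm_nonneg (y - x)]

/-- objects -/
def Obj {V : Type*} [NormedAddCommGroup V] (u : Rd d → V) : Prop :=
  (∃ D, BD D (Function.support u)) ∧ ∃ (C : ℝ) (H : ℕ), ∀ x, ‖u x‖ ≤ C * (1 + ‖x‖) ^ H

end Weight

section UL
open Filter Topology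
set_option linter.unusedSectionVars false

variable {ι : Type} {d : ℕ}

theorem exists_max_card {α : Type*} (P : Finset α → Prop) (N : ℕ) (hN : ∀ B, P B → B.card ≤ N)
    (h0 : P ∅) : ∃ B, P B ∧ ∀ B', P B' → B'.card ≤ B.card := by
  classical
  have := Nat.findGreatest_spec (P := fun k => ∃ B, P B ∧ B.card = k) (Nat.zero_le N) ⟨∅, h0, rfl⟩
  obtain ⟨B, hB, hc⟩ := this
  refine ⟨B, hB, fun B' hB' => ?_⟩
  rw [hc]
  exact Nat.le_findGreatest (hN B' hB') ⟨B', hB', rfl⟩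

/-- infinitesimal germs -/
def Infi (U : Ultrafilter ι) (d : ℕ) : Type :=
  {s : Quotient ((U : Filter ι).germSetoid (Rd d)) // Tendsto (Quotient.out s) (U : Filter ι) (𝓝 0)}

def Infi.rep {U : Ultrafilter ι} (s : Infi U d) : ι → Rd d := Quotient.out s.1

theorem Infi.tendsto {U : Ultrafilter ι} (s : Infi U d) : Tendsto s.rep (U : Filter ι) (𝓝 0) := s.2

theorem Infi.rep_ne {U : Ultrafilter ι} {s t : Infi U d} (h : s ≠ t) :
    ∀ᶠ i in (U : Filter ι), s.rep i ≠ t.rep i := by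
  rw [Ultrafilter.eventually_not]
  intro h2
  apply h
  apply Subtype.ext
  rw [← Quotient.out_eq s.1, ← Quotient.out_eq t.1]
  exact Quotient.sound h2

theorem exists_infi {U : Ultrafilter ι} (y : ι → Rd d) (hy : Tendsto y (U : Filter ι) (𝓝 0)) :
    ∃ s : Infi U d, ∀ᶠ i in (U : Filter ι), s.rep i = y i := by
  have h1 : ∀ᶠ i in (U : Filter ι),
      (Quotient.out (Quotient.mk ((U : Filter ι).germSetoid (Rd d)) y)) i = y i :=
    Quotient.mk_out (s := (U : Filter ι).germSetoid (Rd d)) y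
  exact ⟨⟨Quotient.mk _ y, hy.congr' (by filter_upwards [h1] with i hi using hi.symm)⟩, h1⟩

variable {G : Type*} [NormedAddCommGroup G] [NormedSpace ℂ G] [ProperSpace G]

/-- limit along an infinitesimal germ -/
def uL (U : Ultrafilter ι) (u : ι → Rd d → G) (p : Rd d × Infi U d) : G :=
  ulim U (fun i => u i (p.1 + p.2.rep i))

/-- the limit object -/
def uLim (U : Ultrafilter ι) (u : ι → Rd d → G) (x : Rd d) : G := ∑' s : Infi U d, uL U u (x, s)

theorem pt_tendsto {U : Ultrafilter ι} (p : Rd d × Infi U d) :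
    Tendsto (fun i => p.1 + p.2.rep i) (U : Filter ι) (𝓝 p.1) := by
  simpa using p.2.tendsto.const_add p.1

theorem pt_ne {U : Ultrafilter ι} {p q : Rd d × Infi U d} (h : p ≠ q) :
    ∀ᶠ i in (U : Filter ι), p.1 + p.2.rep i ≠ q.1 + q.2.rep i := by
  by_cases h1 : p.1 = q.1
  · have : p.2 ≠ q.2 := fun h2 => h (Prod.ext h1 h2)
    filter_upwards [Infi.rep_ne this] with i hi
    rw [h1]
    simpa using hi
  · exact ((pt_tendsto p).sub (pt_tendsto q)).eventually_ne (sub_ne_zero.2 h1) |>.mono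
      fun i hi => sub_ne_zero.1 hi

theorem pt_injOn {U : Ultrafilter ι} (B : Finset (Rd d × Infi U d)) :
    ∀ᶠ i in (U : Filter ι), Set.InjOn (fun p : Rd d × Infi U d => p.1 + p.2.rep i) B := by
  have : ∀ᶠ i in (U : Filter ι), ∀ p ∈ B, ∀ q ∈ B, p ≠ q → p.1 + p.2.rep i ≠ q.1 + q.2.rep i := by
    rw [Filter.eventually_all_finset]
    intro p hp
    rw [Filter.eventually_all_finset]
    intro q hq
    by_cases h : p = q
    · simp [h]
    · filter_upwards [pt_ne h] with i hi _ using hi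
  filter_upwards [this] with i hi p hp q hq h
  by_contra h2
  exact hi p hp q hq h2 h

section data
variable {U : Ultrafilter ι} {u : ι → Rd d → G} {D C : ℝ} {H : ℕ}

theorem uL_tendsto (hg : ∀ i x, ‖u i x‖ ≤ C * (1 + ‖x‖) ^ H) (hC : 0 ≤ C) (p : Rd d × Infi U d) :
    Tendsto (fun i => u i (p.1 + p.2.rep i)) (U : Filter ι) (𝓝 (uL U u p)) := by
  refine ulim_tendsto U _ (C * (1 + (‖p.1‖ + 1)) ^ H) ?_
  have h1 := (pt_tendsto p).norm.eventually_le_const (show ‖p.1‖ < ‖p.1‖ + 1 by linarith)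
  filter_upwards [h1] with i hi
  refine (hg i _).trans ?_
  gcongr

theorem uL_norm_le (hg : ∀ i x, ‖u i x‖ ≤ C * (1 + ‖x‖) ^ H) (hC : 0 ≤ C) (p : Rd d × Infi U d) :
    ‖uL U u p‖ ≤ C * (1 + ‖p.1‖) ^ H := by
  refine le_of_tendsto_of_tendsto (uL_tendsto hg hC p).norm
    ((((pt_tendsto p).norm.const_add 1).pow H).const_mul C) (Eventually.of_forall fun i => hg i _)

theorem sum_W0_le (hD : ∀ i, BD D (Function.support (u i))) (h : Rd d) (B : Finset (Rd d × Infi U d))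
    (hB : ∀ᶠ i in (U : Filter ι), ∀ p ∈ B, u i (p.1 + p.2.rep i) ≠ 0) :
    ∑ p ∈ B, W0 (p.1 - h) ≤ D := by
  classical
  have ht : Tendsto (fun i => ∑ p ∈ B, W0 (p.1 + p.2.rep i - h)) (U : Filter ι)
      (𝓝 (∑ p ∈ B, W0 (p.1 - h))) := by
    refine tendsto_finsetSum _ fun p _ => ?_
    exact (W0_continuous.tendsto _).comp ((pt_tendsto p).sub_const h)
  refine le_of_tendsto ht ?_
  filter_upwards [hB, pt_injOn B] with i hi hinj
  rw [← Finset.sum_image (f := fun x => W0 (x)) (g := fun p : Rd d × Infi U d => p.1 + p.2.rep i - h)]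
  · refine hD i h _ fun x hx => ?_
    obtain ⟨p, hp, rfl⟩ := Finset.mem_image.1 hx
    simpa using hi p hp
  · intro p hp q hq hpq
    exact hinj hp hq (by simpa using hpq)

theorem uL_ev_ne (hg : ∀ i x, ‖u i x‖ ≤ C * (1 + ‖x‖) ^ H) (hC : 0 ≤ C) (B : Finset (Rd d × Infi U d))
    (hB : ∀ p ∈ B, uL U u p ≠ 0) : ∀ᶠ i in (U : Filter ι), ∀ p ∈ B, u i (p.1 + p.2.rep i) ≠ 0 := by
  rw [Filter.eventually_all_finset]
  exact fun p hp => (uL_tendsto hg hC p).eventually_ne (hB p hp)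

theorem uL_finite (hD : ∀ i, BD D (Function.support (u i)))
    (hg : ∀ i x, ‖u i x‖ ≤ C * (1 + ‖x‖) ^ H) (hC : 0 ≤ C) (x : Rd d) (F : Finset (Infi U d))
    (hF : ∀ s ∈ F, uL U u (x, s) ≠ 0) : (F.card : ℝ) ≤ D := by
  classical
  have := sum_W0_le hD x (F.image (fun s => (x, s))) (uL_ev_ne hg hC _ (by simpa using hF))
  rw [Finset.sum_image (by intro a _ b _ h; simpa using h)] at this
  simpa [W0_zero] using this

theorem uL_support_finite (hD : ∀ i, BD D (Function.support (u i)))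
    (hg : ∀ i x, ‖u i x‖ ≤ C * (1 + ‖x‖) ^ H) (hC : 0 ≤ C) (x : Rd d) :
    (Function.support fun s : Infi U d => uL U u (x, s)).Finite := by
  by_contra h
  obtain ⟨F, hF, hc⟩ := Set.Infinite.exists_subset_card_eq h (⌈D⌉₊ + 1)
  have := uL_finite hD hg hC x F fun s hs => hF hs
  rw [hc] at this
  push_cast at this
  linarith [Nat.le_ceil D]

theorem uLim_bd (hD : ∀ i, BD D (Function.support (u i)))
    (hg : ∀ i x, ‖u i x‖ ≤ C * (1 + ‖x‖) ^ H) (hC : 0 ≤ C) : BD D (Function.support (uLim U u)) := by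
  classical
  intro h F hF
  have : ∀ x : F, ∃ s : Infi U d, uL U u ((x : Rd d) + h, s) ≠ 0 := by
    intro x
    by_contra! hx
    exact hF x x.2 (by simp [uLim, hx])
  choose s hs using this
  have h2 := sum_W0_le hD h (F.attach.image fun x : F => ((x : Rd d) + h, s x))
    (uL_ev_ne hg hC _ (by intro p hp; obtain ⟨x, -, rfl⟩ := Finset.mem_image.1 hp; exact hs x))
  rw [Finset.sum_image (by
    intro a _ b _ h
    simp only [Prod.mk.injEq, add_left_inj] at h
    exact Subtype.ext h.1)] at h2
  simp only [add_sub_cancel_right] at h2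
  rwa [Finset.sum_attach F (fun x => W0 x)] at h2

theorem uLim_norm_le (hD : ∀ i, BD D (Function.support (u i)))
    (hg : ∀ i x, ‖u i x‖ ≤ C * (1 + ‖x‖) ^ H) (hC : 0 ≤ C) (x : Rd d) :
    ‖uLim U u x‖ ≤ (D * C) * (1 + ‖x‖) ^ H := by
  have hf := uL_support_finite hD hg hC (U := U) x
  have h1 : uLim U u x = ∑ s ∈ hf.toFinset, uL U u (x, s) := by
    refine tsum_eq_sum fun s hs => ?_
    simpa using hs
  rw [h1]
  refine (norm_sum_le_of_le _ fun s _ => uL_norm_le hg hC (x, s)).trans ?_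
  dsimp only
  rw [Finset.sum_const, nsmul_eq_mul, mul_assoc]
  refine mul_le_mul_of_nonneg_right (uL_finite hD hg hC x _ fun s hs => by simpa using hs) (by positivity)

/-- maximal families of points -/
theorem exists_maxfam (hD : ∀ i, BD D (Function.support (u i))) (R : ℝ) :
    ∃ B : Finset (Rd d × Infi U d),
      (∀ᶠ i in (U : Filter ι), ∀ x, u i x ≠ 0 → ‖x‖ ≤ R → ∃ p ∈ B, x = p.1 + p.2.rep i) ∧
      ∀ p ∉ B, (∀ᶠ i in (U : Filter ι), u i (p.1 + p.2.rep i) ≠ 0) → R ≤ ‖p.1‖ := by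
  classical
  set good : Finset (Rd d × Infi U d) → Prop := fun B =>
    ∀ᶠ i in (U : Filter ι), ∀ p ∈ B, u i (p.1 + p.2.rep i) ≠ 0 ∧ ‖p.1 + p.2.rep i‖ ≤ R with hgood
  have hbd : ∀ B, good B → B.card ≤ ⌈D * (1 + R) ^ (d + 1)⌉₊ := by
    intro B hB
    have h1 := sum_W0_le hD 0 B (by filter_upwards [hB] with i hi p hp using (hi p hp).1)
    simp only [sub_zero] at h1
    have h2 : ∀ p ∈ B, ((1 + R) ^ (d + 1))⁻¹ ≤ W0 p.1 := by
      intro p hp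
      have : ‖p.1‖ ≤ R := le_of_tendsto (pt_tendsto p).norm (by filter_upwards [hB] with i hi using (hi p hp).2)
      unfold W0
      gcongr
    have h3 := (Finset.card_nsmul_le_sum B _ _ h2).trans h1
    rw [nsmul_eq_mul] at h3
    rcases B.eq_empty_or_nonempty with rfl | ⟨p, hp⟩
    · simp
    have hR : 0 ≤ R := (norm_nonneg p.1).trans
      (le_of_tendsto (pt_tendsto p).norm (by filter_upwards [hB] with i hi using (hi p hp).2))
    rw [← div_eq_mul_inv, div_le_iff₀ (by positivity)] at h3
    exact_mod_cast h3.trans (Nat.le_ceil _)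
  obtain ⟨B, hB, hmax⟩ := exists_max_card good _ hbd (Eventually.of_forall (by simp))
  have hins : ∀ p, p ∉ B → ¬ ∀ᶠ i in (U : Filter ι), u i (p.1 + p.2.rep i) ≠ 0 ∧ ‖p.1 + p.2.rep i‖ ≤ R := by
    intro p hp h
    have := hmax (insert p B) (by
      filter_upwards [h, hB] with i h1 h2
      intro q hq
      rcases Finset.mem_insert.1 hq with rfl | hq
      exacts [h1, h2 q hq])
    rw [Finset.card_insert_of_notMem hp] at this
    omega
  refine ⟨B, ?_, ?_⟩
  · by_contra hcon
    rw [← Ultrafilter.eventually_not] at hcon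
    have hch : ∀ i, ∃ y : Rd d, (¬ ∀ x, u i x ≠ 0 → ‖x‖ ≤ R → ∃ p ∈ B, x = p.1 + p.2.rep i) →
        u i y ≠ 0 ∧ ‖y‖ ≤ R ∧ ∀ p ∈ B, y ≠ p.1 + p.2.rep i := by
      intro i
      by_cases h : ∀ x, u i x ≠ 0 → ‖x‖ ≤ R → ∃ p ∈ B, x = p.1 + p.2.rep i
      · exact ⟨0, fun h' => absurd h h'⟩
      · push Not at h
        obtain ⟨y, h1, h2, h3⟩ := h
        exact ⟨y, fun _ => ⟨h1, h2, h3⟩⟩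
    choose y hy using hch
    have hy' : ∀ᶠ i in (U : Filter ι), u i (y i) ≠ 0 ∧ ‖y i‖ ≤ R ∧ ∀ p ∈ B, y i ≠ p.1 + p.2.rep i := by
      filter_upwards [hcon] with i hi using hy i hi
    have hlim := ulim_tendsto U y R (by filter_upwards [hy'] with i hi using hi.2.1)
    set x := ulim U y
    obtain ⟨s, hs⟩ := exists_infi (U := U) (fun i => y i - x) (by simpa using hlim.sub_const x)
    have hs' : ∀ᶠ i in (U : Filter ι), x + s.rep i = y i := by
      filter_upwards [hs] with i hi
      rw [hi]; abel
    refine hins (x, s) ?_ ?_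
    · intro hmem
      obtain ⟨i, h1, h2⟩ := (hy'.and hs').exists
      exact h1.2.2 _ hmem h2.symm
    · filter_upwards [hy', hs'] with i h1 h2
      simp only [h2]
      exact ⟨h1.1, h1.2.1⟩
  · intro p hp h
    by_contra! hlt
    apply hins p hp
    filter_upwards [h, (pt_tendsto p).norm.eventually_le_const hlt] with i h1 h2 using ⟨h1, h2⟩

theorem uLim_pair (hD : ∀ i, BD D (Function.support (u i)))
    (hg : ∀ i x, ‖u i x‖ ≤ C * (1 + ‖x‖) ^ H) (hC : 0 ≤ C)
    (b : Rd d → G →L[ℂ] ℂ) (hb : Continuous b) (C' : ℝ) (hC' : 0 ≤ C')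
    (hb' : ∀ x, ‖b x‖ ≤ C' * ((1 + ‖x‖) ^ (H + d + 2))⁻¹) :
    Tendsto (fun i => ∑' x, b x (u i x)) (U : Filter ι) (𝓝 (∑' x, b x (uLim U u x))) := by
  classical
  have hprod : ∀ (x : Rd d) (v : G), ‖v‖ ≤ C * (1 + ‖x‖) ^ H →
      ‖b x v‖ ≤ C * C' * (1 + ‖x‖)⁻¹ * W0 x := by
    intro x v hv
    refine (ContinuousLinearMap.le_opNorm _ _).trans
      ((mul_le_mul (hb' x) hv (norm_nonneg _) (by positivity)).trans (le_of_eq ?_))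
    unfold W0
    have : (1 + ‖x‖) ≠ 0 := by positivity
    field_simp
    ring
  have hD0 : 0 ≤ D := by
    obtain ⟨i⟩ : Nonempty ι := (U : Filter ι).nonempty_of_neBot
    exact (hD i).nonneg
  -- summation over pairs
  set w : Rd d × Infi U d → ℂ := fun p => b p.1 (uL U u p) with hw
  have hwR : ∀ (R : ℝ) (F : Finset (Rd d × Infi U d)), 0 ≤ R → (∀ p ∈ F, uL U u p ≠ 0 → R ≤ ‖p.1‖) →
      ∑ p ∈ F, ‖w p‖ ≤ C * C' * D * (1 + R)⁻¹ := by
    intro R F hR hF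
    rw [← Finset.sum_filter_add_sum_filter_not F (fun p => uL U u p ≠ 0)]
    have h2 : ∑ p ∈ F with ¬ uL U u p ≠ 0, ‖w p‖ = 0 := by
      refine Finset.sum_eq_zero fun p hp => ?_
      have := (Finset.mem_filter.1 hp).2
      push Not at this
      simp [hw, this]
    rw [h2, add_zero]
    have h3 := sum_W0_le hD 0 (F.filter (fun p => uL U u p ≠ 0)) (uL_ev_ne hg hC _
      fun p hp => (Finset.mem_filter.1 hp).2)
    calc _ ≤ ∑ p ∈ F with uL U u p ≠ 0, C * C' * (1 + R)⁻¹ * W0 (p.1 - 0) := by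
          refine Finset.sum_le_sum fun p hp => ?_
          obtain ⟨h4, h5⟩ := Finset.mem_filter.1 hp
          refine (hprod p.1 _ (uL_norm_le hg hC p)).trans ?_
          have := hF p h4 h5
          have := (W0_pos p.1).le
          rw [sub_zero]
          gcongr
      _ ≤ C * C' * (1 + R)⁻¹ * D := by
          rw [← Finset.mul_sum]
          gcongr
      _ = _ := by ring
  have hws : Summable w := by
    refine Summable.of_norm (summable_of_sum_le (c := C * C' * D * (1 + 0)⁻¹) (fun _ => norm_nonneg _) fun F => ?_)
    exact hwR 0 F le_rfl fun p _ _ => norm_nonneg _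
  have hsum : ∑' x, b x (uLim U u x) = ∑' p, w p := by
    rw [hws.tsum_prod]
    refine tsum_congr fun x => ?_
    have hf := uL_support_finite hD hg hC (U := U) x
    have : Summable (fun s : Infi U d => uL U u (x, s)) := summable_of_hasFiniteSupport hf
    exact (b x).map_tsum this
  rw [hsum]
  rw [Metric.tendsto_nhds]
  intro ε hε
  obtain ⟨R, hR0, hR⟩ : ∃ R : ℝ, 0 ≤ R ∧ C * C' * D * (1 + R)⁻¹ < ε / 4 := by
    have h1 : Tendsto (fun R : ℝ => C * C' * D * (1 + R)⁻¹) atTop (𝓝 (C * C' * D * 0)) :=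
      (tendsto_inv_atTop_zero.comp (tendsto_atTop_add_const_left _ _ tendsto_id)).const_mul _
    rw [mul_zero] at h1
    obtain ⟨R, h2, h3⟩ := ((h1.eventually_lt_const (show 0 < ε / 4 by positivity)).and
      (eventually_ge_atTop 0)).exists
    exact ⟨R, h3, h2⟩
  obtain ⟨B, hB1, hB2⟩ := exists_maxfam (U := U) hD R
  have hhead : Tendsto (fun i => ∑ p ∈ B, b (p.1 + p.2.rep i) (u i (p.1 + p.2.rep i))) (U : Filter ι)
      (𝓝 (∑ p ∈ B, w p)) := by
    refine tendsto_finsetSum _ fun p _ => ?_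
    have h1 : Tendsto (fun i => b (p.1 + p.2.rep i)) (U : Filter ι) (𝓝 (b p.1)) :=
      (hb.tendsto _).comp (pt_tendsto p)
    exact (isBoundedBilinearMap_apply (𝕜 := ℂ) (E := G) (F := ℂ)).continuous.tendsto (b p.1, uL U u p)
      |>.comp (h1.prodMk_nhds (uL_tendsto hg hC p))
  have htail : ‖∑' p, w p - ∑ p ∈ B, w p‖ ≤ ε / 4 := by
    have h1 : Tendsto (fun F : Finset (Rd d × Infi U d) => ‖∑ p ∈ F, w p - ∑ p ∈ B, w p‖) atTop
        (𝓝 ‖∑' p, w p - ∑ p ∈ B, w p‖) := (hws.hasSum.sub_const _).norm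
    refine le_of_tendsto h1 ?_
    filter_upwards [eventually_ge_atTop B] with F hF
    rw [← Finset.sum_sdiff (show B ⊆ F from hF), add_sub_cancel_right]
    refine (norm_sum_le _ _).trans ((hwR R _ hR0 fun p hp h => ?_).trans hR.le)
    exact hB2 p (Finset.mem_sdiff.1 hp).2 ((uL_tendsto hg hC p).eventually_ne h)
  filter_upwards [hB1, pt_injOn B, Metric.tendsto_nhds.1 hhead (ε / 4) (by positivity)] with i h1 h2 h3
  -- tail for u i
  set z : Rd d → ℂ := fun x => b x (u i x) with hz
  have hzs : Summable z := by
    refine Summable.of_norm ((hD i).summable z (fun x hx => ?_) (C * C') (by positivity) 0 fun x => ?_).1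
    · intro h0
      simp [hz, h0] at hx
    · rw [zero_sub, W0_neg]
      refine (hprod x _ (hg i x)).trans ?_
      have := (W0_pos x).le
      have h5 : (1 + ‖x‖)⁻¹ ≤ 1 := inv_le_one_of_one_le₀ (by linarith [norm_nonneg x])
      have : C * C' * (1 + ‖x‖)⁻¹ ≤ C * C' * 1 := by gcongr
      rw [mul_one] at this
      gcongr
  set P : Finset (Rd d) := B.image (fun p => p.1 + p.2.rep i) with hP
  have hPs : ∑ x ∈ P, z x = ∑ p ∈ B, b (p.1 + p.2.rep i) (u i (p.1 + p.2.rep i)) :=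
    Finset.sum_image h2
  have hsplit : ∑' x, z x - ∑ x ∈ P, z x = ∑' x, (if x ∈ P then 0 else z x) := by
    rw [sub_eq_iff_eq_add', ← hzs.sum_add_tsum_compl (s := P)]
    congr 1
    rw [tsum_subtype (f := z)]
    refine tsum_congr fun x => ?_
    by_cases hx : x ∈ P <;> simp [Set.indicator, hx]
  have hrest : ‖∑' x, (if x ∈ P then 0 else z x)‖ ≤ ε / 4 := by
    have h6 := (hD i).summable (fun x => if x ∈ P then 0 else z x) (fun x hx h0 => ?_)
      (C * C' * (1 + R)⁻¹) (by positivity) 0 (fun x => ?_)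
    · refine (norm_tsum_le_tsum_norm h6.1).trans (h6.2.trans (le_trans (le_of_eq ?_) hR.le))
      ring
    · apply hx
      simp [hz, h0]
    · have hW := (W0_pos x).le
      rw [zero_sub, W0_neg]
      split_ifs with hx
      · simp only [norm_zero]; positivity
      · by_cases h0 : u i x = 0
        · simp only [hz, h0, map_zero, norm_zero]; positivity
        have : R ≤ ‖x‖ := by
          by_contra! hlt
          obtain ⟨p, hp, hpx⟩ := h1 x h0 hlt.le
          exact hx (Finset.mem_image.2 ⟨p, hp, hpx.symm⟩)
        refine (hprod x _ (hg i x)).trans ?_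
        gcongr
  rw [dist_eq_norm] at h3 ⊢
  calc ‖∑' x, z x - ∑' p, w p‖ = ‖(∑' x, z x - ∑ x ∈ P, z x) + (∑ x ∈ P, z x - ∑ p ∈ B, w p)
        - (∑' p, w p - ∑ p ∈ B, w p)‖ := by congr 1; ring
    _ ≤ ‖∑' x, z x - ∑ x ∈ P, z x‖ + ‖∑ x ∈ P, z x - ∑ p ∈ B, w p‖ + ‖∑' p, w p - ∑ p ∈ B, w p‖ :=
        (norm_sub_le _ _).trans (by gcongr; exact norm_add_le _ _)
    _ < ε := by
        rw [hsplit, hPs]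
        linarith

end data
end UL

section HD
open Filter Topology
set_option linter.unusedSectionVars false

/-- abstract translation space -/
structure HD (d : ℕ) (S : Type) [Fintype S] (X : Type) [NormedAddCommGroup X] [InnerProductSpace ℂ X] where
  Uo : Rd d → X →L[ℂ] X
  ev : Rd d → X →L[ℂ] (S → ℂ)
  C : ℝ
  A : ℝ
  hC : 0 ≤ C
  hA : 0 ≤ A
  U0 : ∀ v, Uo 0 v = v
  Uadd : ∀ g h v, Uo (g + h) v = Uo g (Uo h v)
  Unorm : ∀ g v, ‖Uo g v‖ = ‖v‖
  evU : ∀ x h v, ev x (Uo h v) = ev (x + h) v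
  evb : ∀ x v, ‖ev x v‖ ≤ C * ‖v‖
  I1 : ∀ v B, (∀ F : Finset (Rd d), ∑ x ∈ F, W0 x * ‖ev x v‖ ^ 2 ≤ B) → ‖v‖ ^ 2 ≤ A * B

variable {d : ℕ} {S : Type} [Fintype S] {X : Type} [NormedAddCommGroup X] [InnerProductSpace ℂ X]
  [CompleteSpace X]

namespace HD
variable (Q : HD d S X)

theorem ext_zero (v : X) (h : ∀ x, Q.ev x v = 0) : v = 0 := by
  have := Q.I1 v 0 (fun F => by simp [h])
  simpa using this

theorem ext_eq (v w : X) (h : ∀ x, Q.ev x v = Q.ev x w) : v = w := by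
  rw [← sub_eq_zero]
  exact Q.ext_zero _ fun x => by rw [map_sub, h, sub_self]

theorem inner_U (g : Rd d) (v w : X) : inner ℂ (Q.Uo g v) (Q.Uo g w) = inner ℂ v w :=
  LinearIsometry.inner_map_map (⟨(Q.Uo g : X →ₗ[ℂ] X), Q.Unorm g⟩ : X →ₗᵢ[ℂ] X) v w

theorem U_comm (g h : Rd d) (v : X) : Q.Uo g (Q.Uo h v) = Q.Uo h (Q.Uo g v) := by
  rw [← Q.Uadd, add_comm, Q.Uadd]

theorem U_neg (g : Rd d) (v : X) : Q.Uo g (Q.Uo (-g) v) = v := by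
  rw [← Q.Uadd, add_neg_cancel, Q.U0]

theorem U_neg' (g : Rd d) (v : X) : Q.Uo (-g) (Q.Uo g v) = v := by
  rw [← Q.Uadd, neg_add_cancel, Q.U0]

theorem adj_U (g : Rd d) (v w : X) : inner ℂ v (Q.Uo g w) = inner ℂ (Q.Uo (-g) v) w := by
  rw [← Q.inner_U g (Q.Uo (-g) v), Q.U_neg]

theorem exists_T {ι : Type} (U : Ultrafilter ι) (h : ι → Rd d) (v : X) :
    ∃ v' : X, ∀ w, Tendsto (fun i => inner ℂ (Q.Uo (h i) v) w) (U : Filter ι) (𝓝 (inner ℂ v' w)) := by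
  have hb : ∀ w i, ‖(inner ℂ (Q.Uo (h i) v) w : ℂ)‖ ≤ ‖v‖ * ‖w‖ := fun w i => by
    have := norm_inner_le_norm (𝕜 := ℂ) (Q.Uo (h i) v) w
    rwa [Q.Unorm] at this
  have ht : ∀ w, Tendsto (fun i => (inner ℂ (Q.Uo (h i) v) w : ℂ)) (U : Filter ι)
      (𝓝 (ulim U fun i => (inner ℂ (Q.Uo (h i) v) w : ℂ))) := fun w =>
    ulim_tendsto U _ _ (Eventually.of_forall (hb w))
  let l : X →ₗ[ℂ] ℂ :=
    { toFun := fun w => ulim U fun i => (inner ℂ (Q.Uo (h i) v) w : ℂ)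
      map_add' := fun w w' => ulim_eq (((ht w).add (ht w')).congr fun i => (inner_add_right _ _ _).symm)
      map_smul' := fun c w => ulim_eq (((ht w).const_mul c).congr fun i => (inner_smul_right _ _ _).symm) }
  let L : X →L[ℂ] ℂ := l.mkContinuous ‖v‖ fun w =>
    le_of_tendsto (ht w).norm (Eventually.of_forall (hb w))
  refine ⟨(InnerProductSpace.toDual ℂ X).symm L, fun w => ?_⟩
  rw [InnerProductSpace.toDual_symm_apply]
  exact ht w

/-- weak limits of translates -/
def T {ι : Type} (U : Ultrafilter ι) (h : ι → Rd d) (v : X) : X := Classical.choose (Q.exists_T U h v)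

section
variable {ι : Type} (U : Ultrafilter ι) (h : ι → Rd d)

theorem T_spec' (v w : X) :
    Tendsto (fun i => inner ℂ (Q.Uo (h i) v) w) (U : Filter ι) (𝓝 (inner ℂ (Q.T U h v) w)) :=
  Classical.choose_spec (Q.exists_T U h v) w

theorem T_spec (v w : X) :
    Tendsto (fun i => inner ℂ w (Q.Uo (h i) v)) (U : Filter ι) (𝓝 (inner ℂ w (Q.T U h v))) := by
  have := (Complex.continuous_conj.tendsto _).comp (Q.T_spec' U h v w)
  simpa [Function.comp_def, inner_conj_symm] using this

theorem T_unique {v v' : X}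
    (hv : ∀ w, Tendsto (fun i => inner ℂ w (Q.Uo (h i) v)) (U : Filter ι) (𝓝 (inner ℂ w v'))) :
    Q.T U h v = v' :=
  ext_inner_left ℂ fun w => tendsto_nhds_unique (Q.T_spec U h v w) (hv w)

theorem T_add (v w : X) : Q.T U h (v + w) = Q.T U h v + Q.T U h w := by
  refine Q.T_unique U h fun z => ?_
  simpa [inner_add_right] using (Q.T_spec U h v z).add (Q.T_spec U h w z)

theorem T_zero : Q.T U h 0 = 0 := by
  refine Q.T_unique U h fun z => by simp

theorem T_sum {α : Type*} (F : Finset α) (v : α → X) :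
    Q.T U h (∑ a ∈ F, v a) = ∑ a ∈ F, Q.T U h (v a) := by
  classical
  induction F using Finset.induction_on with
  | empty => simp [T_zero]
  | insert a F ha ih => rw [Finset.sum_insert ha, Finset.sum_insert ha, T_add, ih]

theorem T_U (g : Rd d) (v : X) : Q.T U h (Q.Uo g v) = Q.Uo g (Q.T U h v) := by
  refine Q.T_unique U h fun z => ?_
  rw [Q.adj_U]
  refine (Q.T_spec U h v _).congr fun i => ?_
  rw [← Q.adj_U, Q.U_comm]

theorem adj_T (v w : X) : inner ℂ v (Q.T U h w) = inner ℂ (Q.T U (fun i => -h i) v) w := by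
  refine tendsto_nhds_unique (Q.T_spec U h w v) ((Q.T_spec' U (fun i => -h i) v w).congr fun i => ?_)
  rw [← Q.adj_U]

theorem T_comm {κ : Type} (V : Ultrafilter κ) (k : κ → Rd d) (v : X) :
    Q.T U h (Q.T V k v) = Q.T V k (Q.T U h v) := by
  refine Q.T_unique U h fun w => ?_
  have h1 := Q.T_spec U h v (Q.T V (fun i => -k i) w)
  rw [← Q.adj_T] at h1
  refine h1.congr fun i => ?_
  rw [← Q.adj_T, Q.T_U]

theorem T_norm_le (v : X) : ‖Q.T U h v‖ ≤ ‖v‖ := by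
  have h1 := (Q.T_spec U h v (Q.T U h v)).norm
  have h2 : ‖(inner ℂ (Q.T U h v) (Q.T U h v) : ℂ)‖ ≤ ‖Q.T U h v‖ * ‖v‖ :=
    le_of_tendsto h1 (Eventually.of_forall fun i => by
      have := norm_inner_le_norm (𝕜 := ℂ) (Q.T U h v) (Q.Uo (h i) v)
      rwa [Q.Unorm] at this)
  rw [inner_self_eq_norm_sq_to_K] at h2
  have h3 : ‖Q.T U h v‖ ^ 2 ≤ ‖Q.T U h v‖ * ‖v‖ := by simpa using h2
  by_contra! hlt
  nlinarith [norm_nonneg v]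

theorem ev_T (x : Rd d) (v : X) :
    Tendsto (fun i => Q.ev (x + h i) v) (U : Filter ι) (𝓝 (Q.ev x (Q.T U h v))) := by
  rw [tendsto_pi_nhds]
  intro j
  let L : X →L[ℂ] ℂ := (ContinuousLinearMap.proj j).comp (Q.ev x)
  have h1 := Q.T_spec U h v ((InnerProductSpace.toDual ℂ X).symm L)
  simp only [InnerProductSpace.toDual_symm_apply] at h1
  refine h1.congr fun i => ?_
  simp [L, Q.evU]

theorem T_bd {D : ℝ} {v : X} (hD : BD D {x | Q.ev x v ≠ 0}) : BD D {x | Q.ev x (Q.T U h v) ≠ 0} := by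
  intro g F hF
  have : ∀ᶠ i in (U : Filter ι), ∀ x ∈ F, Q.ev (x + g + h i) v ≠ 0 := by
    rw [Filter.eventually_all_finset]
    exact fun x hx => (Q.ev_T U h (x + g) v).eventually_ne (hF x hx)
  obtain ⟨i, hi⟩ := this.exists
  exact hD (g + h i) F fun x hx => by simpa [add_assoc] using hi x hx

theorem T_congr {h h' : ι → Rd d} (hh : ∀ᶠ i in (U : Filter ι), h i = h' i) (v : X) :
    Q.T U h v = Q.T U h' v := by
  refine Q.T_unique U h fun w => (Q.T_spec U h' v w).congr' ?_
  filter_upwards [hh] with i hi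
  rw [hi]

theorem T_prod {κ : Type} (V : Ultrafilter κ) (k : κ → Rd d) (v : X) :
    Q.T (uprod U V) (fun x => h x.1 + k x.2) v = Q.T U h (Q.T V k v) := by
  refine Q.T_unique _ _ fun w => ?_
  refine tendsto_uprod (G := fun i => inner ℂ w (Q.Uo (h i) (Q.T V k v))) (fun i => ?_) (Q.T_spec U h _ w)
  rw [Q.adj_U]
  refine (Q.T_spec V k v _).congr fun j => ?_
  rw [← Q.adj_U, Q.Uadd]

theorem T_strong {v : X} (hv : Q.T U h v = v) :
    Tendsto (fun i => ‖Q.Uo (h i) v - v‖) (U : Filter ι) (𝓝 0) := by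
  have h1 := Q.T_spec U h v v
  rw [hv] at h1
  have h2 : Tendsto (fun i => 2 * ‖v‖ ^ 2 - 2 * RCLike.re (inner ℂ v (Q.Uo (h i) v))) (U : Filter ι)
      (𝓝 (2 * ‖v‖ ^ 2 - 2 * RCLike.re (inner ℂ v v : ℂ))) :=
    (((RCLike.continuous_re.tendsto _).comp h1).const_mul 2).const_sub _
  rw [inner_self_eq_norm_sq, sub_self] at h2
  have h3 : Tendsto (fun i => ‖Q.Uo (h i) v - v‖ ^ 2) (U : Filter ι) (𝓝 0) := by
    refine h2.congr fun i => ?_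
    rw [norm_sub_rev, norm_sub_sq (𝕜 := ℂ), Q.Unorm]
    ring
  have h4 := (Real.continuous_sqrt.tendsto _).comp h3
  simpa [Function.comp_def, Real.sqrt_sq] using h4

end

/-- shifts of a germ in a direction -/
def sh {ι : Type} {U : Ultrafilter ι} (m : ι → ℕ) (e : Rd d) (s : Infi U d) : ι → Rd d :=
  fun i => s.rep i + (m i : ℝ) • e

/-- packing bound -/
theorem card_le {ι : Type} {U : Ultrafilter ι} (m : ι → ℕ) (e : Rd d) {f : X} {D : ℝ}
    (hD : BD D {x | Q.ev x f ≠ 0}) (F : Finset (Infi U d)) (hF : ∀ s ∈ F, Q.T U (sh m e s) f ≠ 0) :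
    (F.card : ℝ) ≤ Q.A * Q.C ^ 2 * D := by
  classical
  set u : ι → Rd d → S → ℂ := fun i x => Q.ev (x + (m i : ℝ) • e) f with hu
  have hsub : ∀ c : ℝ, 0 ≤ c → c < 1 → c * F.card ≤ Q.A * Q.C ^ 2 * D := by
    intro c hc0 hc1
    have hex : ∀ s ∈ F, ∃ B : Finset (Rd d), (∀ x ∈ B, Q.ev x (Q.T U (sh m e s) f) ≠ 0) ∧
        c ≤ Q.A * Q.C ^ 2 * ∑ x ∈ B, W0 x := by
      intro s hs
      set v := Q.T U (sh m e s) f with hv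
      have hv0 : 0 < ‖v‖ ^ 2 := by have := norm_pos_iff.2 (hF s hs); positivity
      by_contra! hcon
      have hAC : 0 < Q.A := by
        by_contra! h0
        have : Q.A = 0 := le_antisymm h0 Q.hA
        obtain ⟨B, hB⟩ : ∃ B : ℝ, ∀ F : Finset (Rd d), ∑ x ∈ F, W0 x * ‖Q.ev x v‖ ^ 2 ≤ B := by
          refine ⟨Q.C ^ 2 * ‖v‖ ^ 2 * D, fun F => ?_⟩
          have h1 := (Q.T_bd U (sh m e s) hD).sum_le (fun x => ((W0 x * ‖Q.ev x v‖ ^ 2 : ℝ))) (fun x hx h0 => ?_)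
            (Q.C ^ 2 * ‖v‖ ^ 2) (by positivity) 0 (fun x => ?_) F
          · refine le_trans (Finset.sum_le_sum fun x _ => le_abs_self _) h1
          · apply hx
            rw [← hv] at h0
            simp [h0]
          · rw [zero_sub, W0_neg, Real.norm_of_nonneg (by have := (W0_pos x).le; positivity), mul_comm]
            have := (W0_pos x).le
            have := Q.evb x v
            rw [← mul_pow]
            gcongr
        have := Q.I1 v B hB
        rw [‹Q.A = 0›, zero_mul] at this
        linarith
      have h2 := Q.I1 v (c * ‖v‖ ^ 2 / Q.A) (fun B => ?_)
      · rw [mul_div_cancel₀ _ hAC.ne'] at h2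
        nlinarith
      · have h3 := hcon (B.filter fun x => Q.ev x v ≠ 0) (fun x hx => (Finset.mem_filter.1 hx).2)
        have h4 : ∑ x ∈ B, W0 x * ‖Q.ev x v‖ ^ 2 ≤ (Q.C ^ 2 * ‖v‖ ^ 2) * ∑ x ∈ B with Q.ev x v ≠ 0, W0 x := by
          rw [Finset.mul_sum, Finset.sum_filter]
          refine Finset.sum_le_sum fun x _ => ?_
          split_ifs with h5
          · have := (W0_pos x).le
            have := Q.evb x v
            rw [← mul_pow, mul_comm]
            gcongr
          · push Not at h5
            simp [h5]
        rw [le_div_iff₀ hAC]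
        nlinarith
    choose! B hB1 hB2 using hex
    have hg : ∀ i x, ‖u i x‖ ≤ (Q.C * ‖f‖) * (1 + ‖x‖) ^ 0 := fun i x => by
      rw [pow_zero, mul_one]; exact Q.evb _ _
    have h6 := sum_W0_le (U := U) (u := u) (D := D) (fun i => hD.shift _) 0
      ((F.sigma B).image fun p => (p.2, p.1)) ?_
    · rw [Finset.sum_image, Finset.sum_sigma] at h6
      · simp only [sub_zero] at h6
        calc c * F.card = ∑ s ∈ F, c := by simp [mul_comm]
          _ ≤ ∑ s ∈ F, Q.A * Q.C ^ 2 * ∑ x ∈ B s, W0 x := Finset.sum_le_sum hB2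
          _ ≤ _ := by
            rw [← Finset.mul_sum]
            have := Q.hA
            gcongr
      · rintro ⟨a, b⟩ _ ⟨a', b'⟩ _ h
        simp only [Prod.mk.injEq] at h
        obtain ⟨rfl, rfl⟩ := h
        rfl
    · rw [Filter.eventually_all_finset]
      intro p hp
      obtain ⟨⟨s, x⟩, hsx, rfl⟩ := Finset.mem_image.1 hp
      rw [Finset.mem_sigma] at hsx
      have := (Q.ev_T U (sh m e s) x f).eventually_ne (hB1 s hsx.1 x hsx.2)
      filter_upwards [this] with i hi
      simpa [hu, sh, add_assoc] using hi
  have hlim : Tendsto (fun c : ℝ => c * F.card) (𝓝[<] 1) (𝓝 (1 * F.card)) :=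
    (tendsto_id.mul_const _).mono_left nhdsWithin_le_nhds
  rw [one_mul] at hlim
  refine le_of_tendsto hlim ?_
  filter_upwards [Ioo_mem_nhdsLT (show (0:ℝ) < 1 by norm_num)] with c hc
  exact hsub c hc.1.le hc.2

end HD
end HD

section HD2
open Filter Topology
set_option linter.unusedSectionVars false
variable {d : ℕ} {S : Type} [Fintype S] {X : Type} [NormedAddCommGroup X] [InnerProductSpace ℂ X]
  [CompleteSpace X]

namespace HD
variable (Q : HD d S X)

/-- recurrence in a direction -/
def Rec (f : X) (e : Rd d) : Prop :=
  ∀ (ι : Type) (U : Ultrafilter ι) (m : ι → ℕ), IsSys U m → ∀ x,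
    uLim U (fun i x => Q.ev (x + (m i : ℝ) • e) f) x = Q.ev x f

theorem decomp {f : X} {e : Rd d} (hR : Q.Rec f e) {ι : Type} {U : Ultrafilter ι} {m : ι → ℕ}
    (hs : IsSys U m) (F : Finset (Infi U d)) (hF : ∀ s ∉ F, Q.T U (sh m e s) f = 0) :
    f = ∑ s ∈ F, Q.T U (sh m e s) f := by
  refine Q.ext_eq _ _ fun x => ?_
  rw [← hR ι U m hs x, map_sum]
  have h1 : ∀ s : Infi U d, uL U (fun i x => Q.ev (x + (m i : ℝ) • e) f) (x, s) =
      Q.ev x (Q.T U (sh m e s) f) := by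
    intro s
    refine ulim_eq ((Q.ev_T U (sh m e s) x f).congr fun i => ?_)
    simp [sh, add_assoc]
  unfold uLim
  simp only [h1]
  exact tsum_eq_sum fun s hs => by rw [hF s hs, map_zero]

theorem exists_idem {f : X} {e : Rd d} (hR : Q.Rec f e) {D : ℝ} (hD : BD D {x | Q.ev x f ≠ 0}) :
    ∃ (ι : Type) (U : Ultrafilter ι) (m : ι → ℕ) (_ : IsSys U m) (F : Finset (Infi U d)),
      f = ∑ s ∈ F, Q.T U (sh m e s) f ∧
      ∀ s ∈ F, Q.T U (sh m e s) (Q.T U (sh m e s) f) = Q.T U (sh m e s) f := by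
  classical
  set P : ℕ → Prop := fun k => ∃ (ι : Type) (U : Ultrafilter ι) (m : ι → ℕ) (_ : IsSys U m)
    (F : Finset (Infi U d)), F.card = k ∧ ∀ s ∈ F, Q.T U (sh m e s) f ≠ 0 with hP
  set N := ⌈Q.A * Q.C ^ 2 * D⌉₊
  have hN : ∀ k, P k → k ≤ N := by
    rintro k ⟨ι, U, m, hs, F, rfl, hF⟩
    exact_mod_cast (Q.card_le m e hD F hF).trans (Nat.le_ceil _)
  have h0 : P 0 := by
    obtain ⟨U, m, hs⟩ := exists_isSys
    exact ⟨_, U, m, hs, ∅, rfl, by simp⟩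
  obtain ⟨ι, U, m, hs, F, hFc, hF⟩ := Nat.findGreatest_spec (P := P) (Nat.zero_le N) h0
  have hmax : ∀ k, P k → k ≤ F.card := fun k hk => by
    rw [hFc]; exact Nat.le_findGreatest (hN k hk) hk
  have hFall : ∀ s ∉ F, Q.T U (sh m e s) f = 0 := by
    intro s hsF
    by_contra hne
    have := hmax _ ⟨ι, U, m, hs, insert s F, rfl, by
      intro t ht
      rcases Finset.mem_insert.1 ht with rfl | ht
      exacts [hne, hF t ht]⟩
    rw [Finset.card_insert_of_notMem hsF] at this
    omega
  have hdec := Q.decomp hR hs F hFall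
  refine ⟨ι, U, m, hs, F, hdec, ?_⟩
  set t : Infi U d → X → X := fun s => Q.T U (sh m e s) with ht
  have hdec' : ∀ a, t a f = ∑ b ∈ F, t a (t b f) := by
    intro a
    conv_lhs => rw [hdec]
    exact Q.T_sum U _ F _
  -- the product system
  have hpair : ∀ a b : Infi U d, ∃ c : Infi (uprod U U) d, ∀ᶠ i in (uprod U U : Filter (ι × ι)),
      c.rep i = a.rep i.1 + b.rep i.2 := by
    intro a b
    apply exists_infi
    refine tendsto_uprod (G := fun i => a.rep i + 0) (fun i => b.tendsto.const_add _) ?_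
    simpa using a.tendsto
  choose c hc using hpair
  have hcT : ∀ a b, Q.T (uprod U U) (sh (fun x => m x.1 + m x.2) e (c a b)) f = t a (t b f) := by
    intro a b
    rw [ht]
    dsimp only
    rw [← Q.T_prod]
    refine Q.T_congr _ ?_ _
    filter_upwards [hc a b] with i hi
    simp only [sh, hi]
    push_cast
    rw [add_smul]
    abel
  have hcinj : ∀ a b a' b', c a b = c a' b' → a = a' ∧ b = b' := by
    intro a b a' b' h
    have h1 : ∀ᶠ i in (uprod U U : Filter (ι × ι)), a.rep i.1 + b.rep i.2 = a'.rep i.1 + b'.rep i.2 := by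
      filter_upwards [hc a b, hc a' b'] with i h1 h2
      rw [← h1, ← h2, h]
    rw [eventually_uprod] at h1
    have h2 : ∀ᶠ i in (U : Filter ι), a.rep i = a'.rep i := by
      filter_upwards [h1] with i hi
      have h3 : Tendsto (fun j => b'.rep j - b.rep j) (U : Filter ι) (𝓝 (a.rep i - a'.rep i)) := by
        refine tendsto_const_nhds.congr' ?_
        filter_upwards [hi] with j hj
        rw [sub_eq_sub_iff_add_eq_add, hj, add_comm]
      have h4 := tendsto_nhds_unique h3 (b'.tendsto.sub b.tendsto)
      rw [sub_zero] at h4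
      exact sub_eq_zero.1 h4
    have ha : a = a' := by
      by_contra hne
      obtain ⟨i, h3, h4⟩ := ((Infi.rep_ne hne).and h2).exists
      exact h3 h4
    refine ⟨ha, ?_⟩
    by_contra hne
    obtain ⟨i, hi⟩ := h1.exists
    obtain ⟨j, h3, h4⟩ := ((Infi.rep_ne hne).and hi).exists
    rw [ha] at h4
    exact h3 (add_left_cancel h4)
  -- relation
  have hF0 : ∀ s ∈ F, t s f ≠ 0 := hF
  have hcomm0 : ∀ a b, t a (t b f) = t b (t a f) := fun a b => Q.T_comm U _ U _ f
  change ∀ a ∈ F, t a (t a f) = t a f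
  clear_value t
  set R : Finset (Infi U d × Infi U d) := (F ×ˢ F).filter fun p => t p.1 (t p.2 f) ≠ 0 with hR'
  have hRc : R.card ≤ F.card := by
    refine hmax _ ⟨ι × ι, uprod U U, fun x => m x.1 + m x.2, hs.prod hs, R.image fun p => c p.1 p.2, ?_, ?_⟩
    · refine Finset.card_image_of_injOn ?_
      intro p _ q _ h
      exact Prod.ext (hcinj _ _ _ _ h).1 (hcinj _ _ _ _ h).2
    · intro s hs
      obtain ⟨p, hp, rfl⟩ := Finset.mem_image.1 hs
      rw [hcT]
      exact (Finset.mem_filter.1 hp).2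
  have hsurj : ∀ a ∈ F, ∃ b ∈ F, t a (t b f) ≠ 0 := by
    intro a ha
    by_contra! h
    exact hF0 a ha ((hdec' a).trans (Finset.sum_eq_zero h))
  have himg : R.image Prod.fst = F := by
    ext a
    constructor
    · intro ha
      obtain ⟨p, hp, rfl⟩ := Finset.mem_image.1 ha
      exact (Finset.mem_product.1 (Finset.mem_filter.1 hp).1).1
    · intro ha
      obtain ⟨b, hb, hab⟩ := hsurj a ha
      exact Finset.mem_image.2 ⟨(a, b), Finset.mem_filter.2 ⟨Finset.mem_product.2 ⟨ha, hb⟩, hab⟩, rfl⟩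
  have hinj : Set.InjOn Prod.fst (R : Set (Infi U d × Infi U d)) := by
    apply Finset.injOn_of_card_image_eq
    refine le_antisymm Finset.card_image_le ?_
    rw [himg]; exact hRc
  have huniq : ∀ a ∈ F, ∀ b ∈ F, ∀ b' ∈ F, t a (t b f) ≠ 0 → t a (t b' f) ≠ 0 → b = b' := by
    intro a ha b hb b' hb' h1 h2
    have m1 : (a, b) ∈ R := Finset.mem_filter.2 ⟨Finset.mem_product.2 ⟨ha, hb⟩, h1⟩
    have m2 : (a, b') ∈ R := Finset.mem_filter.2 ⟨Finset.mem_product.2 ⟨ha, hb'⟩, h2⟩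
    have := hinj (Finset.mem_coe.2 m1) (Finset.mem_coe.2 m2) rfl
    exact (Prod.ext_iff.1 this).2
  have hone : ∀ a ∈ F, ∀ b ∈ F, t a (t b f) ≠ 0 → t a f = t a (t b f) := by
    intro a ha b hb h
    rw [hdec' a]
    refine Finset.sum_eq_single b (fun b' hb' hne => ?_) (fun h => absurd hb h)
    by_contra h2
    exact hne (huniq a ha b' hb' b hb h2 h)
  intro a ha
  obtain ⟨b, hb, hab⟩ := hsurj a ha
  have h1 := hone a ha b hb hab
  have hcomm : t a (t b f) = t b (t a f) := hcomm0 a b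
  have h2 := hone b hb a ha (by rwa [← hcomm])
  have h3 : t a f = t b f := h1.trans (hcomm.trans h2.symm)
  exact (congrArg (t a) h3).trans h1.symm

/-- orbit under weak limits -/
inductive Orb (f : X) : X → Prop
  | base : Orb f f
  | step (v : X) (ι : Type) (U : Ultrafilter ι) (h : ι → Rd d) : Orb f v → Orb f (Q.T U h v)

theorem Orb.bd {Q : HD d S X} {f v : X} {D : ℝ} (hD : BD D {x | Q.ev x f ≠ 0}) (hv : Q.Orb f v) :
    BD D {x | Q.ev x v ≠ 0} := by
  induction hv with
  | base => exact hD
  | step v ι U h _ ih => exact Q.T_bd U h ih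

/-- near-invariance in direction e -/
def Inv (v : X) (e : Rd d) : Prop :=
  ∃ (ι : Type) (U : Ultrafilter ι) (m : ι → ℕ) (_ : IsSys U m) (s : Infi U d), Q.T U (sh m e s) v = v

theorem decomp_inv {f : X} {D : ℝ} (hD : BD D {x | Q.ev x f ≠ 0}) (l : List (Rd d))
    (hR : ∀ e ∈ l, Q.Rec f e) :
    f ∈ Submodule.span ℂ {v | Q.Orb f v ∧ ∀ e ∈ l, Q.Inv v e} := by
  induction l with
  | nil => exact Submodule.subset_span ⟨.base, by simp⟩
  | cons e l ih =>
    have ih := ih fun e he => hR e (List.mem_cons_of_mem _ he)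
    obtain ⟨ι, U, m, hs, F, hF1, hF2⟩ := Q.exists_idem (hR e List.mem_cons_self) hD
    refine Submodule.span_le.2 ?_ ih
    rintro v ⟨hv, hl⟩
    have h1 : v = ∑ s ∈ F, Q.T U (sh m e s) v ∧
        ∀ s ∈ F, Q.T U (sh m e s) (Q.T U (sh m e s) v) = Q.T U (sh m e s) v := by
      clear hl
      induction hv with
      | base => exact ⟨hF1, hF2⟩
      | step v κ V h _ ih =>
        constructor
        · conv_lhs => rw [ih.1]
          rw [Q.T_sum]
          exact Finset.sum_congr rfl fun s _ => Q.T_comm _ _ _ _ _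
        · intro s hs
          rw [Q.T_comm U _ V, Q.T_comm U _ V, ih.2 s hs]
    rw [SetLike.mem_coe, h1.1]
    refine Submodule.sum_mem _ fun s hsF => Submodule.subset_span ⟨.step _ _ _ _ hv, ?_⟩
    intro e' he'
    rcases List.mem_cons.1 he' with rfl | he'
    · exact ⟨ι, U, m, hs, s, h1.2 s hsF⟩
    · obtain ⟨κ, V, n, hn, s', h2⟩ := hl e' he'
      exact ⟨κ, V, n, hn, s', by rw [Q.T_comm, h2]⟩

end HD
end HD2

section HD3
open Filter Topology
set_option linter.unusedSectionVars false
variable {d : ℕ} {S : Type} [Fintype S] {X : Type} [NormedAddCommGroup X] [InnerProductSpace ℂ X]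
  [CompleteSpace X]

namespace HD
variable (Q : HD d S X)

theorem dim_bound (n : ℕ) (v : Fin n → X) (hv : LinearIndependent ℂ v) (B : ℝ)
    (hB : ∀ F : Finset (Rd d), (∀ x ∈ F, ∃ k, Q.ev x (v k) ≠ 0) → ∑ x ∈ F, W0 x ≤ B) :
    (n : ℝ) ≤ Q.A * (Fintype.card S * Q.C ^ 2 * B) := by
  classical
  set φ := InnerProductSpace.gramSchmidtNormed ℂ v with hφ
  have hon : Orthonormal ℂ φ := InnerProductSpace.gramSchmidtNormed_orthonormal hv
  have hmem : ∀ l, φ l ∈ Submodule.span ℂ (range v) := by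
    intro l
    rw [← InnerProductSpace.span_gramSchmidt, ← InnerProductSpace.span_gramSchmidtNormed_range]
    exact Submodule.subset_span ⟨l, rfl⟩
  have hzero : ∀ x, (∀ k, Q.ev x (v k) = 0) → ∀ l, Q.ev x (φ l) = 0 := by
    intro x hx l
    have : Submodule.span ℂ (range v) ≤ LinearMap.ker (Q.ev x : X →ₗ[ℂ] (S → ℂ)) := by
      rw [Submodule.span_le]
      rintro _ ⟨k, rfl⟩
      exact hx k
    exact this (hmem l)
  have hbes : ∀ x, ∑ l, ‖Q.ev x (φ l)‖ ^ 2 ≤ Fintype.card S * Q.C ^ 2 := by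
    intro x
    have h1 : ∀ l, ‖Q.ev x (φ l)‖ ^ 2 ≤ ∑ j, ‖Q.ev x (φ l) j‖ ^ 2 := by
      intro l
      have h0 : 0 ≤ ∑ j, ‖Q.ev x (φ l) j‖ ^ 2 := Finset.sum_nonneg fun _ _ => by positivity
      have : ‖Q.ev x (φ l)‖ ≤ √(∑ j, ‖Q.ev x (φ l) j‖ ^ 2) := by
        rw [pi_norm_le_iff_of_nonneg (Real.sqrt_nonneg _)]
        intro j
        refine Real.le_sqrt_of_sq_le ?_
        exact Finset.single_le_sum (f := fun j => ‖Q.ev x (φ l) j‖ ^ 2) (fun _ _ => by positivity) (Finset.mem_univ j)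
      calc _ ≤ (√(∑ j, ‖Q.ev x (φ l) j‖ ^ 2)) ^ 2 := by gcongr
        _ = _ := Real.sq_sqrt h0
    refine (Finset.sum_le_sum fun l _ => h1 l).trans ?_
    rw [Finset.sum_comm, ← nsmul_eq_mul, Fintype.card, ← Finset.sum_const]
    refine Finset.sum_le_sum fun j _ => ?_
    let L : X →L[ℂ] ℂ := (ContinuousLinearMap.proj j).comp (Q.ev x)
    have hL : ‖L‖ ≤ Q.C := ContinuousLinearMap.opNorm_le_bound _ Q.hC fun v =>
      (norm_le_pi_norm (Q.ev x v) j).trans (Q.evb x v)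
    have h2 := hon.sum_inner_products_le (s := Finset.univ) ((InnerProductSpace.toDual ℂ X).symm L)
    rw [LinearIsometryEquiv.norm_map] at h2
    refine le_trans (le_of_eq ?_) (h2.trans (by gcongr))
    refine Finset.sum_congr rfl fun l _ => ?_
    rw [norm_inner_symm, InnerProductSpace.toDual_symm_apply]
    rfl
  have hfin : ∀ F : Finset (Rd d), ∑ x ∈ F, W0 x * ∑ l, ‖Q.ev x (φ l)‖ ^ 2 ≤ Fintype.card S * Q.C ^ 2 * B := by
    intro F
    rw [← Finset.sum_filter_add_sum_filter_not F (fun x => ∃ k, Q.ev x (v k) ≠ 0)]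
    have h2 : ∑ x ∈ F with ¬ ∃ k, Q.ev x (v k) ≠ 0, W0 x * ∑ l, ‖Q.ev x (φ l)‖ ^ 2 = 0 := by
      refine Finset.sum_eq_zero fun x hx => ?_
      have := (Finset.mem_filter.1 hx).2
      push Not at this
      simp [hzero x this]
    rw [h2, add_zero]
    calc _ ≤ ∑ x ∈ F with ∃ k, Q.ev x (v k) ≠ 0, (Fintype.card S * Q.C ^ 2) * W0 x := by
          refine Finset.sum_le_sum fun x _ => ?_
          rw [mul_comm]
          exact mul_le_mul_of_nonneg_right (hbes x) (W0_pos x).le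
      _ ≤ _ := by
          rw [← Finset.mul_sum]
          exact mul_le_mul_of_nonneg_left (hB _ fun x hx => (Finset.mem_filter.1 hx).2) (by positivity)
  have hpos : ∀ x l, 0 ≤ W0 x * ‖Q.ev x (φ l)‖ ^ 2 := fun x l => by have := (W0_pos x).le; positivity
  have hsum : ∀ l, Summable fun x => W0 x * ‖Q.ev x (φ l)‖ ^ 2 := by
    intro l
    refine summable_of_sum_le (fun x => hpos x l) (fun F => le_trans (Finset.sum_le_sum fun x _ => ?_) (hfin F))
    have := (W0_pos x).le
    gcongr
    exact Finset.single_le_sum (f := fun l => ‖Q.ev x (φ l)‖ ^ 2) (fun _ _ => by positivity) (Finset.mem_univ l)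
  have h3 : ∀ l, (1 : ℝ) ≤ Q.A * ∑' x, W0 x * ‖Q.ev x (φ l)‖ ^ 2 := by
    intro l
    have := Q.I1 (φ l) _ (fun F => (hsum l).sum_le_tsum F fun x _ => hpos x l)
    rwa [hon.1 l, one_pow] at this
  calc (n : ℝ) = ∑ l : Fin n, (1 : ℝ) := by simp
    _ ≤ ∑ l, Q.A * ∑' x, W0 x * ‖Q.ev x (φ l)‖ ^ 2 := Finset.sum_le_sum fun l _ => h3 l
    _ = Q.A * ∑' x, ∑ l, W0 x * ‖Q.ev x (φ l)‖ ^ 2 := by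
        rw [← Finset.mul_sum, Summable.tsum_finsetSum fun l _ => hsum l]
    _ ≤ _ := by
        refine mul_le_mul_of_nonneg_left ?_ Q.hA
        refine Real.tsum_le_of_sum_le (fun x => Finset.sum_nonneg fun l _ => hpos x l) fun F => ?_
        simpa [Finset.mul_sum] using hfin F

theorem U_mul_norm (g : Rd d) (v : X) (k : ℕ) :
    ‖Q.Uo ((k : ℝ) • g) v - v‖ ≤ k * ‖Q.Uo g v - v‖ := by
  induction k with
  | zero => simp [Q.U0]
  | succ k ih =>
    have : Q.Uo (((k + 1 : ℕ) : ℝ) • g) v - v =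
        Q.Uo ((k : ℝ) • g) (Q.Uo g v - v) + (Q.Uo ((k : ℝ) • g) v - v) := by
      push_cast
      rw [add_smul, one_smul, Q.Uadd, map_sub]
      abel
    rw [this]
    refine (norm_add_le _ _).trans ?_
    rw [Q.Unorm]
    push_cast
    linarith

theorem U_pow (g : Rd d) (v : X) (k : ℕ) :
    ((Q.Uo g : X →ₗ[ℂ] X) ^ k) v = Q.Uo ((k : ℝ) • g) v := by
  induction k with
  | zero => simp [Q.U0]
  | succ k ih =>
    rw [pow_succ', Module.End.mul_apply, ih]
    push_cast
    rw [add_smul, one_smul, add_comm, Q.Uadd]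

theorem exists_poly {u : X} {e : Rd d} (hI : Q.Inv u e) {D : ℝ} (hD : BD D {x | Q.ev x u ≠ 0})
    {ε : ℝ} (hε : 0 < ε) : ∃ (m : ℕ) (s : Rd d) (p : Polynomial ℂ), 1 ≤ m ∧ ‖s‖ < ε ∧ p ≠ 0 ∧
      Polynomial.aeval (Q.Uo (s + (m : ℝ) • e) : X →ₗ[ℂ] X) p u = 0 := by
  classical
  obtain ⟨ι, U, m, hs, s, hT⟩ := hI
  have hstr := Q.T_strong U _ hT
  set M : ℝ := Q.A * (Fintype.card S * Q.C ^ 2) with hM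
  have hM0 : 0 ≤ M := by have := Q.hA; positivity
  have hD0 := hD.nonneg
  set κ : ℝ := 1 / (2 * (M + 1)) with hκ
  have hκ0 : 0 < κ := by positivity
  set n : ℕ := ⌈2 * M * D⌉₊ + 1 with hn
  -- extremal translate
  set V : Set ℝ := {r | ∃ (g : Rd d) (F : Finset (Rd d)), (∀ x ∈ F, Q.ev (x + g) u ≠ 0) ∧ r = ∑ x ∈ F, W0 x}
    with hV
  have hVne : V.Nonempty := ⟨0, 0, ∅, by simp, by simp⟩
  have hVbd : BddAbove V := ⟨D, by rintro r ⟨g, F, hF, rfl⟩; exact hD g F hF⟩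
  obtain ⟨r, ⟨g', F, hF, rfl⟩, hr⟩ := exists_lt_of_lt_csSup hVne (show sSup V - κ < sSup V by linarith)
  set u' := Q.Uo g' u with hu'
  have hconv : ∀ k : ℕ, Tendsto (fun i => Q.Uo ((k : ℝ) • sh m e s i) u') (U : Filter ι) (𝓝 u') := by
    intro k
    rw [tendsto_iff_norm_sub_tendsto_zero]
    have h1 := hstr.const_mul (k : ℝ)
    rw [mul_zero] at h1
    refine squeeze_zero (fun _ => norm_nonneg _) (fun i => ?_) h1
    refine (Q.U_mul_norm _ _ k).trans (le_of_eq ?_)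
    rw [hu', Q.U_comm, ← map_sub, Q.Unorm]
  have hev : ∀ᶠ i in (U : Filter ι), ∀ k ∈ Finset.range n, ∀ x ∈ F, Q.ev x (Q.Uo ((k : ℝ) • sh m e s i) u') ≠ 0 := by
    rw [Filter.eventually_all_finset]
    intro k _
    rw [Filter.eventually_all_finset]
    intro x hx
    refine (((Q.ev x).continuous.tendsto _).comp (hconv k)).eventually_ne ?_
    rw [hu', Q.evU]
    exact hF x hx
  have hsm : ∀ᶠ i in (U : Filter ι), ‖s.rep i‖ < ε := by
    have := s.tendsto.norm
    rw [norm_zero] at this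
    exact this.eventually_lt_const hε
  obtain ⟨i, h1, h2, h3⟩ := (hev.and (hsm.and (Filter.tendsto_atTop.1 hs.top 1))).exists
  set g := sh m e s i with hg
  set v : Fin n → X := fun k => Q.Uo (((k : ℕ) : ℝ) • g) u' with hv
  have hfr : ∀ (k : Fin n) (B : Finset (Rd d)), (∀ x ∈ B, x ∉ F ∧ Q.ev x (v k) ≠ 0) → ∑ x ∈ B, W0 x ≤ κ := by
    intro k B hB
    have h4 : ∑ x ∈ F ∪ B, W0 x ∈ V := by
      refine ⟨(((k : ℕ) : ℝ) • g) + g', F ∪ B, fun x hx => ?_, rfl⟩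
      have : Q.ev x (v k) ≠ 0 := by
        rcases Finset.mem_union.1 hx with hx | hx
        · exact h1 k (Finset.mem_range.2 k.2) x hx
        · exact (hB x hx).2
      rwa [hv, hu', Q.evU, Q.evU, add_assoc] at this
    have h5 := le_csSup hVbd h4
    rw [Finset.sum_union (Finset.disjoint_left.2 fun x hx hx' => (hB x hx').1 hx)] at h5
    linarith
  have hnot : ¬ LinearIndependent ℂ v := by
    intro hli
    have hB := Q.dim_bound n v hli (D + n * κ) (fun B hB => ?_)
    · have h5 : (n : ℝ) ≤ M * D + M * κ * n := by rw [hM]; linarith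
      have h6 : M * κ ≤ 1 / 2 := by
        rw [hκ, mul_one_div, div_le_div_iff₀ (by positivity) (by norm_num)]
        linarith
      have h7 : 2 * M * D + 1 ≤ n := by
        rw [hn]; push_cast
        linarith [Nat.le_ceil (2 * M * D)]
      have h8 : (0 : ℝ) ≤ n := Nat.cast_nonneg n
      nlinarith
    · rw [← Finset.sum_filter_add_sum_filter_not B (fun x => x ∈ F)]
      refine add_le_add ?_ ?_
      · exact hD g' _ fun x hx => hF x (Finset.mem_filter.1 hx).2
      · calc ∑ x ∈ B with x ∉ F, W0 x ≤ ∑ x ∈ B with x ∉ F, ∑ k : Fin n, if Q.ev x (v k) ≠ 0 then W0 x else 0 := by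
              refine Finset.sum_le_sum fun x hx => ?_
              obtain ⟨k, hk⟩ := hB x (Finset.mem_filter.1 hx).1
              refine le_trans (le_of_eq (if_pos hk).symm) (Finset.single_le_sum
                (f := fun k => if Q.ev x (v k) ≠ 0 then W0 x else 0) (fun k _ => ?_) (Finset.mem_univ k))
              have := (W0_pos x).le
              split_ifs <;> simp [this]
          _ = ∑ k : Fin n, ∑ x ∈ B with x ∉ F ∧ Q.ev x (v k) ≠ 0, W0 x := by
              rw [Finset.sum_comm]
              refine Finset.sum_congr rfl fun k _ => ?_
              rw [← Finset.sum_filter, Finset.filter_filter]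
          _ ≤ ∑ k : Fin n, κ := Finset.sum_le_sum fun k _ => hfr k _ fun x hx => (Finset.mem_filter.1 hx).2
          _ = n * κ := by simp
  obtain ⟨c, hc, k0, hk0⟩ := Fintype.not_linearIndependent_iff.1 hnot
  refine ⟨m i, s.rep i, ∑ k : Fin n, Polynomial.monomial (k : ℕ) (c k), h3, h2, ?_, ?_⟩
  · intro h0
    have := congrArg (fun p => Polynomial.coeff p (k0 : ℕ)) h0
    simp only [Polynomial.finsetSum_coeff, Polynomial.coeff_monomial, Polynomial.coeff_zero] at this
    rw [Finset.sum_eq_single k0] at this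
    · simp at this; exact hk0 this
    · intro b _ hb
      rw [if_neg (fun h => hb (Fin.ext h))]
    · simp
  · change Polynomial.aeval (Q.Uo g : X →ₗ[ℂ] X) _ u = 0
    have h5 : Polynomial.aeval (Q.Uo g : X →ₗ[ℂ] X) (∑ k : Fin n, Polynomial.monomial (k : ℕ) (c k)) u =
        Q.Uo (-g') (∑ k, c k • v k) := by
      rw [map_sum, map_sum, LinearMap.sum_apply]
      refine Finset.sum_congr rfl fun k _ => ?_
      rw [Polynomial.aeval_monomial, map_smul, hv, hu']
      simp only [Module.End.mul_apply, Module.algebraMap_end_apply]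
      rw [Q.U_pow, Q.U_comm (-g'), Q.U_neg']
    rw [h5, hc, map_zero]

end HD
end HD3

section Eig
open Filter Topology
set_option linter.unusedSectionVars false
variable {X : Type} [NormedAddCommGroup X] [InnerProductSpace ℂ X]

theorem isom_sq (A : X →L[ℂ] X) (hA : ∀ v, ‖A v‖ = ‖v‖) (z : ℂ) (y w : X) (h1 : A y = z • y + w)
    (h2 : A w = z • w) : w = 0 := by
  by_contra hw
  have hin : ∀ v v', inner ℂ (A v) (A v') = inner ℂ v v' :=
    LinearIsometry.inner_map_map (⟨(A : X →ₗ[ℂ] X), hA⟩ : X →ₗᵢ[ℂ] X)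
  have hz : ‖z‖ = 1 := by
    have := hA w
    rw [h2, norm_smul] at this
    have hw' := norm_pos_iff.2 hw
    exact mul_right_cancel₀ hw'.ne' (by rw [this, one_mul])
  have hz0 : z ≠ 0 := by rintro rfl; simp at hz
  have h3 := hin y w
  rw [h1, h2, inner_add_left, inner_smul_left, inner_smul_right, inner_smul_right, ← mul_assoc,
    Complex.conj_mul', hz] at h3
  simp only [Complex.ofReal_one, one_pow, one_mul, add_eq_left, mul_eq_zero, hz0, false_or,
    inner_self_eq_zero] at h3
  exact hw h3

/-- span of eigenvectors in an invariant subspace -/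
theorem eig_step (A : X →L[ℂ] X) (hA : ∀ v, ‖A v‖ = ‖v‖) (M : Submodule ℂ X) (hM : ∀ v ∈ M, A v ∈ M)
    (z : ℂ) (v : X) (hv : v ∈ M)
    (h : A v - z • v ∈ Submodule.span ℂ {w | w ∈ M ∧ ∃ z : ℂ, A w = z • w}) :
    v ∈ Submodule.span ℂ {w | w ∈ M ∧ ∃ z : ℂ, A w = z • w} := by
  set Sp := Submodule.span ℂ {w | w ∈ M ∧ ∃ z : ℂ, A w = z • w} with hSp
  have hSM : Sp ≤ M := Submodule.span_le.2 fun w hw => hw.1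
  have key : ∀ x ∈ Sp, ∃ v1 ∈ Sp, ∃ w, A w = z • w ∧ x = A v1 - z • v1 + w := by
    intro x hx
    induction hx using Submodule.span_induction with
    | mem w hw =>
      obtain ⟨hwM, z', hz'⟩ := hw
      by_cases hzz : z' = z
      · exact ⟨0, Sp.zero_mem, w, by rw [hz', hzz], by simp⟩
      · refine ⟨(z' - z)⁻¹ • w, Sp.smul_mem _ (Submodule.subset_span ⟨hwM, z', hz'⟩), 0, by simp, ?_⟩
        rw [map_smul, hz', smul_comm z, ← smul_sub, ← sub_smul, smul_smul,
          inv_mul_cancel₀ (sub_ne_zero.2 hzz), one_smul, add_zero]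
    | zero => exact ⟨0, Sp.zero_mem, 0, by simp, by simp⟩
    | add x y _ _ hx hy =>
      obtain ⟨v1, h1, w1, h2, h3⟩ := hx
      obtain ⟨v2, h4, w2, h5, h6⟩ := hy
      refine ⟨v1 + v2, Sp.add_mem h1 h4, w1 + w2, by rw [map_add, h2, h5, smul_add], ?_⟩
      rw [h3, h6, map_add, smul_add]
      abel
    | smul c x _ hx =>
      obtain ⟨v1, h1, w1, h2, h3⟩ := hx
      refine ⟨c • v1, Sp.smul_mem _ h1, c • w1, by rw [map_smul, h2, smul_comm], ?_⟩
      rw [h3, map_smul, smul_add, smul_sub, smul_comm z]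
  obtain ⟨v1, h1, w, h2, h3⟩ := key _ h
  have h4 : A (v - v1) = z • (v - v1) + w := by
    rw [map_sub, smul_sub, sub_eq_iff_eq_add]
    rw [sub_eq_iff_eq_add] at h3
    rw [h3]
    abel
  have hw0 := isom_sq A hA z _ _ h4 h2
  rw [hw0, add_zero] at h4
  have : v - v1 ∈ Sp := Submodule.subset_span ⟨M.sub_mem hv (hSM h1), z, h4⟩
  have := Sp.add_mem this h1
  rwa [sub_add_cancel] at this

theorem eig_span (A : X →L[ℂ] X) (hA : ∀ v, ‖A v‖ = ‖v‖) (M : Submodule ℂ X) (hM : ∀ v ∈ M, A v ∈ M)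
    (p : Polynomial ℂ) (hp : p ≠ 0) (v : X) (hv : v ∈ M)
    (h : Polynomial.aeval (A : X →ₗ[ℂ] X) p v = 0) :
    v ∈ Submodule.span ℂ {w | w ∈ M ∧ ∃ z : ℂ, A w = z • w} := by
  have hsp : p.Splits := IsAlgClosed.splits p
  rw [hsp.eq_prod_roots] at h
  rw [map_mul, Polynomial.aeval_C, Module.End.mul_apply, Module.algebraMap_end_apply,
    smul_eq_zero_iff_right (Polynomial.leadingCoeff_ne_zero.2 hp)] at h
  generalize p.roots = s at h
  induction s using Multiset.induction_on generalizing v with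
  | empty => simp at h; rw [h]; exact Submodule.zero_mem _
  | cons z s ih =>
    rw [Multiset.map_cons, Multiset.prod_cons, mul_comm, map_mul, Module.End.mul_apply] at h
    refine eig_step A hA M hM z v hv ?_
    have h5 : Polynomial.aeval (A : X →ₗ[ℂ] X) (Polynomial.X - Polynomial.C z) v = A v - z • v := by
      simp [Module.algebraMap_end_apply]
    rw [h5] at h
    exact ih _ (M.sub_mem (hM v hv) (M.smul_mem _ hv)) h

/-- joint eigenvectors -/
theorem joint_eig {I : Type} (A : I → X →L[ℂ] X) (hA : ∀ i v, ‖A i v‖ = ‖v‖)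
    (hc : ∀ i j v, A i (A j v) = A j (A i v)) (M : Submodule ℂ X) (hM : ∀ i, ∀ v ∈ M, A i v ∈ M)
    (p : I → Polynomial ℂ) (hp : ∀ i, p i ≠ 0)
    (h : ∀ i, ∀ v ∈ M, Polynomial.aeval (A i : X →ₗ[ℂ] X) (p i) v = 0) (l : List I) :
    M ≤ Submodule.span ℂ {w | w ∈ M ∧ ∀ i ∈ l, ∃ z : ℂ, A i w = z • w} := by
  induction l with
  | nil => intro v hv; exact Submodule.subset_span ⟨hv, by simp⟩
  | cons i l ih =>
    refine ih.trans (Submodule.span_le.2 ?_)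
    rintro w ⟨hw, hl⟩
    choose! z hz using hl
    let M' : Submodule ℂ X :=
      { carrier := {w | w ∈ M ∧ ∀ j ∈ l, A j w = z j • w}
        add_mem' := fun {a b} ha hb => ⟨M.add_mem ha.1 hb.1, fun j hj => by
          rw [map_add, ha.2 j hj, hb.2 j hj, smul_add]⟩
        zero_mem' := ⟨M.zero_mem, by simp⟩
        smul_mem' := fun c a ha => ⟨M.smul_mem _ ha.1, fun j hj => by
          rw [map_smul, ha.2 j hj, smul_comm]⟩ }
    have h1 := eig_span (A i) (hA i) M' (fun v hv => ⟨hM i v hv.1, fun j hj => by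
      rw [hc, hv.2 j hj, map_smul]⟩) (p i) (hp i) w ⟨hw, hz⟩ (h i w hw)
    refine Submodule.span_mono ?_ h1
    rintro v ⟨hv, hv2⟩
    refine ⟨hv.1, fun j hj => ?_⟩
    rcases List.mem_cons.1 hj with rfl | hj
    · exact hv2
    · exact ⟨_, hv.2 j hj⟩

end Eig

section Crys
open Filter Topology
set_option linter.unusedSectionVars false
variable {d : ℕ} {S : Type} [Fintype S] [DecidableEq S]

/-- elementary crystals -/
def elem (v : Rd d) (L : Set (Rd d)) (m : Fin d → ℕ) (w : Rd d) (k : S) : Rd d → S → ℂ :=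
  open Classical in
  fun x => if x ∈ (fun y => v + y) '' L then (monom m x * e2pi x w) • Pi.single k 1 else 0

/-- finite sums of elementary crystals -/
def Crys (d : ℕ) (S : Type) [Fintype S] [DecidableEq S] : Submodule ℂ (Rd d → S → ℂ) :=
  Submodule.span ℂ {u | ∃ v L m w k, IsFullRankLattice L ∧ u = elem v L m w k}

theorem BD.finite {D : ℝ} {A : Set (Rd d)} (hA : BD D A) (R : ℝ) (hR : 0 ≤ R) : (A ∩ closedBall 0 R).Finite := by
  by_contra h
  obtain ⟨F, hF, hc⟩ := Set.Infinite.exists_subset_card_eq h (⌈D * (1 + R) ^ (d + 1)⌉₊ + 1)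
  have h1 := hA 0 F fun x hx => by simpa using (hF hx).1
  have h2 : ∀ x ∈ F, ((1 + R) ^ (d + 1))⁻¹ ≤ W0 x := by
    intro x hx
    have : ‖x‖ ≤ R := by simpa using (hF hx).2
    unfold W0
    gcongr
  have h3 := (Finset.card_nsmul_le_sum F _ _ h2).trans h1
  rw [nsmul_eq_mul, ← div_eq_mul_inv, div_le_iff₀ (by positivity), hc] at h3
  push_cast at h3
  linarith [Nat.le_ceil (D * (1 + R) ^ (d + 1))]

theorem exists_freq (T : Rd d ≃ₗ[ℝ] Rd d) (z : Fin d → ℂ) (hz : ∀ i, ‖z i‖ = 1) :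
    ∃ w : Rd d, ∀ i, e2pi (T (EuclideanSpace.single i 1)) w = z i := by
  have hθ : ∀ i, ∃ θ : ℝ, Complex.exp (((2 * Real.pi : ℝ) : ℂ) * Complex.I * (θ : ℂ)) = z i := by
    intro i
    refine ⟨(z i).arg / (2 * Real.pi), ?_⟩
    have h1 := Complex.norm_mul_exp_arg_mul_I (z i)
    rw [hz, Complex.ofReal_one, one_mul] at h1
    rw [← h1]
    congr 1
    have : (Real.pi : ℂ) ≠ 0 := by exact_mod_cast Real.pi_ne_zero
    rw [h1]
    push_cast
    field_simp
  choose θ hθ using hθ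
  let L : Rd d →ₗ[ℝ] ℝ := (innerₛₗ ℝ (WithLp.toLp 2 θ : Rd d)).comp (T.symm : Rd d →ₗ[ℝ] Rd d)
  refine ⟨(InnerProductSpace.toDual ℝ (Rd d)).symm L.toContinuousLinearMap, fun i => ?_⟩
  unfold e2pi
  rw [real_inner_comm, InnerProductSpace.toDual_symm_apply, ← hθ i]
  simp [L, EuclideanSpace.inner_single_right]

theorem crys_of_quasi (T : Rd d ≃ₗ[ℝ] Rd d) (u : Rd d → S → ℂ) {D : ℝ} (hD : BD D (Function.support u))
    (z : Fin d → ℂ) (hz : ∀ i, ‖z i‖ = 1)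
    (hu : ∀ i x, u (x + T (EuclideanSpace.single i 1)) = z i • u x) : u ∈ Crys d S := by
  classical
  obtain ⟨w, hw⟩ := exists_freq T z hz
  set φ : Rd d → S → ℂ := fun x => e2pi (-x) w • u x with hφ
  have hφu : ∀ x, u x = e2pi x w • φ x := by
    intro x
    rw [hφ, smul_smul, ← e2pi_add_left, add_neg_cancel, e2pi_zero_left, one_smul]
  set Z : Set (Rd d) := {x : Rd d | ∀ i, ∃ n : ℤ, x i = (n : ℝ)} with hZ
  set L : Set (Rd d) := T '' Z with hL
  have hLl : IsFullRankLattice L := ⟨(T : Rd d →ₗ[ℝ] Rd d), T.bijective, rfl⟩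
  let P : AddSubgroup (Rd d) :=
    { carrier := {l | ∀ x, φ (x + l) = φ x}
      add_mem' := fun {a b} ha hb x => by rw [← add_assoc, hb, ha]
      zero_mem' := fun x => by rw [add_zero]
      neg_mem' := fun {a} ha x => by rw [← ha (x + -a), neg_add_cancel_right] }
  have hgen : ∀ i, T (EuclideanSpace.single i 1) ∈ P := by
    intro i x
    rw [hφ]
    dsimp only
    rw [hu, neg_add, e2pi_add_left, smul_smul, mul_assoc, e2pi_neg_left (T _), hw]
    congr 1
    rw [mul_comm ((starRingEnd ℂ) _), Complex.mul_conj', hz]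
    simp
  have hLP : ∀ l ∈ L, l ∈ P := by
    rintro _ ⟨n, hn, rfl⟩
    choose k hk using hn
    have h1 : n = ∑ i, (k i) • (EuclideanSpace.single i (1:ℝ) : Rd d) := by
      ext j
      rw [WithLp.ofLp_sum, Finset.sum_apply, hk]
      simp [Finset.sum_ite_eq]
    rw [h1, map_sum]
    refine P.sum_mem fun i _ => ?_
    rw [map_zsmul]
    exact P.zsmul_mem (hgen i) _
  -- fundamental domain
  set Dm : Set (Rd d) := {x | ∀ i, T.symm x i ∈ Ico (0:ℝ) 1} with hDm
  have hDb : ∃ R : ℝ, 0 ≤ R ∧ Dm ⊆ closedBall 0 R := by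
    set Tc := LinearMap.toContinuousLinearMap (T : Rd d →ₗ[ℝ] Rd d)
    refine ⟨‖Tc‖ * √(∑ _i : Fin d, 1), mul_nonneg (norm_nonneg _) (Real.sqrt_nonneg _), fun x hx => ?_⟩
    rw [mem_closedBall_zero_iff]
    have h1 : x = Tc (T.symm x) := (T.apply_symm_apply x).symm
    rw [h1]
    refine (Tc.le_opNorm _).trans ?_
    gcongr
    rw [EuclideanSpace.norm_eq]
    gcongr with i _
    have := hx i
    rw [Real.norm_eq_abs, sq_abs]
    nlinarith [this.1, this.2]
  obtain ⟨R, hR0, hR⟩ := hDb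
  have hfin : (Function.support u ∩ Dm).Finite := (hD.finite R hR0).subset (by gcongr)
  have key : u = ∑ v ∈ hfin.toFinset, ∑ k, (φ v k) • elem v L (0 : Fin d → ℕ) w k := by
    funext x
    have hterm : ∀ v, (∑ k, (φ v k) • elem v L (0 : Fin d → ℕ) w k) x =
        if x ∈ (fun y => v + y) '' L then e2pi x w • φ v else 0 := by
      intro v
      rw [Finset.sum_apply]
      funext k'
      rw [Finset.sum_apply]
      by_cases hx : x ∈ (fun y => v + y) '' L
      · rw [if_pos hx]
        simp only [elem, Pi.smul_apply, if_pos hx]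
        simp [monom, Pi.single_apply, mul_comm]
      · rw [if_neg hx]
        simp only [elem, Pi.smul_apply, if_neg hx]
        simp
    rw [Finset.sum_apply]
    simp only [hterm]
    -- the representative
    set n : Rd d := WithLp.toLp 2 fun i => ((⌊T.symm x i⌋ : ℤ) : ℝ) with hn
    have hnZ : n ∈ Z := fun i => ⟨_, rfl⟩
    set v0 := x - T n with hv0
    have hv0D : v0 ∈ Dm := by
      intro i
      rw [hv0, map_sub, T.symm_apply_apply]
      change T.symm x i - (⌊T.symm x i⌋ : ℝ) ∈ _
      exact ⟨by linarith [Int.floor_le (T.symm x i)], by linarith [Int.lt_floor_add_one (T.symm x i)]⟩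
    have hx0 : x ∈ (fun y => v0 + y) '' L := ⟨T n, ⟨n, hnZ, rfl⟩, by simp [hv0]⟩
    have hφx : φ x = φ v0 := by
      have := hLP (T n) ⟨n, hnZ, rfl⟩ v0
      rwa [hv0, sub_add_cancel] at this
    have huniq : ∀ v ∈ Dm, x ∈ (fun y => v + y) '' L → v = v0 := by
      rintro v hv ⟨_, ⟨n', hn', rfl⟩, hx'⟩
      have h1 : T.symm v = T.symm x - n' := by
        rw [← hx']; simp
      have h2 : n' = n := by
        ext i
        obtain ⟨k, hk⟩ := hn' i
        have h3 := hv i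
        rw [h1] at h3
        have h4 : T.symm x i - (k : ℝ) ∈ Ico (0:ℝ) 1 := by rw [← hk]; exact h3
        rw [hk]
        change (k : ℝ) = (⌊T.symm x i⌋ : ℝ)
        rw [Int.floor_eq_iff.2 ⟨by linarith [h4.1], by linarith [h4.2]⟩]
      rw [hv0, ← h2, ← hx']
      simp
    by_cases hux : u x = 0
    · rw [hux]
      symm
      refine Finset.sum_eq_zero fun v hv => ?_
      split_ifs with h
      · have hv' := (hfin.mem_toFinset.1 hv)
        have := huniq v hv'.2 h
        rw [this, ← hφx, ← hφu, hux]
      · rfl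
    · have hv0s : v0 ∈ hfin.toFinset := by
        rw [hfin.mem_toFinset]
        refine ⟨fun h0 => hux ?_, hv0D⟩
        rw [hφu, hφx, hφ]
        simp [h0]
      rw [Finset.sum_eq_single v0]
      · rw [if_pos hx0, ← hφx, ← hφu]
      · intro v hv hne
        rw [if_neg]
        exact fun h => hne (huniq v (hfin.mem_toFinset.1 hv).2 h)
      · exact fun h => absurd hv0s h
  rw [key]
  refine Submodule.sum_mem _ fun v _ => Submodule.sum_mem _ fun k _ => Submodule.smul_mem _ _
    (Submodule.subset_span ⟨v, L, 0, w, k, hLl, rfl⟩)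

end Crys

section HDend
open Filter Topology
set_option linter.unusedSectionVars false

/-- near-diagonal systems are bases -/
theorem exists_basis_equiv {d : ℕ} (m : Fin d → ℕ) (s : Fin d → Rd d) (hm : ∀ i, 1 ≤ m i)
    (hs : ∀ i, ‖s i‖ < 1 / (d + 1)) :
    ∃ T : Rd d ≃ₗ[ℝ] Rd d, ∀ i, T (EuclideanSpace.single i 1) =
      s i + (m i : ℝ) • EuclideanSpace.single i 1 := by
  let T : Rd d →ₗ[ℝ] Rd d :=
    { toFun := fun x => ∑ i, x i • (s i + (m i : ℝ) • EuclideanSpace.single i (1:ℝ))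
      map_add' := fun x y => by simp only [PiLp.add_apply, add_smul, Finset.sum_add_distrib]
      map_smul' := fun c x => by
        simp only [PiLp.smul_apply, smul_eq_mul, mul_smul, Finset.smul_sum, RingHom.id_apply] }
  have hT : ∀ x, T x = ∑ i, x i • (s i + (m i : ℝ) • EuclideanSpace.single i (1:ℝ)) := fun x => rfl
  have hTj : ∀ x j, T x j = ∑ i, x i * s i j + x j * m j := by
    intro x j
    rw [hT, WithLp.ofLp_sum, Finset.sum_apply]
    simp [mul_add, Finset.sum_add_distrib, Pi.single_apply]
  have hinj : Function.Injective T := by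
    rw [← LinearMap.ker_eq_bot, LinearMap.ker_eq_bot']
    intro x hx
    have h1 : ∀ j, |x j| ≤ (1 / (d + 1)) * ∑ i, |x i| := by
      intro j
      have h2 := hTj x j
      rw [hx] at h2
      have h3 : x j * m j = - ∑ i, x i * s i j := by
        have : (0 : Rd d) j = 0 := rfl
        linarith
      have h4 : |x j| ≤ |x j * m j| := by
        rw [abs_mul, Nat.abs_cast]
        exact le_mul_of_one_le_right (abs_nonneg _) (Nat.one_le_cast.2 (hm j))
      refine h4.trans ?_
      rw [h3, abs_neg, Finset.mul_sum]
      refine (Finset.abs_sum_le_sum_abs _ _).trans (Finset.sum_le_sum fun i _ => ?_)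
      rw [abs_mul, mul_comm]
      refine mul_le_mul_of_nonneg_right ?_ (abs_nonneg _)
      have := PiLp.norm_apply_le (s i) j
      rw [Real.norm_eq_abs] at this
      exact this.trans (hs i).le
    have h5 : ∑ j, |x j| ≤ d * ((1 / (d + 1)) * ∑ i, |x i|) := by
      refine (Finset.sum_le_sum fun j _ => h1 j).trans ?_
      simp
    have h6 : 0 ≤ ∑ j, |x j| := Finset.sum_nonneg fun _ _ => abs_nonneg _
    have h7 : ∑ j, |x j| = 0 := by
      have hd : (0:ℝ) < d + 1 := by positivity
      rw [← mul_assoc, mul_one_div, div_mul_eq_mul_div, le_div_iff₀ hd] at h5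
      nlinarith
    ext j
    have := (Finset.sum_eq_zero_iff_of_nonneg (fun j _ => abs_nonneg (x j))).1 h7 j (Finset.mem_univ j)
    simpa using this
  refine ⟨LinearEquiv.ofInjectiveEndo T hinj, fun i => ?_⟩
  rw [LinearEquiv.coe_ofInjectiveEndo, hT]
  simp [Finset.sum_add_distrib]

variable {d : ℕ} {S : Type} [Fintype S] [DecidableEq S] {X : Type} [NormedAddCommGroup X]
  [InnerProductSpace ℂ X] [CompleteSpace X]

namespace HD
variable (Q : HD d S X)

/-- the function attached to a vector -/
def evl : X →ₗ[ℂ] (Rd d → S → ℂ) where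
  toFun v := fun x => Q.ev x v
  map_add' v w := by funext x; simp
  map_smul' c v := by funext x; simp

theorem crys_of_inv {u : X} {D : ℝ} (hD : BD D {x | Q.ev x u ≠ 0})
    (hI : ∀ i, Q.Inv u (EuclideanSpace.single i 1)) : Q.evl u ∈ Crys d S := by
  have hε : (0:ℝ) < 1 / (d + 1) := by positivity
  choose m s p hm hs hp hpu using fun i => Q.exists_poly (hI i) hD hε
  obtain ⟨T, hT⟩ := exists_basis_equiv m s hm hs
  set g : Fin d → Rd d := fun i => s i + (m i : ℝ) • EuclideanSpace.single i 1 with hg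
  set M : Submodule ℂ X := Submodule.span ℂ (Set.range fun h => Q.Uo h u) with hM
  have hMU : ∀ h, ∀ v ∈ M, Q.Uo h v ∈ M := by
    intro h v hv
    induction hv using Submodule.span_induction with
    | mem x hx =>
      obtain ⟨k, rfl⟩ := hx
      refine Submodule.subset_span ⟨h + k, ?_⟩
      exact Q.Uadd _ _ _
    | zero => rw [map_zero]; exact M.zero_mem
    | add x y _ _ hx hy => rw [map_add]; exact M.add_mem hx hy
    | smul a x _ hx => rw [map_smul]; exact M.smul_mem _ hx
  have hMp : ∀ i, ∀ v ∈ M, Polynomial.aeval (Q.Uo (g i) : X →ₗ[ℂ] X) (p i) v = 0 := by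
    intro i v hv
    induction hv using Submodule.span_induction with
    | mem x hx =>
      obtain ⟨k, rfl⟩ := hx
      have h1 : Commute (Q.Uo (g i) : X →ₗ[ℂ] X) (Q.Uo k : X →ₗ[ℂ] X) := by
        refine LinearMap.ext fun v => ?_
        exact Q.U_comm _ _ _
      have h2 : Commute (Polynomial.aeval (Q.Uo (g i) : X →ₗ[ℂ] X) (p i)) (Q.Uo k : X →ₗ[ℂ] X) := by
        induction p i using Polynomial.induction_on' with
        | add a b ha hb => rw [map_add]; exact ha.add_left hb
        | monomial n a =>
          rw [Polynomial.aeval_monomial]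
          exact Commute.mul_left (Algebra.commutes a _) (h1.pow_left n)
      have h3 := LinearMap.congr_fun h2.eq u
      rw [Module.End.mul_apply, Module.End.mul_apply, hpu i] at h3
      simpa using h3
    | zero => rw [map_zero]
    | add x y _ _ hx hy => rw [map_add, hx, hy, add_zero]
    | smul a x _ hx => rw [map_smul, hx, smul_zero]
  have hMB : ∀ v ∈ M, ∃ D', BD D' {x | Q.ev x v ≠ 0} := by
    intro v hv
    induction hv using Submodule.span_induction with
    | mem x hx =>
      obtain ⟨k, rfl⟩ := hx
      refine ⟨D, (hD.shift k).mono fun x hx => ?_⟩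
      have : Q.ev x (Q.Uo k u) ≠ 0 := hx
      rw [Q.evU] at this
      exact this
    | zero => exact ⟨D, hD.mono fun x hx => by simp at hx⟩
    | add x y _ _ hx hy =>
      obtain ⟨D1, h1⟩ := hx
      obtain ⟨D2, h2⟩ := hy
      refine ⟨_, (h1.union h2).mono fun z hz => ?_⟩
      by_contra hcon
      simp only [mem_union, not_or, mem_ofPred_eq, not_not] at hcon
      apply hz
      rw [map_add, hcon.1, hcon.2, add_zero]
    | smul a x _ hx =>
      obtain ⟨D1, h1⟩ := hx
      refine ⟨_, h1.mono fun z hz hcon => hz ?_⟩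
      rw [map_smul, hcon, smul_zero]
  have hj := joint_eig (fun i => Q.Uo (g i)) (fun i v => Q.Unorm _ _) (fun i j v => Q.U_comm _ _ _) M
    (fun i v hv => hMU _ v hv) p hp hMp (List.finRange d)
  have hu : u ∈ M := Submodule.subset_span ⟨0, Q.U0 u⟩
  have hle : M ≤ (Crys d S).comap Q.evl := by
    refine hj.trans (Submodule.span_le.2 ?_)
    rintro w ⟨hwM, hw⟩
    change Q.evl w ∈ Crys d S
    by_cases hw0 : w = 0
    · rw [hw0, map_zero]; exact Submodule.zero_mem _
    obtain ⟨D', hD'⟩ := hMB w hwM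
    choose z hz using fun i => hw i (List.mem_finRange i)
    refine crys_of_quasi T (Q.evl w) (D := D') hD' z (fun i => ?_) fun i x => ?_
    · have h1 := Q.Unorm (g i) w
      have h2 := hz i
      rw [h2, norm_smul] at h1
      have : ‖w‖ ≠ 0 := norm_ne_zero_iff.2 hw0
      field_simp at h1
      exact h1
    · rw [hT]
      change Q.ev (x + g i) w = z i • Q.ev x w
      rw [← Q.evU, ← map_smul]
      exact congrArg _ (hz i)
  exact hle hu

theorem crys_of_rec {f : X} {D : ℝ} (hD : BD D {x | Q.ev x f ≠ 0})
    (hR : ∀ i, Q.Rec f (EuclideanSpace.single i 1)) : Q.evl f ∈ Crys d S := by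
  have h := Q.decomp_inv hD ((List.finRange d).map fun i => (EuclideanSpace.single i 1 : Rd d)) (by
    intro e he
    obtain ⟨i, _, rfl⟩ := List.mem_map.1 he
    exact hR i)
  have hle : Submodule.span ℂ {v | Q.Orb f v ∧ ∀ e ∈ ((List.finRange d).map fun i =>
      (EuclideanSpace.single i 1 : Rd d)), Q.Inv v e} ≤ (Crys d S).comap Q.evl := by
    refine Submodule.span_le.2 ?_
    rintro v ⟨h1, h2⟩
    exact Q.crys_of_inv (h1.bd hD) fun i => h2 _ (List.mem_map.2 ⟨i, List.mem_finRange i, rfl⟩)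
  exact hle h

end HD
end HDend

section Hilb
open Filter Topology
set_option linter.unusedSectionVars false

variable {d : ℕ} {S : Type} [Fintype S] [DecidableEq S]

theorem exists_HD {J : Type} [Fintype J] (κ : J → Rd d → (S → ℂ) →L[ℂ] ℂ) (f : Rd d → S → ℂ) {A : ℝ}
    (hA : 0 ≤ A) (H4 : ∀ j y, ‖κ j y‖ ^ 2 ≤ A * W0 y)
    (H3 : ∀ p, (∀ j, κ j 0 p = 0) → p = 0)
    (H1 : ∀ j h, Summable fun x => ‖κ j (-x) (f (x + h))‖ ^ 2)
    (H2 : ∀ j t k, ∑' x, κ j (t - x) (f x) * (starRingEnd ℂ) (κ j (t - x) (f (x + k))) =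
      ∑' x, κ j (-x) (f x) * (starRingEnd ℂ) (κ j (-x) (f (x + k)))) :
    ∃ (X : Type) (_ : NormedAddCommGroup X) (_ : InnerProductSpace ℂ X) (_ : CompleteSpace X)
      (Q : HD d S X) (v : X), ∀ x, Q.ev x v = f x := by
  classical
  let ℓ : Type := lp (fun _ : J × Rd d => ℂ) 2
  have hmem : ∀ h, Memℓp (fun jx : J × Rd d => κ jx.1 (-jx.2) (f (jx.2 + h))) 2 := by
    intro h
    refine memℓp_gen ?_
    simp only [ENNReal.toReal_ofNat, Real.rpow_ofNat]
    rw [summable_prod_of_nonneg (fun _ => by positivity)]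
    exact ⟨fun j => H1 j h, (hasSum_fintype _).summable⟩
  let w : Rd d → ℓ := fun h => ⟨_, hmem h⟩
  have hw : ∀ h jx, (w h : J × Rd d → ℂ) jx = κ jx.1 (-jx.2) (f (jx.2 + h)) := fun h jx => rfl
  have hinn : ∀ g h k, (inner ℂ (w (h + g)) (w (k + g)) : ℂ) = inner ℂ (w h) (w k) := by
    have key : ∀ h k, (inner ℂ (w h) (w k) : ℂ) =
        ∑ j, ∑' x, κ j (-x) (f x) * (starRingEnd ℂ) (κ j (-x) (f (x + (h - k)))) := by
      intro h k
      have hs := lp.summable_inner (𝕜 := ℂ) (w h) (w k)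
      rw [lp.inner_eq_tsum, hs.tsum_prod, tsum_fintype]
      refine Finset.sum_congr rfl fun j _ => ?_
      rw [← H2 j k (h - k), ← (Equiv.addRight k).tsum_eq fun x =>
        κ j (k - x) (f x) * (starRingEnd ℂ) (κ j (k - x) (f (x + (h - k))))]
      refine tsum_congr fun x => ?_
      rw [RCLike.inner_apply, hw, hw]
      simp only [Equiv.coe_addRight, sub_add_cancel_right]
      rw [show x + k + (h - k) = x + h by abel]
    intro g h k
    rw [key, key, add_sub_add_right_eq_sub]
  -- finitely supported combinations
  let W : (Rd d →₀ ℂ) →ₗ[ℂ] ℓ := Finsupp.linearCombination ℂ w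
  let X0 : Submodule ℂ ℓ := (LinearMap.range W).topologicalClosure
  have hWX : ∀ c, W c ∈ X0 := fun c => Submodule.le_topologicalClosure _ ⟨c, rfl⟩
  let e : (Rd d →₀ ℂ) →ₗ[ℂ] X0 := W.codRestrict X0 hWX
  have he : ∀ c, (e c : ℓ) = W c := fun c => rfl
  have hde : DenseRange e := by
    intro v
    rw [Metric.mem_closure_iff]
    intro ε hε
    have hv : (v : ℓ) ∈ closure (LinearMap.range W : Set ℓ) := v.2
    obtain ⟨_, ⟨c, rfl⟩, hc⟩ := Metric.mem_closure_iff.1 hv ε hε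
    exact ⟨e c, ⟨c, rfl⟩, hc⟩
  let sf : Rd d → (Rd d →₀ ℂ) →ₗ[ℂ] (Rd d →₀ ℂ) := fun g => Finsupp.lmapDomain ℂ ℂ (fun h => h + g)
  have hsf : ∀ g h a, sf g (Finsupp.single h a) = Finsupp.single (h + g) a := fun g h a => by
    simp [sf, Finsupp.mapDomain_single]
  have hWs : ∀ h a, W (Finsupp.single h a) = a • w h := fun h a => by
    simp [W]
  have hnorm : ∀ g c, ‖W (sf g c)‖ = ‖W c‖ := by
    have hi : ∀ g c c', (inner ℂ (W (sf g c)) (W (sf g c')) : ℂ) = inner ℂ (W c) (W c') := by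
      intro g c c'
      induction c using Finsupp.induction_linear with
      | zero => simp
      | add a b ha hb => rw [map_add, map_add, map_add, inner_add_left, inner_add_left, ha, hb]
      | single h a =>
        induction c' using Finsupp.induction_linear with
        | zero => simp
        | add a b ha hb => rw [map_add, map_add, map_add, inner_add_right, inner_add_right, ha, hb]
        | single k b =>
          rw [hsf, hsf, hWs, hWs, hWs, hWs, inner_smul_left, inner_smul_left, inner_smul_right,
            inner_smul_right, hinn]
    intro g c
    have := hi g c c
    rw [inner_self_eq_norm_sq_to_K, inner_self_eq_norm_sq_to_K] at this
    have h2 : ‖W (sf g c)‖ ^ 2 = ‖W c‖ ^ 2 := by exact_mod_cast this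
    exact (pow_left_inj₀ (norm_nonneg _) (norm_nonneg _) two_ne_zero).1 h2
  haveI : CompleteSpace X0 := (Submodule.isClosed_topologicalClosure _).completeSpace_coe
  let Uo : Rd d → X0 →L[ℂ] X0 := fun g => (e ∘ₗ sf g).extendOfNorm e
  have hbd : ∀ g c, ‖(e ∘ₗ sf g) c‖ ≤ 1 * ‖e c‖ := fun g c => by
    rw [one_mul]; exact (hnorm g c).le
  have hU : ∀ g c, Uo g (e c) = e (sf g c) := fun g c =>
    LinearMap.extendOfNorm_eq hde ⟨1, hbd g⟩ c
  -- density principle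
  have dens : ∀ {Y : Type} [TopologicalSpace Y] [T2Space Y] (F G : X0 → Y), Continuous F → Continuous G →
      (∀ c, F (e c) = G (e c)) → ∀ v, F v = G v := by
    intro Y _ _ F G hF hG h v
    exact congrFun (hde.equalizer hF hG (funext h)) v
  let κ0 : (S → ℂ) →ₗ[ℂ] (J → ℂ) := LinearMap.pi fun j => (κ j 0 : (S → ℂ) →ₗ[ℂ] ℂ)
  obtain ⟨l, hl⟩ := κ0.exists_leftInverse_of_injective (by
    rw [LinearMap.ker_eq_bot']
    intro p hp
    exact H3 p fun j => congrFun hp j)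
  let coord : (J × Rd d) → X0 →L[ℂ] ℂ := fun jx =>
    (lp.evalCLM ℂ (fun _ : J × Rd d => ℂ) 2 jx).comp X0.subtypeL
  have hcoord : ∀ jx v, coord jx v = ((v : ℓ) : J × Rd d → ℂ) jx := fun jx v => rfl
  let ev0 : X0 →L[ℂ] (S → ℂ) := (LinearMap.toContinuousLinearMap l).comp
    (ContinuousLinearMap.pi fun j => coord (j, 0))
  have hev0 : ∀ h, ev0 (e (Finsupp.single h 1)) = f h := by
    intro h
    change l (fun j => ((e (Finsupp.single h 1) : ℓ) : J × Rd d → ℂ) (j, 0)) = f h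
    have h1 : (fun j => ((e (Finsupp.single h 1) : ℓ) : J × Rd d → ℂ) (j, 0)) = κ0 (f h) := by
      funext j
      rw [he, hWs, one_smul, hw]
      simp [κ0]
    rw [h1]
    exact LinearMap.congr_fun hl (f h)
  let ev : Rd d → X0 →L[ℂ] (S → ℂ) := fun x => ev0.comp (Uo x)
  have hevs : ∀ x h, ev x (e (Finsupp.single h 1)) = f (x + h) := by
    intro x h
    change ev0 (Uo x (e _)) = _
    rw [hU, hsf, hev0, add_comm]
  have ind : ∀ {Y : Type} [AddCommGroup Y] [Module ℂ Y] (F G : X0 →ₗ[ℂ] Y),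
      (∀ h, F (e (Finsupp.single h 1)) = G (e (Finsupp.single h 1))) → ∀ c, F (e c) = G (e c) := by
    intro Y _ _ F G h c
    have : F ∘ₗ e = G ∘ₗ e := by
      refine Finsupp.lhom_ext fun a b => ?_
      have hb : Finsupp.single a b = b • Finsupp.single a (1:ℂ) := by simp
      simp only [LinearMap.comp_apply]
      rw [hb, map_smul, map_smul, map_smul, h]
    exact LinearMap.congr_fun this c
  have hUadd : ∀ g h v, Uo (g + h) v = Uo g (Uo h v) := by
    intro g h
    refine dens _ _ (Uo (g + h)).continuous ((Uo g).comp (Uo h)).continuous fun c => ?_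
    refine ind (Uo (g + h) : X0 →ₗ[ℂ] X0) ((Uo g).comp (Uo h) : X0 →L[ℂ] X0) (fun k => ?_) c
    change Uo (g + h) _ = Uo g (Uo h _)
    rw [hU, hU, hU, hsf, hsf, hsf, add_assoc, add_comm h]
  have hUnorm : ∀ g v, ‖Uo g v‖ = ‖v‖ := by
    intro g
    refine dens _ _ (Uo g).continuous.norm continuous_norm fun c => ?_
    rw [hU]
    exact hnorm g c
  have hcoordev : ∀ j x v, coord (j, x) v = κ j (-x) (ev x v) := by
    intro j x
    refine dens _ _ (coord (j, x)).continuous ((κ j (-x)).comp (ev x)).continuous fun c => ?_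
    refine ind (coord (j, x) : X0 →ₗ[ℂ] ℂ) ((κ j (-x)).comp (ev x) : X0 →L[ℂ] ℂ) (fun k => ?_) c
    change coord (j, x) (e (Finsupp.single k 1)) = κ j (-x) (ev x (e (Finsupp.single k 1)))
    rw [hevs, hcoord, he, hWs, one_smul, hw]
  let Q : HD d S X0 :=
    { Uo := Uo
      ev := ev
      C := ‖ev0‖
      A := Fintype.card J * A
      hC := ContinuousLinearMap.opNorm_nonneg ev0
      hA := by positivity
      U0 := by
        refine dens _ _ (Uo 0).continuous continuous_id fun c => ?_
        refine ind (Uo 0 : X0 →ₗ[ℂ] X0) LinearMap.id (fun k => ?_) c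
        change Uo 0 _ = _
        rw [hU, hsf, add_zero]
        rfl
      Uadd := hUadd
      Unorm := hUnorm
      evU := fun x h v => by
        change ev0 (Uo x (Uo h v)) = ev0 (Uo (x + h) v)
        rw [hUadd]
      evb := fun x v => by
        have := ev0.le_opNorm (Uo x v)
        rwa [hUnorm] at this
      I1 := fun v B hB => by
        have h2 : (0:ℝ) < (2 : ℝ≥0∞).toReal := by norm_num
        have h3 := lp.norm_rpow_eq_tsum h2 (v : ℓ)
        simp only [ENNReal.toReal_ofNat, Real.rpow_ofNat] at h3
        have h4 : ‖v‖ ^ 2 = ‖(v : ℓ)‖ ^ 2 := rfl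
        rw [h4, h3]
        have hB0 : 0 ≤ B := by simpa using hB ∅
        refine Real.tsum_le_of_sum_le (fun _ => by positivity) fun F => ?_
        have h5 : ∑ jx ∈ F, ‖((v : ℓ) : J × Rd d → ℂ) jx‖ ^ 2 ≤
            ∑ jx ∈ (Finset.univ : Finset J) ×ˢ (F.image Prod.snd), ‖((v : ℓ) : J × Rd d → ℂ) jx‖ ^ 2 := by
          refine Finset.sum_le_sum_of_subset_of_nonneg (fun jx hjx => ?_) fun _ _ _ => by positivity
          exact Finset.mem_product.2 ⟨Finset.mem_univ _, Finset.mem_image_of_mem _ hjx⟩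
        refine h5.trans ?_
        rw [Finset.sum_product, mul_assoc]
        have h6 : ∀ j ∈ (Finset.univ : Finset J),
            ∑ x ∈ F.image Prod.snd, ‖((v : ℓ) : J × Rd d → ℂ) (j, x)‖ ^ 2 ≤ A * B := by
          intro j _
          refine le_trans ?_ (mul_le_mul_of_nonneg_left (hB (F.image Prod.snd)) hA)
          rw [Finset.mul_sum]
          refine Finset.sum_le_sum fun x _ => ?_
          rw [← hcoord, hcoordev, ← mul_assoc]
          have h7 := (κ j (-x)).le_opNorm (ev x v)
          have h8 := H4 j (-x)
          rw [W0_neg] at h8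
          calc ‖κ j (-x) (ev x v)‖ ^ 2 ≤ (‖κ j (-x)‖ * ‖ev x v‖) ^ 2 := by gcongr
            _ = ‖κ j (-x)‖ ^ 2 * ‖ev x v‖ ^ 2 := by ring
            _ ≤ _ := by gcongr
        refine (Finset.sum_le_sum h6).trans ?_
        simp }
  refine ⟨X0, inferInstance, inferInstance, inferInstance, Q, e (Finsupp.single 0 1), fun x => ?_⟩
  have := hevs x 0
  rwa [add_zero] at this

theorem crys_of_kernel {J : Type} [Fintype J] (κ : J → Rd d → (S → ℂ) →L[ℂ] ℂ) (f : Rd d → S → ℂ) {A : ℝ}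
    (hA : 0 ≤ A) (H4 : ∀ j y, ‖κ j y‖ ^ 2 ≤ A * W0 y)
    (H3 : ∀ p, (∀ j, κ j 0 p = 0) → p = 0)
    (H1 : ∀ j h, Summable fun x => ‖κ j (-x) (f (x + h))‖ ^ 2)
    (H2 : ∀ j t k, ∑' x, κ j (t - x) (f x) * (starRingEnd ℂ) (κ j (t - x) (f (x + k))) =
      ∑' x, κ j (-x) (f x) * (starRingEnd ℂ) (κ j (-x) (f (x + k))))
    {D : ℝ} (hD : BD D (Function.support f))
    (hR : ∀ (i : Fin d) (ι : Type) (U : Ultrafilter ι) (m : ι → ℕ), IsSys U m → ∀ x,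
      uLim U (fun n x => f (x + (m n : ℝ) • EuclideanSpace.single i 1)) x = f x) : f ∈ Crys d S := by
  obtain ⟨X, _, _, _, Q, v, hv⟩ := exists_HD κ f hA H4 H3 H1 H2
  have h := Q.crys_of_rec (f := v) (D := D) (by simp only [hv]; exact hD) fun i ι U m hs x => by
    simp only [hv]
    exact hR i ι U m hs x
  have h2 : Q.evl v = f := funext hv
  rwa [h2] at h

end Hilb

section SchwOps
open Filter Topology
set_option linter.unusedSectionVars false
variable {d : ℕ}

/-- Schwartz space -/
abbrev Sc (d : ℕ) : Type := SchwartzMap (Rd d) ℂ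

theorem e2pi_htg (η : Rd d) : (fun y => e2pi η y).HasTemperateGrowth := by
  have h1 : Function.HasTemperateGrowth (fun s : ℝ => Complex.exp (((2 * Real.pi : ℝ) : ℂ) * Complex.I * (s : ℂ))) := by
    refine ⟨(contDiff_const.mul Complex.ofRealCLM.contDiff).cexp, fun n => ⟨0, (2 * Real.pi) ^ n, fun s => ?_⟩⟩
    rw [norm_iteratedFDeriv_eq_norm_iteratedDeriv]
    have : ∀ n, iteratedDeriv n (fun s : ℝ => Complex.exp (((2 * Real.pi : ℝ) : ℂ) * Complex.I * (s : ℂ))) =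
        fun s : ℝ => (((2 * Real.pi : ℝ) : ℂ) * Complex.I) ^ n *
          Complex.exp (((2 * Real.pi : ℝ) : ℂ) * Complex.I * (s : ℂ)) := by
      intro n
      induction n with
      | zero => simp
      | succ n ih =>
        rw [iteratedDeriv_succ, ih]
        funext s
        have h2 : HasDerivAt (fun s : ℝ => Complex.exp (((2 * Real.pi : ℝ) : ℂ) * Complex.I * (s : ℂ)))
            (Complex.exp (((2 * Real.pi : ℝ) : ℂ) * Complex.I * (s : ℂ)) *
              (((2 * Real.pi : ℝ) : ℂ) * Complex.I * 1)) s :=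
          ((Complex.ofRealCLM.hasDerivAt (x := s)).const_mul _).cexp
        rw [(h2.const_mul _).deriv]
        ring
    rw [this]
    simp only [norm_mul, norm_pow, pow_zero, mul_one]
    have h3 : ‖Complex.exp (((2 * Real.pi : ℝ) : ℂ) * Complex.I * (s : ℂ))‖ = 1 := by
      rw [show ((2 * Real.pi : ℝ) : ℂ) * Complex.I * (s : ℂ) = ((2 * Real.pi * s : ℝ) : ℂ) * Complex.I by
        push_cast; ring]
      exact Complex.norm_exp_ofReal_mul_I _
    rw [h3]
    simp [abs_of_pos Real.pi_pos]
  exact h1.comp (Function.hasTemperateGrowth_inner_right η)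

theorem coord_htg (i : Fin d) : (fun y : Rd d => ((y i : ℝ) : ℂ)).HasTemperateGrowth :=
  Complex.ofRealCLM.hasTemperateGrowth.comp (EuclideanSpace.proj (𝕜 := ℝ) i).hasTemperateGrowth

/-- partial derivative operators -/
def pd (i : Fin d) : Sc d →L[ℂ] Sc d :=
  LineDeriv.lineDerivOpCLM ℂ (Sc d) (EuclideanSpace.single i (1:ℝ) : Rd d)

theorem pd_apply (i : Fin d) (φ : Sc d) (x : Rd d) :
    pd i φ x = fderiv ℝ φ x (EuclideanSpace.single i (1:ℝ)) := rfl

theorem pd_comm (i j : Fin d) (φ : Sc d) : pd i (pd j φ) = pd j (pd i φ) := by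
  ext x
  rw [pd_apply, pd_apply]
  have h2 : ∀ j : Fin d, (⇑(pd j φ)) = fun x => fderiv ℝ φ x (EuclideanSpace.single j (1:ℝ)) := fun j => rfl
  have hd : DifferentiableAt ℝ (fderiv ℝ φ) x :=
    ((φ.smooth ⊤).fderiv_right (m := 1) (by norm_cast)).differentiable (by norm_num) x
  rw [h2, h2, fderiv_clm_apply hd (by fun_prop), fderiv_clm_apply hd (by fun_prop)]
  have hs : IsSymmSndFDerivAt ℝ φ x := ((φ.smooth 2).contDiffAt).isSymmSndFDerivAt (by simp)
  simpa using hs.eq _ _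

/-- multiplication by a coordinate -/
def xm (i : Fin d) : Sc d →L[ℂ] Sc d := smulLeftCLM ℂ (fun y : Rd d => ((y i : ℝ) : ℂ))

theorem xm_apply (i : Fin d) (φ : Sc d) (x : Rd d) : xm i φ x = (x i : ℂ) * φ x := by
  rw [xm, smulLeftCLM_apply_apply (coord_htg i), smul_eq_mul]

theorem pd_xm (i j : Fin d) (φ : Sc d) : pd j (xm i φ) = xm i (pd j φ) + (if i = j then φ else 0) := by
  ext x
  rw [add_apply, xm_apply, pd_apply, pd_apply]
  have h1 : (⇑(xm i φ)) = fun x : Rd d => (x i : ℂ) * φ x := funext fun x => xm_apply i φ x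
  have h2 : HasFDerivAt (fun x : Rd d => (x i : ℂ))
      (Complex.ofRealCLM.comp (EuclideanSpace.proj (𝕜 := ℝ) i)) x :=
    (Complex.ofRealCLM.comp (EuclideanSpace.proj (𝕜 := ℝ) i)).hasFDerivAt
  have h3 : HasFDerivAt (fun x : Rd d => (x i : ℂ) * φ x) _ x := h2.mul (φ.hasFDerivAt x)
  rw [h1, h3.fderiv]
  by_cases hij : i = j
  · subst hij; simp
  · simp [hij]

/-- multi-index derivative operators -/
def Dk (k : Fin d → ℕ) : Sc d →L[ℂ] Sc d := ((List.finRange d).map fun i => (pd i) ^ (k i)).prod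

theorem pd_pow_coe (i : Fin d) (n : ℕ) (φ : Sc d) : ⇑((pd i ^ n) φ) = (pderiv' i)^[n] ⇑φ := by
  induction n generalizing φ with
  | zero => rfl
  | succ n ih =>
    rw [pow_succ, mul_apply_eq_comp, ih, Function.iterate_succ_apply]
    rfl

theorem Dk_coe (k : Fin d → ℕ) (φ : Sc d) : ⇑(Dk k φ) = Dmulti k ⇑φ := by
  unfold Dk Dmulti
  induction (List.finRange d) generalizing φ with
  | nil => rfl
  | cons i l ih =>
    simp only [List.map_cons, List.prod_cons, List.foldr_cons, mul_apply_eq_comp,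
      Function.comp_apply]
    rw [pd_pow_coe, ih]

theorem dkDelta_eq (k : Fin d → ℕ) (x : Rd d) (φ : Sc d) :
    dkDelta k x φ = (-1 : ℂ) ^ (∑ i, k i) * Dk k φ x := by
  rw [dkDelta, Dk_coe]

theorem pd_commute (i j : Fin d) : Commute (pd i : Sc d →L[ℂ] Sc d) (pd j) :=
  ContinuousLinearMap.ext fun φ => pd_comm i j φ

theorem Dk_zero : Dk (0 : Fin d → ℕ) = 1 := by
  unfold Dk
  refine List.prod_eq_one fun x hx => ?_
  obtain ⟨i, _, rfl⟩ := List.mem_map.1 hx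
  simp

theorem Dk_add_single (k : Fin d → ℕ) (i : Fin d) : Dk (k + Pi.single i 1) = pd i * Dk k := by
  unfold Dk
  have key : ∀ l : List (Fin d), l.Nodup →
      (l.map fun j => (pd j : Sc d →L[ℂ] Sc d) ^ ((k + Pi.single i 1 : Fin d → ℕ) j)).prod =
        (if i ∈ l then pd i else 1) * (l.map fun j => (pd j : Sc d →L[ℂ] Sc d) ^ (k j)).prod := by
    intro l hl
    induction l with
    | nil => simp
    | cons j l ih =>
      rw [List.nodup_cons] at hl
      rw [List.map_cons, List.prod_cons, ih hl.2, List.map_cons, List.prod_cons]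
      by_cases hij : i = j
      · subst hij
        simp only [Pi.add_apply, Pi.single_eq_same, hl.1, if_false, List.mem_cons, true_or, if_true, one_mul]
        rw [pow_succ', mul_assoc]
      · have hij' : j ≠ i := fun h => hij h.symm
        simp only [Pi.add_apply, Pi.single_eq_of_ne hij', add_zero, List.mem_cons, hij, false_or]
        split_ifs
        · rw [← mul_assoc, ← mul_assoc, ((pd_commute j i).pow_left _).eq]
        · rw [one_mul, one_mul]
  rw [key _ (List.nodup_finRange d), if_pos (List.mem_finRange i)]

/-- induction on multi-indices -/
theorem midx_ind {P : (Fin d → ℕ) → Prop} (h0 : P 0) (h1 : ∀ k i, P k → P (k + Pi.single i 1)) : ∀ k, P k := by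
  have : ∀ n, ∀ k : Fin d → ℕ, ∑ i, k i = n → P k := by
    intro n
    induction n with
    | zero =>
      intro k hk
      have : k = 0 := by
        funext i
        exact Finset.sum_eq_zero_iff.1 hk i (Finset.mem_univ i)
      rw [this]; exact h0
    | succ n ih =>
      intro k hk
      obtain ⟨i, hi⟩ : ∃ i, k i ≠ 0 := by
        by_contra hcon
        push Not at hcon
        simp [hcon] at hk
      have h2 : k = (k - Pi.single i 1) + Pi.single i 1 := by
        funext j
        by_cases hj : j = i
        · subst hj; simp; omega
        · simp [hj]
      rw [h2]
      refine h1 _ _ (ih _ ?_)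
      have h3 : ∑ j, k j = ∑ j, (k - Pi.single i 1 : Fin d → ℕ) j + 1 := by
        conv_lhs => rw [h2]
        simp only [Pi.add_apply, Finset.sum_add_distrib]
        simp
      omega
  exact fun k => this _ k rfl

theorem sum_add_single (k : Fin d → ℕ) (i : Fin d) : ∑ j, (k + Pi.single i 1 : Fin d → ℕ) j = ∑ j, k j + 1 := by
  simp only [Pi.add_apply, Finset.sum_add_distrib]
  simp

theorem Dk_xm (k : Fin d → ℕ) (i : Fin d) (φ : Sc d) :
    Dk k (xm i φ) = xm i (Dk k φ) + (k i : ℂ) • Dk (k - Pi.single i 1) φ := by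
  induction k using midx_ind with
  | h0 => simp [Dk_zero]
  | h1 k j ih =>
    rw [Dk_add_single, mul_apply_eq_comp, ih, map_add, pd_xm, map_smul,
      mul_apply_eq_comp, add_assoc]
    congr 1
    by_cases hij : i = j
    · subst hij
      rw [if_pos rfl]
      simp only [Pi.add_apply, Pi.single_eq_same, add_tsub_cancel_right]
      by_cases hk : k i = 0
      · simp [hk]
      · have h2 : k - Pi.single i 1 + Pi.single i 1 = k := by
          funext j
          by_cases hj : j = i
          · subst hj; simp; omega
          · simp [hj]
        have h3 := Dk_add_single (k - Pi.single i 1) i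
        rw [h2] at h3
        rw [← mul_apply_eq_comp, ← h3]
        push_cast
        rw [add_smul, one_smul, add_comm]
    · rw [if_neg hij, zero_add, ← mul_apply_eq_comp, ← Dk_add_single]
      have h2 : k - Pi.single i 1 + Pi.single j 1 = k + Pi.single j 1 - Pi.single i 1 := by
        funext l
        by_cases hl : l = i
        · subst hl; simp [hij]
        · simp [hl]
      rw [h2]
      simp [hij]

theorem dkDelta_xm (k : Fin d → ℕ) (i : Fin d) (x : Rd d) (φ : Sc d) :
    dkDelta k x (xm i φ) = (x i : ℂ) * dkDelta k x φ - (k i : ℂ) * dkDelta (k - Pi.single i 1) x φ := by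
  rw [dkDelta_eq, dkDelta_eq, dkDelta_eq, Dk_xm, add_apply, smul_apply, xm_apply, smul_eq_mul]
  by_cases hk : k i = 0
  · simp [hk]; ring
  · have h2 : k - Pi.single i 1 + Pi.single i 1 = k := by
      funext j
      by_cases hj : j = i
      · subst hj; simp; omega
      · simp [hj]
    have h3 := sum_add_single (k - Pi.single i 1) i
    rw [h2] at h3
    rw [h3, pow_succ]
    ring

/-- modulation -/
def emd (η : Rd d) : Sc d →L[ℂ] Sc d := smulLeftCLM ℂ (fun y : Rd d => e2pi η y)

theorem emd_apply (η : Rd d) (φ : Sc d) (x : Rd d) : emd η φ x = e2pi η x * φ x := by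
  rw [emd, smulLeftCLM_apply_apply (e2pi_htg η), smul_eq_mul]

/-- reflection -/
def rf (t : Rd d) : Sc d →L[ℂ] Sc d :=
  (compSubConstCLM ℂ t).comp (compCLMOfContinuousLinearEquiv ℂ (ContinuousLinearEquiv.neg ℝ))

theorem rf_apply (t : Rd d) (φ : Sc d) (x : Rd d) : rf t φ x = φ (t - x) := by
  simp [rf]

/-- test functions -/
def Ph (η t : Rd d) : Sc d →L[ℂ] Sc d := (emd η).comp (rf t)

theorem Ph_apply (η t : Rd d) (ψ : Sc d) (y : Rd d) : Ph η t ψ y = e2pi η y * ψ (t - y) := by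
  rw [Ph, ContinuousLinearMap.comp_apply, emd_apply, rf_apply]

theorem pd_rf (t : Rd d) (i : Fin d) (φ : Sc d) : pd i (rf t φ) = - rf t (pd i φ) := by
  ext x
  rw [neg_apply, rf_apply, pd_apply, pd_apply]
  have h1 : (⇑(rf t φ)) = fun x => φ (t - x) := funext fun x => rf_apply t φ x
  have h2 : HasFDerivAt (fun x : Rd d => t - x) (-ContinuousLinearMap.id ℝ (Rd d)) x :=
    (hasFDerivAt_id x).const_sub t
  have h3 : HasFDerivAt (fun x : Rd d => φ (t - x)) _ x := (φ.hasFDerivAt (t - x)).comp x h2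
  rw [h1, h3.fderiv]
  simp

theorem pd_emd (η : Rd d) (i : Fin d) (φ : Sc d) :
    pd i (emd η φ) = (((2 * Real.pi : ℝ) : ℂ) * Complex.I * (η i : ℂ)) • emd η φ + emd η (pd i φ) := by
  ext x
  rw [add_apply, smul_apply, emd_apply, emd_apply, pd_apply, pd_apply]
  have h1 : (⇑(emd η φ)) = fun x => e2pi η x * φ x := funext fun x => emd_apply η φ x
  have h2 : HasFDerivAt (fun x : Rd d => (((2 * Real.pi : ℝ) : ℂ) * Complex.I) • (((⟪η, x⟫ : ℝ) : ℂ)))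
      ((((2 * Real.pi : ℝ) : ℂ) * Complex.I) • (Complex.ofRealCLM.comp (innerSL ℝ η))) x :=
    ((((2 * Real.pi : ℝ) : ℂ) * Complex.I) • (Complex.ofRealCLM.comp (innerSL ℝ η))).hasFDerivAt
  have h3 : HasFDerivAt (fun x : Rd d => e2pi η x) (e2pi η x •
      ((((2 * Real.pi : ℝ) : ℂ) * Complex.I) • (Complex.ofRealCLM.comp (innerSL ℝ η)))) x := h2.cexp
  have h4 : HasFDerivAt (fun x : Rd d => e2pi η x * φ x) _ x := h3.mul (φ.hasFDerivAt x)
  rw [h1, h4.fderiv]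
  simp [EuclideanSpace.inner_single_right]
  ring

theorem pd_Ph (η t : Rd d) (i : Fin d) (ψ : Sc d) : pd i (Ph η t ψ) =
    (η i : ℂ) • Ph η t ((((2 * Real.pi : ℝ) : ℂ) * Complex.I) • ψ) - Ph η t (pd i ψ) := by
  simp only [Ph, ContinuousLinearMap.comp_apply, pd_emd, pd_rf, map_neg, map_smul, smul_smul]
  rw [mul_comm, sub_eq_add_neg]

theorem xm_Ph (η t : Rd d) (i : Fin d) (ψ : Sc d) :
    xm i (Ph η t ψ) = (t i : ℂ) • Ph η t ψ - Ph η t (xm i ψ) := by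
  ext x
  rw [sub_apply, smul_apply, xm_apply, Ph_apply, Ph_apply, xm_apply, smul_eq_mul]
  simp only [PiLp.sub_apply]
  push_cast
  ring

theorem Dk_rf (k : Fin d → ℕ) (t : Rd d) (φ : Sc d) :
    Dk k (rf t φ) = (-1 : ℂ) ^ (∑ i, k i) • rf t (Dk k φ) := by
  induction k using midx_ind with
  | h0 => simp [Dk_zero]
  | h1 k j ih =>
    rw [Dk_add_single, mul_apply_eq_comp, ih, map_smul, pd_rf, sum_add_single, pow_succ,
      mul_apply_eq_comp]
    simp

theorem dkDelta_Ph_zero (k : Fin d → ℕ) (t x : Rd d) (ψ : Sc d) :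
    dkDelta k x (Ph 0 t ψ) = Dk k ψ (t - x) := by
  have h1 : Ph 0 t ψ = rf t ψ := by
    ext y; rw [Ph_apply, rf_apply, e2pi_zero_left, one_mul]
  rw [h1, dkDelta_eq, Dk_rf, smul_apply, rf_apply, smul_eq_mul, ← mul_assoc, ← mul_pow]
  simp

theorem monom_add_single (m : Fin d → ℕ) (i : Fin d) (x : Rd d) :
    monom (m + Pi.single i 1) x = (x i : ℂ) * monom m x := by
  unfold monom
  rw [← Complex.ofReal_mul]
  congr 1
  have : ∀ j, x j ^ ((m + Pi.single i 1 : Fin d → ℕ) j) = x j ^ m j * (if j = i then x j else 1) := by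
    intro j
    by_cases hj : j = i
    · subst hj; simp [pow_succ]
    · simp [hj]
  simp only [this, Finset.prod_mul_distrib, Finset.prod_ite_eq', Finset.mem_univ, if_true]
  ring

theorem Dk_Ph (k : Fin d → ℕ) (ψ : Sc d) : ∃ (n : ℕ) (m : Fin n → Fin d → ℕ) (g : Fin n → Sc d),
    ∀ η t, Dk k (Ph η t ψ) = ∑ l, monom (m l) η • Ph η t (g l) := by
  induction k using midx_ind with
  | h0 => exact ⟨1, fun _ => 0, fun _ => ψ, fun η t => by simp [Dk_zero, monom]⟩
  | h1 k j ih =>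
    obtain ⟨n, m, g, h⟩ := ih
    refine ⟨n + n, Fin.append (fun l => m l + Pi.single j 1) m,
      Fin.append (fun l => (((2 * Real.pi : ℝ) : ℂ) * Complex.I) • g l) (fun l => - pd j (g l)), fun η t => ?_⟩
    rw [Dk_add_single, mul_apply_eq_comp, h, map_sum, Fin.sum_univ_add, ← Finset.sum_add_distrib]
    refine Finset.sum_congr rfl fun l _ => ?_
    simp only [Fin.append_left, Fin.append_right, map_smul, pd_Ph, monom_add_single, map_neg, smul_sub,
      smul_neg, smul_smul]
    rw [sub_eq_add_neg]
    congr 2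
    ring

/-- the key expansion -/
theorem dkDelta_Ph (k : Fin d → ℕ) (ψ : Sc d) : ∃ (n : ℕ) (m : Fin n → Fin d → ℕ) (g : Fin n → Sc d),
    ∀ η t x, dkDelta k x (Ph η t ψ) = e2pi η x * ∑ l, monom (m l) η * g l (t - x) := by
  obtain ⟨n, m, g, h⟩ := Dk_Ph k ψ
  refine ⟨n, m, fun l => ((-1 : ℂ) ^ (∑ i, k i)) • g l, fun η t x => ?_⟩
  rw [dkDelta_eq, h, SchwartzMap.sum_apply, Finset.mul_sum, Finset.mul_sum]
  refine Finset.sum_congr rfl fun l _ => ?_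
  rw [smul_apply, smul_apply, Ph_apply, smul_eq_mul, smul_eq_mul]
  ring

/-- decay of Schwartz functions -/
theorem Sc_decay (ψ : Sc d) (n : ℕ) : ∃ C, 0 ≤ C ∧ ∀ y, ‖ψ y‖ ≤ C * ((1 + ‖y‖) ^ n)⁻¹ := by
  refine ⟨2 ^ n * ((Finset.Iic (n, 0)).sup fun m => SchwartzMap.seminorm ℂ m.1 m.2) ψ, by positivity, fun y => ?_⟩
  have := SchwartzMap.one_add_le_sup_seminorm_apply (𝕜 := ℂ) (m := (n, 0)) (k := n) (n := 0) le_rfl le_rfl ψ y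
  rw [norm_iteratedFDeriv_zero] at this
  rw [← div_eq_mul_inv, le_div_iff₀ (by positivity)]
  linarith

theorem Dmulti_tsupport (k : Fin d → ℕ) (φ : Sc d) : tsupport (Dk k φ) ⊆ tsupport φ := by
  induction k using midx_ind with
  | h0 => simp [Dk_zero]
  | h1 k j ih =>
    rw [Dk_add_single, mul_apply_eq_comp]
    exact (SchwartzMap.tsupport_lineDerivOp_subset _ _).trans ih

theorem dkDelta_eq_zero (k : Fin d → ℕ) (φ : Sc d) (x : Rd d) (hx : x ∉ tsupport φ) : dkDelta k x φ = 0 := by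
  rw [dkDelta_eq, image_eq_zero_of_notMem_tsupport fun h => hx (Dmulti_tsupport k φ h), mul_zero]

end SchwOps

section CrysConv
open Filter Topology
set_option linter.unusedSectionVars false
variable {d K : ℕ}

/-- index type -/
abbrev SI (d K : ℕ) : Type := ↥(mIdx d K)

/-- pairing -/
def prx (u : Rd d → SI d K → ℂ) (φ : Sc d) (x : Rd d) : ℂ := ∑ k, u x k * dkDelta k.1 x φ

/-- pairing -/
def pr (u : Rd d → SI d K → ℂ) (φ : Sc d) : ℂ := ∑' x, prx u φ x

theorem lattice_ud (v : Rd d) {L : Set (Rd d)} (hL : IsFullRankLattice L) :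
    UniformlyDiscrete ((fun y => v + y) '' L) := by
  obtain ⟨T, hT, rfl⟩ := hL
  set e := (LinearEquiv.ofBijective T hT).toContinuousLinearEquiv with he
  have heT : ∀ x, e x = T x := fun x => rfl
  refine ⟨(‖(e.symm : Rd d →L[ℝ] Rd d)‖ + 1)⁻¹, by positivity, ?_⟩
  rintro _ ⟨_, ⟨x, hx, rfl⟩, rfl⟩ _ ⟨_, ⟨y, hy, rfl⟩, rfl⟩ hxy
  have hxy' : x ≠ y := fun h => hxy (by rw [h])
  obtain ⟨i, hi⟩ : ∃ i, x i ≠ y i := by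
    by_contra h
    push Not at h
    exact hxy' (by ext i; exact h i)
  obtain ⟨a, ha⟩ := hx i
  obtain ⟨b, hb⟩ := hy i
  have h1 : (1 : ℝ) ≤ ‖x - y‖ := by
    refine le_trans ?_ (PiLp.norm_apply_le (x - y) i)
    rw [PiLp.sub_apply, ha, hb, Real.norm_eq_abs]
    rw [ha, hb] at hi
    have : a - b ≠ 0 := fun h => hi (by rw [sub_eq_zero.1 h])
    exact_mod_cast Int.one_le_abs this
  have h2 : x - y = e.symm (T x - T y) := by
    rw [← heT, ← heT, ← map_sub, e.symm_apply_apply]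
  have h3 : ‖x - y‖ ≤ ‖(e.symm : Rd d →L[ℝ] Rd d)‖ * ‖T x - T y‖ := by
    conv_lhs => rw [h2]
    exact (e.symm : Rd d →L[ℝ] Rd d).le_opNorm _
  have h0 : (0:ℝ) ≤ ‖(e.symm : Rd d →L[ℝ] Rd d)‖ := norm_nonneg _
  have h4 : dist ((fun y => v + y) (T x)) ((fun y => v + y) (T y)) = ‖T x - T y‖ := by
    simp [dist_eq_norm]
  rw [h4, inv_le_iff_one_le_mul₀ (by positivity)]
  have := norm_nonneg (T x - T y)
  nlinarith

theorem finite_supp {A : Set (Rd d)} {D : ℝ} (hA : BD D A) (φ : Sc d) (hφ : HasCompactSupport φ)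
    (g : Rd d → ℂ) (h1 : ∀ x, g x ≠ 0 → x ∈ A) (h2 : ∀ x, g x ≠ 0 → x ∈ tsupport φ) : (Function.support g).Finite := by
  obtain ⟨R, hR⟩ := hφ.isCompact.isBounded.subset_closedBall (0 : Rd d)
  refine (hA.finite (max R 0) (le_max_right _ _)).subset fun x hx => ⟨h1 x hx, ?_⟩
  exact closedBall_subset_closedBall (le_max_left _ _) (hR (h2 x hx))

theorem prx_eq_zero (u : Rd d → SI d K → ℂ) (φ : Sc d) (x : Rd d) (hx : x ∉ tsupport φ) : prx u φ x = 0 :=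
  Finset.sum_eq_zero fun k _ => by rw [dkDelta_eq_zero _ _ _ hx, mul_zero]

theorem prx_ne {u : Rd d → SI d K → ℂ} {φ : Sc d} {x : Rd d} (h : prx u φ x ≠ 0) : u x ≠ 0 := by
  intro hu
  exact h (by simp [prx, hu])

theorem crys_conv {u : Rd d → SI d K → ℂ} (hu : u ∈ Crys d (SI d K)) :
    ∃ (J : ℕ) (L : Fin J → Set (Rd d)) (v : Fin J → Rd d)
      (n : ℕ) (kk mm : Fin n → (Fin d → ℕ)) (w : Fin n → Rd d) (cc : Fin J → Fin n → ℂ),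
      (∀ j, IsFullRankLattice (L j)) ∧
      ∀ φ : SchwartzMap (Rd d) ℂ, HasCompactSupport (⇑φ) →
        pr u φ = ∑ j, ∑' x : ((fun y => v j + y) '' (L j) : Set (Rd d)),
          ∑ i, cc j i * monom (mm i) (x : Rd d) * e2pi (x : Rd d) (w i) *
            dkDelta (kk i) (x : Rd d) φ := by
  classical
  obtain ⟨n, a, g, hg⟩ := (Submodule.mem_span_set').1 hu
  choose v L m w k hL hgj using fun j => (g j).2
  refine ⟨n, L, v, n, fun j => (k j).1, m, w, fun j i => if i = j then a j else 0, hL, fun φ hφ => ?_⟩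
  have h1 : ∀ x, prx u φ x = ∑ j, ((fun y => v j + y) '' (L j)).indicator
      (fun x => a j * monom (m j) x * e2pi x (w j) * dkDelta (k j).1 x φ) x := by
    intro x
    rw [← hg]
    simp only [prx, Finset.sum_apply, Pi.smul_apply, smul_eq_mul, Finset.sum_mul]
    rw [Finset.sum_comm]
    refine Finset.sum_congr rfl fun j _ => ?_
    rw [hgj j]
    by_cases hx : x ∈ (fun y => v j + y) '' (L j)
    · rw [Set.indicator_of_mem hx]
      simp only [elem, if_pos hx, Pi.smul_apply, smul_eq_mul, Pi.single_apply]
      simp only [mul_ite, mul_one, mul_zero, ite_mul, zero_mul, Finset.sum_ite_eq', Finset.mem_univ, if_true]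
      ring
    · rw [Set.indicator_of_notMem hx]
      simp only [elem, if_neg hx, Pi.zero_apply, mul_zero, zero_mul, Finset.sum_const_zero]
  simp only [pr, h1]
  rw [Summable.tsum_finsetSum]
  · refine Finset.sum_congr rfl fun j _ => ?_
    rw [← tsum_subtype]
    refine tsum_congr fun x => ?_
    rw [Finset.sum_eq_single j]
    · simp
    · intro i _ hi
      simp [hi]
    · simp
  · intro j _
    obtain ⟨D, hD⟩ := (lattice_ud (v j) (hL j)).bd
    refine summable_of_hasFiniteSupport (finite_supp hD φ hφ _ (fun x hx => ?_) (fun x hx => ?_))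
    · by_contra h
      exact hx (Set.indicator_of_notMem h _)
    · by_contra h
      refine hx ?_
      rw [Set.indicator_apply, dkDelta_eq_zero _ _ _ h]
      simp

/-- the operator dual to multiplication by a coordinate -/
def Xop (i : Fin d) : (Rd d → SI d K → ℂ) →ₗ[ℂ] (Rd d → SI d K → ℂ) where
  toFun u x k := (x i : ℂ) * u x k - ∑ k' : SI d K, if k'.1 = k.1 + Pi.single i 1 then (k'.1 i : ℂ) * u x k' else 0
  map_add' u v := by
    funext x k
    simp only [Pi.add_apply, mul_add]
    have : ∀ k' : SI d K, (if k'.1 = k.1 + Pi.single i 1 then (k'.1 i : ℂ) * u x k' + (k'.1 i : ℂ) * v x k' else 0) =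
      (if k'.1 = k.1 + Pi.single i 1 then (k'.1 i : ℂ) * u x k' else 0) +
      (if k'.1 = k.1 + Pi.single i 1 then (k'.1 i : ℂ) * v x k' else 0) := fun k' => by split_ifs <;> simp
    simp only [this, Finset.sum_add_distrib]
    ring
  map_smul' c u := by
    funext x k
    simp only [Pi.smul_apply, smul_eq_mul, RingHom.id_apply, mul_sub, Finset.mul_sum]
    congr 1
    · ring
    · refine Finset.sum_congr rfl fun k' _ => ?_
      split_ifs <;> ring

theorem Xop_apply (i : Fin d) (u : Rd d → SI d K → ℂ) (x : Rd d) (k : SI d K) : Xop i u x k =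
    (x i : ℂ) * u x k - ∑ k' : SI d K, if k'.1 = k.1 + Pi.single i 1 then (k'.1 i : ℂ) * u x k' else 0 := rfl

theorem mem_mIdx {k : Fin d → ℕ} : k ∈ mIdx d K ↔ ∑ i, k i ≤ K := by
  unfold mIdx
  rw [Finset.mem_filter, Finset.mem_Iic, and_iff_right_iff_imp]
  intro h i
  exact (Finset.single_le_sum (f := k) (fun _ _ => Nat.zero_le _) (Finset.mem_univ i)).trans h

theorem sub_add_single {k : Fin d → ℕ} {i : Fin d} (hk : k i ≠ 0) : k - Pi.single i 1 + Pi.single i 1 = k := by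
  funext j
  by_cases hj : j = i
  · subst hj; simp; omega
  · simp [hj]

theorem sub_mem_mIdx {k : Fin d → ℕ} {i : Fin d} (hk : k ∈ mIdx d K) : k - Pi.single i 1 ∈ mIdx d K := by
  rw [mem_mIdx] at hk ⊢
  exact (Finset.sum_le_sum fun j _ => by simp [Pi.sub_apply]).trans hk

theorem prx_Xop (i : Fin d) (u : Rd d → SI d K → ℂ) (φ : Sc d) (x : Rd d) :
    prx (Xop i u) φ x = prx u (xm i φ) x := by
  classical
  simp only [prx, Xop_apply, dkDelta_xm, sub_mul, mul_sub, Finset.sum_sub_distrib, Finset.sum_mul]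
  congr 1
  · exact Finset.sum_congr rfl fun k _ => by ring
  · rw [Finset.sum_comm]
    refine Finset.sum_congr rfl fun k' _ => ?_
    by_cases hk : k'.1 i = 0
    · rw [hk]
      simp
    · rw [Finset.sum_eq_single (⟨k'.1 - Pi.single i 1, sub_mem_mIdx k'.2⟩ : SI d K)]
      · rw [if_pos (sub_add_single hk).symm]
        ring
      · intro k _ hne
        rw [if_neg, zero_mul]
        intro h
        refine hne (Subtype.ext ?_)
        change k.1 = k'.1 - Pi.single i 1
        rw [h]
        funext j
        simp
      · simp

theorem pr_Xop (i : Fin d) (u : Rd d → SI d K → ℂ) (φ : Sc d) : pr (Xop i u) φ = pr u (xm i φ) := by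
  simp only [pr, prx_Xop]

theorem Xop_crys (i : Fin d) {u : Rd d → SI d K → ℂ} (hu : u ∈ Crys d (SI d K)) : Xop i u ∈ Crys d (SI d K) := by
  classical
  induction hu using Submodule.span_induction with
  | zero => rw [map_zero]; exact Submodule.zero_mem _
  | add x y _ _ hx hy => rw [map_add]; exact Submodule.add_mem _ hx hy
  | smul c x _ hx => rw [map_smul]; exact Submodule.smul_mem _ _ hx
  | mem u hu =>
    obtain ⟨v, L, m, w, k0, hL, rfl⟩ := hu
    have key : Xop i (elem v L m w k0) = elem v L (m + Pi.single i 1) w k0 -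
        ∑ k : SI d K, (if k0.1 = k.1 + Pi.single i 1 then (k0.1 i : ℂ) else 0) • elem v L m w k := by
      funext x k
      rw [Xop_apply]
      simp only [Pi.sub_apply, Finset.sum_apply, Pi.smul_apply, smul_eq_mul, elem]
      by_cases hx : x ∈ (fun y => v + y) '' L
      · simp only [if_pos hx, Pi.smul_apply, smul_eq_mul, Pi.single_apply, monom_add_single]
        congr 1
        · ring
        · rw [Finset.sum_eq_single k0, Finset.sum_eq_single k]
          · simp only [if_true]; split_ifs <;> simp
          · intro k' _ hne
            rw [if_neg (Ne.symm hne), mul_zero, mul_zero]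
          · simp
          · intro k' _ hne
            simp [hne]
          · simp
      · simp only [if_neg hx, Pi.zero_apply, mul_zero, ite_self, Finset.sum_const_zero, sub_zero]
    rw [key]
    refine Submodule.sub_mem _ (Submodule.subset_span ⟨_, _, _, _, _, hL, rfl⟩) (Submodule.sum_mem _ fun k _ =>
      Submodule.smul_mem _ _ (Submodule.subset_span ⟨_, _, _, _, _, hL, rfl⟩))

theorem Obj.smul {V : Type*} [NormedAddCommGroup V] [NormedSpace ℂ V] {u : Rd d → V} (hu : Obj u) (c : ℂ) :
    Obj (c • u) := by
  obtain ⟨⟨D, hD⟩, C, H, hC⟩ := hu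
  refine ⟨⟨D, hD.mono fun x hx h => hx (by simp [h])⟩, ‖c‖ * C, H, fun x => ?_⟩
  rw [Pi.smul_apply, norm_smul, mul_assoc]
  exact mul_le_mul_of_nonneg_left (hC x) (norm_nonneg _)

theorem Obj.add {V : Type*} [NormedAddCommGroup V] {u v : Rd d → V} (hu : Obj u) (hv : Obj v) : Obj (u + v) := by
  obtain ⟨⟨D, hD⟩, C, H, hC⟩ := hu
  obtain ⟨⟨D', hD'⟩, C', H', hC'⟩ := hv
  refine ⟨⟨D + D', (hD.union hD').mono fun x hx => ?_⟩, |C| + |C'|, H + H', fun x => ?_⟩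
  · by_contra h
    simp only [Set.mem_union, Function.mem_support, not_or, not_not] at h
    exact hx (by rw [Pi.add_apply, h.1, h.2, add_zero])
  · refine (norm_add_le _ _).trans ?_
    have h1 : 1 ≤ 1 + ‖x‖ := by linarith [norm_nonneg x]
    rw [add_mul]
    refine add_le_add ((hC x).trans ?_) ((hC' x).trans ?_)
    · exact mul_le_mul (le_abs_self _) (pow_le_pow_right₀ h1 (by omega)) (by positivity) (abs_nonneg _)
    · exact mul_le_mul (le_abs_self _) (pow_le_pow_right₀ h1 (by omega)) (by positivity) (abs_nonneg _)

theorem Xop_norm (i : Fin d) : ∃ C, 0 ≤ C ∧ ∀ (u : Rd d → SI d K → ℂ) x, ‖Xop i u x‖ ≤ C * (1 + ‖x‖) * ‖u x‖ := by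
  refine ⟨1 + ∑ k' : SI d K, (k'.1 i : ℝ), by positivity, fun u x => ?_⟩
  rw [pi_norm_le_iff_of_nonneg (by positivity)]
  intro k
  rw [Xop_apply]
  have h1 : ‖∑ k' : SI d K, (if k'.1 = k.1 + Pi.single i 1 then (k'.1 i : ℂ) * u x k' else 0)‖ ≤
      ∑ k' : SI d K, (k'.1 i : ℝ) * ‖u x‖ := by
    refine norm_sum_le_of_le _ fun k' _ => ?_
    split_ifs
    · rw [norm_mul]
      simpa using mul_le_mul_of_nonneg_left (norm_le_pi_norm (u x) k') (Nat.cast_nonneg (k'.1 i))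
    · rw [norm_zero]; positivity
  have h2 : ‖(x i : ℂ) * u x k‖ ≤ ‖x‖ * ‖u x‖ := by
    rw [norm_mul, Complex.norm_real]
    exact mul_le_mul (PiLp.norm_apply_le x i) (norm_le_pi_norm (u x) k) (norm_nonneg _) (norm_nonneg _)
  refine (norm_sub_le _ _).trans ((add_le_add h2 h1).trans ?_)
  rw [← Finset.sum_mul]
  have h3 : 0 ≤ ∑ k' : SI d K, (k'.1 i : ℝ) := by positivity
  have h4 := norm_nonneg (u x)
  have h5 := norm_nonneg x
  nlinarith [mul_nonneg h3 (mul_nonneg h4 h5)]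

theorem Xop_obj (i : Fin d) {u : Rd d → SI d K → ℂ} (hu : Obj u) : Obj (Xop i u) := by
  obtain ⟨⟨D, hD⟩, C, H, hC⟩ := hu
  obtain ⟨C', hC'0, hC'⟩ := Xop_norm (K := K) i
  refine ⟨⟨D, hD.mono fun x hx h => hx ?_⟩, C' * C, H + 1, fun x => ?_⟩
  · have := hC' u x
    rw [h] at this
    simpa using this
  · refine (hC' u x).trans ?_
    calc C' * (1 + ‖x‖) * ‖u x‖ ≤ C' * (1 + ‖x‖) * (C * (1 + ‖x‖) ^ H) :=
          mul_le_mul_of_nonneg_left (hC x) (by positivity)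
      _ = _ := by ring

end CrysConv

section PeelA
open Filter Topology
set_option linter.unusedSectionVars false
variable {d K : ℕ}

/-- kernel -/
def kap (ψ : Sc d) (y : Rd d) : (SI d K → ℂ) →L[ℂ] ℂ :=
  ∑ k : SI d K, (Dk k.1 ψ y) • ContinuousLinearMap.proj (R := ℂ) (φ := fun _ : SI d K => ℂ) k

theorem kap_apply (ψ : Sc d) (y : Rd d) (p : SI d K → ℂ) : kap ψ y p = ∑ k, Dk k.1 ψ y * p k := by
  simp [kap]

/-- windowed transform -/
def aa (u : Rd d → SI d K → ℂ) (η t : Rd d) (ψ : Sc d) : ℂ := pr u (Ph η t ψ)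

/-- rapidly decaying continuous kernels -/
structure Dec (b : Rd d → (SI d K → ℂ) →L[ℂ] ℂ) : Prop where
  cont : Continuous b
  dec : ∀ n : ℕ, ∃ C, 0 ≤ C ∧ ∀ y, ‖b y‖ ≤ C * ((1 + ‖y‖) ^ n)⁻¹

theorem Dec.of_sc (g : Sc d) (k : SI d K) : Dec (fun y => g y •
    ContinuousLinearMap.proj (R := ℂ) (φ := fun _ : SI d K => ℂ) k) := by
  refine ⟨g.continuous.smul continuous_const, fun n => ?_⟩
  obtain ⟨C, hC, h⟩ := Sc_decay g n
  refine ⟨C, hC, fun y => ?_⟩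
  have h1 : ‖ContinuousLinearMap.proj (R := ℂ) (φ := fun _ : SI d K => ℂ) k‖ ≤ 1 :=
    ContinuousLinearMap.opNorm_le_bound _ zero_le_one fun p => by
      rw [one_mul]; exact norm_le_pi_norm p k
  rw [norm_smul]
  calc _ ≤ ‖g y‖ * 1 := mul_le_mul_of_nonneg_left h1 (norm_nonneg _)
    _ ≤ _ := by rw [mul_one]; exact h y

theorem Dec.sum {I : Type*} (T : Finset I) {b : I → Rd d → (SI d K → ℂ) →L[ℂ] ℂ} (h : ∀ i ∈ T, Dec (b i)) :
    Dec fun y => ∑ i ∈ T, b i y := by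
  refine ⟨continuous_finsetSum _ fun i hi => (h i hi).cont, fun n => ?_⟩
  classical
  induction T using Finset.induction_on with
  | empty => exact ⟨0, le_rfl, by simp⟩
  | insert a T ha ih =>
    obtain ⟨C, hC, h1⟩ := ih fun i hi => h i (Finset.mem_insert_of_mem hi)
    obtain ⟨C', hC', h2⟩ := (h a (Finset.mem_insert_self _ _)).dec n
    refine ⟨C' + C, by positivity, fun y => ?_⟩
    rw [Finset.sum_insert ha, add_mul]
    exact (norm_add_le _ _).trans (add_le_add (h2 y) (h1 y))

theorem Dec.smul {b : Rd d → (SI d K → ℂ) →L[ℂ] ℂ} (hb : Dec b) (c : ℂ) : Dec fun y => c • b y := by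
  refine ⟨hb.cont.const_smul c, fun n => ?_⟩
  obtain ⟨C, hC, h⟩ := hb.dec n
  refine ⟨‖c‖ * C, by positivity, fun y => ?_⟩
  rw [norm_smul, mul_assoc]
  exact mul_le_mul_of_nonneg_left (h y) (norm_nonneg _)

theorem Dec.kap (ψ : Sc d) : Dec (kap ψ : Rd d → (SI d K → ℂ) →L[ℂ] ℂ) :=
  Dec.sum _ fun k _ => Dec.of_sc (Dk k.1 ψ) k

theorem expand (ψ : Sc d) : ∃ (I : Type) (_ : Fintype I) (m : I → Fin d → ℕ)
    (b : I → Rd d → (SI d K → ℂ) →L[ℂ] ℂ), (∀ l, Dec (b l)) ∧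
    ∀ (u : Rd d → SI d K → ℂ) η t x, prx u (Ph η t ψ) x =
      (∑ l, monom (m l) η * b l (t - x) (u x)) * e2pi η x := by
  choose n m g h using fun k : SI d K => dkDelta_Ph k.1 ψ
  refine ⟨Σ k : SI d K, Fin (n k), inferInstance, fun l => m l.1 l.2, fun l y => g l.1 l.2 y •
    ContinuousLinearMap.proj (R := ℂ) (φ := fun _ : SI d K => ℂ) l.1, fun l => Dec.of_sc _ _, fun u η t x => ?_⟩
  simp only [prx, h, Fintype.sum_sigma, Finset.sum_mul, Finset.mul_sum]
  refine Finset.sum_congr rfl fun k _ => Finset.sum_congr rfl fun l _ => ?_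
  simp
  ring

theorem prx_Ph_zero (u : Rd d → SI d K → ℂ) (t x : Rd d) (ψ : Sc d) :
    prx u (Ph 0 t ψ) x = kap ψ (t - x) (u x) := by
  simp only [prx, dkDelta_Ph_zero, kap_apply, mul_comm]

theorem Dec.summable {b : Rd d → (SI d K → ℂ) →L[ℂ] ℂ} (hb : Dec b) {u : Rd d → SI d K → ℂ} (hu : Obj u) :
    ∃ (C : ℝ) (H : ℕ), 0 ≤ C ∧ ∀ t, Summable (fun x => ‖b (t - x) (u x)‖) ∧
      ∑' x, ‖b (t - x) (u x)‖ ≤ C * (1 + ‖t‖) ^ H := by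
  obtain ⟨⟨D, hD⟩, C, H, hC⟩ := hu
  obtain ⟨C', hC', h'⟩ := hb.dec (H + (d + 1))
  have hC0 : 0 ≤ |C| := abs_nonneg C
  refine ⟨C' * |C| * D, H, mul_nonneg (mul_nonneg hC' hC0) hD.nonneg, fun t => ?_⟩
  have := hD.summable (fun x => b (t - x) (u x)) (fun x hx h => hx (by simp [h])) (C' * |C| * (1 + ‖t‖) ^ H)
    (by positivity) t fun x => ?_
  · refine ⟨this.1, this.2.trans (le_of_eq (by ring))⟩
  · refine ((b (t - x)).le_opNorm _).trans ?_
    have h1 : ‖u x‖ ≤ |C| * ((1 + ‖t‖) ^ H * (1 + ‖t - x‖) ^ H) := by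
      refine (hC x).trans (mul_le_mul (le_abs_self C) ?_ (by positivity) hC0)
      rw [← mul_pow]
      exact pow_le_pow_left₀ (by positivity) (one_add_norm_le x t) _
    refine (mul_le_mul (h' (t - x)) h1 (norm_nonneg _) (by positivity)).trans (le_of_eq ?_)
    rw [W0, pow_add]
    have h2 : (1 + ‖t - x‖) ≠ 0 := by positivity
    field_simp

theorem PSF.of_fin {ι I : Type*} [Fintype I] (m : I → Fin d → ℕ) (c : I → ι → ℂ) (hc : ∀ l, Summable (c l)) :
    PSF fun η i => ∑ l, monom (m l) η * c l i := by
  classical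
  refine ⟨Finset.univ.image m, fun μ i => ∑ l with m l = μ, c l i, fun μ => summable_sum fun l _ => hc l, fun η i => ?_⟩
  dsimp only
  rw [← Finset.sum_fiberwise_of_maps_to (g := m) (t := Finset.univ.image m) (fun l _ => Finset.mem_image_of_mem _ (Finset.mem_univ l))]
  refine Finset.sum_congr rfl fun μ _ => ?_
  rw [Finset.mul_sum]
  refine Finset.sum_congr rfl fun l hl => ?_
  rw [(Finset.mem_filter.1 hl).2]

theorem monom_add (m m' : Fin d → ℕ) (x : Rd d) : monom (m + m') x = monom m x * monom m' x := by
  simp [monom, pow_add, Finset.prod_mul_distrib]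

theorem conj_monom (m : Fin d → ℕ) (x : Rd d) : (starRingEnd ℂ) (monom m x) = monom m x := by
  rw [monom, Complex.conj_ofReal]

/-- correlation -/
def BB (ψ : Sc d) (u v : Rd d → SI d K → ℂ) (t : Rd d) : ℂ :=
  ∑' x, kap ψ (t - x) (u x) * (starRingEnd ℂ) (kap ψ (t - x) (v x))

theorem isM_prod {u v : Rd d → SI d K → ℂ} (hu : Obj u) (hv : Obj v) (ψ : Sc d) (t : Rd d) :
    IsM (fun η => aa u η t ψ * (starRingEnd ℂ) (aa v η t ψ)) (BB ψ u v t) := by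
  classical
  obtain ⟨I, _, m, b, hb, he⟩ := expand (K := K) ψ
  set P : (Rd d → SI d K → ℂ) → Rd d → Rd d → ℂ := fun u η x => ∑ l, monom (m l) η * b l (t - x) (u x) with hP
  have hs : ∀ {u : Rd d → SI d K → ℂ}, Obj u → ∀ l, Summable fun x => ‖b l (t - x) (u x)‖ := by
    intro u hu l
    obtain ⟨C, H, _, h⟩ := (hb l).summable hu
    exact (h t).1
  have hPs : ∀ {u : Rd d → SI d K → ℂ}, Obj u → ∀ η, Summable fun x => P u η x := fun hu η =>
    summable_sum fun l _ => ((hs hu l).of_norm).mul_left _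
  have hP0 : ∀ u x, P u 0 x = kap ψ (t - x) (u x) := by
    intro u x
    have := he u 0 t x
    rw [e2pi_zero_left, mul_one, prx_Ph_zero] at this
    exact this.symm
  refine ⟨Rd d × Rd d, fun η i => P u η i.1 * (starRingEnd ℂ) (P v η i.2), fun i => i.1 - i.2, ?_, fun η => ?_, ?_⟩
  · have h1 : (fun (η : Rd d) (i : Rd d × Rd d) => P u η i.1 * (starRingEnd ℂ) (P v η i.2)) =
        fun η i => ∑ l : I × I, monom (m l.1 + m l.2) η * (b l.1 (t - i.1) (u i.1) *
          (starRingEnd ℂ) (b l.2 (t - i.2) (v i.2))) := by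
      funext η i
      simp only [hP, map_sum, map_mul, conj_monom, Fintype.sum_prod_type, Finset.sum_mul_sum, monom_add]
      exact Finset.sum_congr rfl fun l _ => Finset.sum_congr rfl fun l' _ => by ring
    rw [h1]
    refine PSF.of_fin _ _ fun l => Summable.of_norm ?_
    have := Summable.mul_norm (f := fun x => b l.1 (t - x) (u x)) (g := fun x => (starRingEnd ℂ) (b l.2 (t - x) (v x)))
      (hs hu l.1) (by simpa using hs hv l.2)
    exact this
  · have h1 : ∀ u, aa u η t ψ = ∑' x, P u η x * e2pi η x := fun u => tsum_congr fun x => he u η t x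
    have h2 : ∀ {u : Rd d → SI d K → ℂ}, Obj u → Summable fun x => ‖P u η x * e2pi η x‖ := fun hu => by
      simpa [norm_e2pi] using (hPs hu η).norm
    dsimp only
    rw [h1, h1, Complex.conj_tsum, tsum_mul_tsum_of_summable_norm (h2 hu) (by simpa using h2 hv)]
    refine tsum_congr fun i => ?_
    rw [map_mul, sub_eq_add_neg, e2pi_add_right, e2pi_neg_right]
    ring
  · have hinj : Function.Injective (fun x : Rd d => (x, x)) := fun x y h => (Prod.ext_iff.1 h).1
    rw [← hinj.tsum_eq]
    · rw [BB]
      refine tsum_congr fun x => ?_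
      simp [hP0]
    · rintro ⟨x, y⟩ h
      by_cases hxy : x - y = 0
      · exact ⟨x, by simp [sub_eq_zero.1 hxy]⟩
      · simp [hxy] at h

theorem exists_family {Ψ : Set (Sc d)} (hΨ : ∀ i, ∀ ψ ∈ Ψ, xm i ψ ∈ Ψ) (h0 : ∃ ψ ∈ Ψ, ψ 0 ≠ 0) :
    ∃ ψ : SI d K → Sc d, (∀ j, ψ j ∈ Ψ) ∧ ∀ p : SI d K → ℂ, (∀ j, kap (ψ j) 0 p = 0) → p = 0 := by
  obtain ⟨ψ0, hψ0, hne⟩ := h0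
  have key : ∀ j : Fin d → ℕ, ∃ ψ ∈ Ψ, ∀ k, Dk k ψ 0 = ((∏ l, (k l).descFactorial (j l) : ℕ) : ℂ) * Dk (k - j) ψ0 0 := by
    intro j
    induction j using midx_ind with
    | h0 => exact ⟨ψ0, hψ0, fun k => by simp⟩
    | h1 j i ih =>
      obtain ⟨ψ, hψ, h⟩ := ih
      refine ⟨xm i ψ, hΨ i ψ hψ, fun k => ?_⟩
      rw [Dk_xm, add_apply, smul_apply, xm_apply, smul_eq_mul]
      have h1 : ∀ l, (k l).descFactorial ((j + Pi.single i 1 : Fin d → ℕ) l) =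
          (if l = i then k i else 1) * ((k - Pi.single i 1 : Fin d → ℕ) l).descFactorial (j l) := by
        intro l
        by_cases hl : l = i
        · subst hl
          simp only [Pi.add_apply, Pi.sub_apply, Pi.single_eq_same, if_true]
          rcases hk : k l with _ | n
          · simp
          · rw [Nat.succ_descFactorial_succ]; rfl
        · simp [hl]
      rw [Finset.prod_congr rfl fun l _ => h1 l, Finset.prod_mul_distrib]
      simp only [Finset.prod_ite_eq', Finset.mem_univ, if_true, PiLp.zero_apply, Complex.ofReal_zero, zero_mul, zero_add]
      have h2 : k - Pi.single i 1 - j = k - (j + Pi.single i 1) := by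
        rw [tsub_tsub, add_comm]
      rw [h, h2]
      push_cast
      ring
  choose ψ hψ h using key
  refine ⟨fun j => ψ j.1, fun j => hψ _, fun p hp => ?_⟩
  by_contra hne'
  obtain ⟨j0, hj0⟩ : ∃ j, p j ≠ 0 := by
    by_contra hcon
    push Not at hcon
    exact hne' (funext hcon)
  obtain ⟨j, hj, hmax⟩ := Finset.exists_max_image (Finset.univ.filter fun j : SI d K => p j ≠ 0)
    (fun j => ∑ i, j.1 i) ⟨j0, by simp [hj0]⟩
  have hpj : p j ≠ 0 := (Finset.mem_filter.1 hj).2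
  have h1 := hp j
  rw [kap_apply, Finset.sum_eq_single j] at h1
  · rw [h, tsub_self, Dk_zero] at h1
    have h2 : (∏ l, (j.1 l).descFactorial (j.1 l)) ≠ 0 :=
      Finset.prod_ne_zero_iff.2 fun l _ => by rw [Nat.descFactorial_self]; exact Nat.factorial_ne_zero _
    have h3 : ((∏ l, (j.1 l).descFactorial (j.1 l) : ℕ) : ℂ) ≠ 0 := Nat.cast_ne_zero.2 h2
    exact mul_ne_zero (mul_ne_zero h3 hne) hpj h1
  · intro k _ hkj
    by_cases hpk : p k = 0
    · rw [hpk, mul_zero]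
    · have h2 := hmax k (Finset.mem_filter.2 ⟨Finset.mem_univ _, hpk⟩)
      obtain ⟨l, hl⟩ : ∃ l, k.1 l < j.1 l := by
        by_contra hcon
        push Not at hcon
        refine hkj (Subtype.ext (funext fun l => ?_))
        by_contra hne2
        have : ∑ i, j.1 i < ∑ i, k.1 i := Finset.sum_lt_sum (fun i _ => hcon i)
          ⟨l, Finset.mem_univ _, lt_of_le_of_ne (hcon l) (Ne.symm hne2)⟩
        omega
      rw [h, Finset.prod_eq_zero (Finset.mem_univ l) (Nat.descFactorial_eq_zero_iff_lt.2 hl)]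
      simp
  · simp

end PeelA

section PeelB
open Filter Topology fwdDiff
set_option linter.unusedSectionVars false
variable {d K : ℕ}

theorem monom_line (m : Fin d → ℕ) (i : Fin d) (t : Rd d) (s : ℝ) :
    monom m (t + s • EuclideanSpace.single i (1:ℝ)) = (((t i : ℝ) : ℂ) + (s : ℂ)) ^ (m i) * monom (Function.update m i 0) t := by
  unfold monom
  have : ∀ l, (t + s • EuclideanSpace.single i (1:ℝ)) l ^ m l =
      (if l = i then (t i + s) ^ m i else 1) * t l ^ (Function.update m i 0 l) := by
    intro l
    by_cases hl : l = i
    · subst hl; simp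
    · simp [hl]
  rw [Finset.prod_congr rfl fun l _ => this l, Finset.prod_mul_distrib]
  simp only [Finset.prod_ite_eq', Finset.mem_univ, if_true]
  push_cast
  rfl

theorem monom_split (m : Fin d → ℕ) (i : Fin d) (t : Rd d) :
    monom m t = ((t i : ℝ) : ℂ) ^ (m i) * monom (Function.update m i 0) t := by
  have := monom_line m i t 0
  simpa using this

/-- polynomials with strict coordinate degree bounds -/
def BS (N : Fin d → ℕ) : Submodule ℂ (Rd d → ℂ) := Submodule.span ℂ {q | ∃ m : Fin d → ℕ, (∀ j, m j < N j) ∧ q = monom m}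

theorem BS_mono {N N' : Fin d → ℕ} (h : N ≤ N') : BS N ≤ BS N' :=
  Submodule.span_mono fun _ ⟨m, hm, hq⟩ => ⟨m, fun j => (hm j).trans_le (h j), hq⟩

theorem BS_mul {N : Fin d → ℕ} {i : Fin d} {n : ℕ} {q : Rd d → ℂ} (hq : q ∈ BS (Function.update N i n)) :
    (fun t : Rd d => ((t i : ℝ) : ℂ) * q t) ∈ BS (Function.update N i (n + 1)) := by
  induction hq using Submodule.span_induction with
  | zero => simp only [Pi.zero_apply, mul_zero]; exact Submodule.zero_mem _
  | add x y _ _ hx hy => simp only [Pi.add_apply, mul_add]; exact Submodule.add_mem _ hx hy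
  | smul c x _ hx =>
    have : (fun t : Rd d => ((t i : ℝ) : ℂ) * (c • x) t) = c • fun t : Rd d => ((t i : ℝ) : ℂ) * x t := by
      funext t; simp; ring
    rw [this]; exact Submodule.smul_mem _ _ hx
  | mem q hq =>
    obtain ⟨m, hm, rfl⟩ := hq
    refine Submodule.subset_span ⟨m + Pi.single i 1, fun j => ?_, funext fun t => (monom_add_single m i t).symm⟩
    have := hm j
    by_cases hj : j = i
    · subst hj; simp at this ⊢; omega
    · simpa [hj] using this

theorem BS_pow {N : Fin d → ℕ} {i : Fin d} {n : ℕ} {q : Rd d → ℂ} (hq : q ∈ BS (Function.update N i 1)) :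
    (fun t : Rd d => ((t i : ℝ) : ℂ) ^ n * q t) ∈ BS (Function.update N i (n + 1)) := by
  induction n with
  | zero => simpa using hq
  | succ n ih =>
    have := BS_mul ih
    simpa only [pow_succ', mul_assoc] using this

theorem BS_poly {N : Fin d → ℕ} {i : Fin d} {n : ℕ} {q : Rd d → ℂ} (hq : q ∈ BS (Function.update N i (n + 1)))
    (t : Rd d) : ∃ P : Polynomial ℂ, P.natDegree ≤ n ∧
      ∀ s : ℕ, q (t + (s : ℝ) • EuclideanSpace.single i (1:ℝ)) = P.eval (s : ℂ) := by
  induction hq using Submodule.span_induction with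
  | zero => exact ⟨0, by simp, by simp⟩
  | add x y _ _ hx hy =>
    obtain ⟨P, hP, h⟩ := hx
    obtain ⟨Q, hQ, h'⟩ := hy
    exact ⟨P + Q, (Polynomial.natDegree_add_le _ _).trans (max_le hP hQ), fun s => by simp [h, h']⟩
  | smul c x _ hx =>
    obtain ⟨P, hP, h⟩ := hx
    exact ⟨c • P, (Polynomial.natDegree_smul_le _ _).trans hP, fun s => by simp [h]⟩
  | mem q hq =>
    obtain ⟨m, hm, rfl⟩ := hq
    have := hm i
    simp at this
    refine ⟨(Polynomial.C ((t i : ℝ) : ℂ) + Polynomial.X) ^ (m i) * Polynomial.C (monom (Function.update m i 0) t), ?_, fun s => ?_⟩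
    · refine (Polynomial.natDegree_mul_C_le _ _).trans (Polynomial.natDegree_pow_le.trans ?_)
      have h1 : (Polynomial.C ((t i : ℝ) : ℂ) + Polynomial.X).natDegree ≤ 1 :=
        (Polynomial.natDegree_add_le _ _).trans (by simp)
      nlinarith
    · rw [monom_line]
      simp

theorem tends_pow (a : ℂ) (n k : ℕ) (hk : k ≤ n) :
    Tendsto (fun j : ℕ => ((1 + (j : ℂ)) ^ n)⁻¹ * (a + j) ^ k) atTop (𝓝 (if k = n then 1 else 0)) := by
  have hinv : Tendsto (fun j : ℕ => (1 + (j : ℂ))⁻¹) atTop (𝓝 0) := by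
    have h := tendsto_one_div_add_atTop_nhds_zero_nat (𝕜 := ℂ)
    refine h.congr fun j => ?_
    rw [one_div, add_comm]
  have h1 : Tendsto (fun j : ℕ => (1 + (a - 1) * (1 + (j : ℂ))⁻¹) ^ k * ((1 + (j : ℂ))⁻¹) ^ (n - k)) atTop
      (𝓝 ((1 + (a - 1) * 0) ^ k * 0 ^ (n - k))) :=
    ((tendsto_const_nhds.add (hinv.const_mul _)).pow k).mul (hinv.pow _)
  have h2 : ((1 + (a - 1) * 0) ^ k * 0 ^ (n - k) : ℂ) = if k = n then 1 else 0 := by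
    split_ifs with h
    · subst h; simp
    · rw [zero_pow (by omega), mul_zero]
  rw [h2] at h1
  refine h1.congr fun j => ?_
  have hj : (1 + (j : ℂ)) ≠ 0 := by
    have : ((j + 1 : ℕ) : ℂ) ≠ 0 := Nat.cast_ne_zero.2 (by omega)
    rw [add_comm]; exact_mod_cast this
  have h3 : 1 + (a - 1) * (1 + (j : ℂ))⁻¹ = (a + j) * (1 + (j : ℂ))⁻¹ := by
    field_simp; ring
  rw [h3, mul_pow, mul_assoc, ← pow_add, inv_pow, Nat.add_sub_cancel' hk]
  ring

theorem BS_split {N : Fin d → ℕ} {i : Fin d} {n : ℕ} {q : Rd d → ℂ} (hq : q ∈ BS (Function.update N i (n + 1))) :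
    ∃ q1 ∈ BS (Function.update N i 1), ∃ q2 ∈ BS (Function.update N i n),
      (∀ t, q t = ((t i : ℝ) : ℂ) ^ n * q1 t + q2 t) ∧
      ∀ t, Tendsto (fun j : ℕ => ((1 + (j : ℂ)) ^ n)⁻¹ * q (t + (j : ℝ) • EuclideanSpace.single i (1:ℝ))) atTop (𝓝 (q1 t)) := by
  induction hq using Submodule.span_induction with
  | zero => exact ⟨0, Submodule.zero_mem _, 0, Submodule.zero_mem _, by simp, by simp⟩
  | add x y _ _ hx hy =>
    obtain ⟨a, ha, b, hb, h1, h2⟩ := hx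
    obtain ⟨a', ha', b', hb', h1', h2'⟩ := hy
    refine ⟨a + a', Submodule.add_mem _ ha ha', b + b', Submodule.add_mem _ hb hb', fun t => ?_, fun t => ?_⟩
    · simp only [Pi.add_apply, h1, h1']; ring
    · refine ((h2 t).add (h2' t)).congr fun j => ?_
      simp only [Pi.add_apply]; ring
  | smul c x _ hx =>
    obtain ⟨a, ha, b, hb, h1, h2⟩ := hx
    refine ⟨c • a, Submodule.smul_mem _ _ ha, c • b, Submodule.smul_mem _ _ hb, fun t => ?_, fun t => ?_⟩
    · simp only [Pi.smul_apply, h1, smul_eq_mul]; ring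
    · refine ((h2 t).const_mul c).congr fun j => ?_
      simp only [Pi.smul_apply, smul_eq_mul]; ring
  | mem q hq =>
    obtain ⟨m, hm, rfl⟩ := hq
    have hmi := hm i
    simp at hmi
    have htend : ∀ t : Rd d, Tendsto (fun j : ℕ => ((1 + (j : ℂ)) ^ n)⁻¹ * monom m (t + (j : ℝ) • EuclideanSpace.single i (1:ℝ))) atTop
        (𝓝 ((if m i = n then 1 else 0) * monom (Function.update m i 0) t)) := by
      intro t
      refine ((tends_pow ((t i : ℝ) : ℂ) n (m i) (by omega)).mul_const (monom (Function.update m i 0) t)).congr fun j => ?_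
      rw [monom_line]
      push_cast
      ring
    by_cases h : m i = n
    · refine ⟨monom (Function.update m i 0), Submodule.subset_span ⟨_, fun j => ?_, rfl⟩, 0, Submodule.zero_mem _,
        fun t => ?_, fun t => by simpa [h] using htend t⟩
      · have := hm j
        by_cases hj : j = i
        · subst hj; simp
        · simpa [hj] using this
      · rw [monom_split m i t, h]; simp
    · refine ⟨0, Submodule.zero_mem _, monom m, Submodule.subset_span ⟨_, fun j => ?_, rfl⟩, fun t => by simp,
        fun t => by simpa [h] using htend t⟩
      have := hm j
      by_cases hj : j = i
      · subst hj; simp; omega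
      · simpa [hj] using this

/-- polynomial windowed transforms -/
def PM (Ψ : Set (Sc d)) (γ : Rd d → Rd d) (N : Fin d → ℕ) (u : Rd d → SI d K → ℂ) : Prop :=
  ∀ ψ ∈ Ψ, ∀ η, ∃ q ∈ BS N, ∀ t, aa u η t ψ = e2pi (γ η) t * q t

theorem prx_summable {u : Rd d → SI d K → ℂ} (hu : Obj u) (η t : Rd d) (ψ : Sc d) :
    Summable fun x => prx u (Ph η t ψ) x := by
  obtain ⟨I, _, m, b, hb, he⟩ := expand (K := K) ψ
  simp only [he]
  refine summable_mul_e2pi (summable_sum fun l _ => ?_) η (fun x => x)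
  obtain ⟨C, H, _, h⟩ := (hb l).summable hu
  exact ((h t).1.of_norm).mul_left _

theorem aa_add {u v : Rd d → SI d K → ℂ} (hu : Obj u) (hv : Obj v) (η t : Rd d) (ψ : Sc d) :
    aa (u + v) η t ψ = aa u η t ψ + aa v η t ψ := by
  simp only [aa, pr]
  rw [← (prx_summable hu η t ψ).tsum_add (prx_summable hv η t ψ)]
  refine tsum_congr fun x => ?_
  simp only [prx, Pi.add_apply, add_mul, Finset.sum_add_distrib]

theorem aa_smul (c : ℂ) (u : Rd d → SI d K → ℂ) (η t : Rd d) (ψ : Sc d) :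
    aa (c • u) η t ψ = c * aa u η t ψ := by
  simp only [aa, pr, ← tsum_mul_left]
  refine tsum_congr fun x => ?_
  simp only [prx, Pi.smul_apply, smul_eq_mul, Finset.mul_sum, mul_assoc]

theorem aa_Xop {u : Rd d → SI d K → ℂ} (hu : Obj u) (i : Fin d) (η t : Rd d) (ψ : Sc d) :
    aa (Xop i u) η t ψ = ((t i : ℝ) : ℂ) * aa u η t ψ - aa u η t (xm i ψ) := by
  rw [aa, pr_Xop, xm_Ph]
  simp only [aa, pr]
  rw [← tsum_mul_left, ← ((prx_summable hu η t ψ).mul_left _).tsum_sub (prx_summable hu η t _)]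
  refine tsum_congr fun x => ?_
  simp only [prx, Finset.mul_sum, ← Finset.sum_sub_distrib]
  refine Finset.sum_congr rfl fun k _ => ?_
  rw [dkDelta_eq, map_sub, map_smul, sub_apply, smul_apply, dkDelta_eq, dkDelta_eq, smul_eq_mul]
  ring

theorem aa_shift (u : Rd d → SI d K → ℂ) (h η t : Rd d) (ψ : Sc d) :
    aa (fun x => u (x + h)) η t ψ = (starRingEnd ℂ) (e2pi η h) * aa u η (t + h) ψ := by
  obtain ⟨I, _, m, b, hb, he⟩ := expand (K := K) ψ
  simp only [aa, pr]
  rw [← (Equiv.addRight h).tsum_eq (fun x => prx u (Ph η (t + h) ψ) x), ← tsum_mul_left]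
  refine tsum_congr fun x => ?_
  rw [he, he]
  simp only [Equiv.coe_addRight, add_sub_add_right_eq_sub, e2pi_add_right]
  linear_combination (-(∑ l, monom (m l) η * b l (t - x) (u (x + h))) * e2pi η x) * e2pi_mul_conj η h

theorem Obj.shift {u : Rd d → SI d K → ℂ} (hu : Obj u) (h : Rd d) : Obj fun x => u (x + h) := by
  obtain ⟨⟨D, hD⟩, C, H, hC⟩ := hu
  refine ⟨⟨D, hD.shift h⟩, |C| * (1 + ‖h‖) ^ H, H, fun x => (hC _).trans ?_⟩
  rw [mul_assoc, ← mul_pow]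
  refine mul_le_mul (le_abs_self _) (pow_le_pow_left₀ (by positivity) ?_ _) (by positivity) (abs_nonneg _)
  have := norm_add_le x h
  nlinarith [norm_nonneg x, norm_nonneg h]

theorem kap_sq_summable {u : Rd d → SI d K → ℂ} (hu : Obj u) (ψ : Sc d) : ∃ (C : ℝ) (H : ℕ), 0 ≤ C ∧
    ∀ t, Summable (fun x => ‖kap ψ (t - x) (u x)‖ ^ 2) ∧ ∑' x, ‖kap ψ (t - x) (u x)‖ ^ 2 ≤ C * (1 + ‖t‖) ^ H := by
  obtain ⟨C, H, hC, h⟩ := (Dec.kap ψ).summable hu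
  refine ⟨C ^ 2, 2 * H, by positivity, fun t => ?_⟩
  obtain ⟨h1, h2⟩ := h t
  have h3 : ∀ x, ‖kap ψ (t - x) (u x)‖ ^ 2 ≤ (∑' x, ‖kap ψ (t - x) (u x)‖) * ‖kap ψ (t - x) (u x)‖ := by
    intro x
    rw [sq]
    exact mul_le_mul_of_nonneg_right (h1.le_tsum x fun _ _ => norm_nonneg _) (norm_nonneg _)
  have h4 : Summable fun x => (∑' x, ‖kap ψ (t - x) (u x)‖) * ‖kap ψ (t - x) (u x)‖ := h1.mul_left _
  have h5 := Summable.of_nonneg_of_le (fun x => sq_nonneg _) h3 h4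
  refine ⟨h5, (h5.tsum_le_tsum h3 h4).trans ?_⟩
  rw [tsum_mul_left, pow_mul', ← mul_pow, ← sq]
  exact pow_le_pow_left₀ (tsum_nonneg fun _ => norm_nonneg _) h2 2

theorem BB_self (ψ : Sc d) (u : Rd d → SI d K → ℂ) (t : Rd d) :
    BB ψ u u t = ((∑' x, ‖kap ψ (t - x) (u x)‖ ^ 2 : ℝ) : ℂ) := by
  rw [BB, Complex.ofReal_tsum]
  refine tsum_congr fun x => ?_
  rw [Complex.mul_conj, Complex.normSq_eq_norm_sq]

theorem BB_ge {u : Rd d → SI d K → ℂ} (hu : Obj u) (ψ : Sc d) (t : Rd d) :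
    ‖kap ψ 0 (u t)‖ ^ 2 ≤ ‖BB ψ u u t‖ := by
  obtain ⟨C, H, hC, h⟩ := kap_sq_summable hu ψ
  rw [BB_self, Complex.norm_real, Real.norm_eq_abs]
  refine le_trans ?_ (le_abs_self _)
  have := (h t).1.le_tsum t fun _ _ => sq_nonneg _
  simpa using this

theorem aa_unique {Ψ : Set (Sc d)} (hΨ : ∀ i, ∀ ψ ∈ Ψ, xm i ψ ∈ Ψ) (h0 : ∃ ψ ∈ Ψ, ψ 0 ≠ 0)
    {u : Rd d → SI d K → ℂ} (hu : Obj u) (h : ∀ ψ ∈ Ψ, ∀ η t, aa u η t ψ = 0) : u = 0 := by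
  obtain ⟨ψ, hψ, hinj⟩ := exists_family (K := K) hΨ h0
  funext t
  refine hinj _ fun j => ?_
  have h1 : BB (ψ j) u u t = 0 := (isM_prod hu hu (ψ j) t).eq_zero fun η => by rw [h _ (hψ j), zero_mul]
  have h2 := BB_ge hu (ψ j) t
  rw [h1, norm_zero] at h2
  have h3 : ‖kap (ψ j) 0 (u t)‖ ^ 2 = 0 := le_antisymm h2 (sq_nonneg _)
  simpa using h3

end PeelB

section PeelC
open Filter Topology
set_option linter.unusedSectionVars false
variable {d K : ℕ}

theorem isM_diff {E : Rd d → Rd d → ℂ} {B : Rd d → ℂ} (h : ∀ t, IsM (fun η => E η t) (B t)) (v : Rd d) (s : ℕ) :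
    ∀ t, IsM (fun η => (fwdDiff v)^[s] (E η) t) ((fwdDiff v)^[s] B t) := by
  induction s with
  | zero => simpa using h
  | succ s ih =>
    intro t
    simp only [Function.iterate_succ_apply', fwdDiff]
    have := (ih (t + v)).add ((ih t).smul (-1))
    simpa only [neg_one_mul, ← sub_eq_add_neg] using this

theorem diff_bound {B : Rd d → ℂ} {C : ℝ} {H : ℕ} (hC : 0 ≤ C) (h : ∀ t, ‖B t‖ ≤ C * (1 + ‖t‖) ^ H) (v : Rd d)
    (s : ℕ) : ∀ t, ‖(fwdDiff v)^[s] B t‖ ≤ C * ((1 + ‖v‖) ^ H + 1) ^ s * (1 + ‖t‖) ^ H := by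
  induction s with
  | zero => simpa using h
  | succ s ih =>
    intro t
    simp only [Function.iterate_succ_apply', fwdDiff]
    refine (norm_sub_le _ _).trans ((add_le_add (ih _) (ih _)).trans ?_)
    have h1 : (1 + ‖t + v‖) ^ H ≤ (1 + ‖v‖) ^ H * (1 + ‖t‖) ^ H := by
      rw [← mul_pow]
      refine pow_le_pow_left₀ (by positivity) ?_ _
      have := norm_add_le t v
      nlinarith [norm_nonneg t, norm_nonneg v]
    rw [pow_succ]
    have h2 : 0 ≤ C * ((1 + ‖v‖) ^ H + 1) ^ s := by positivity
    nlinarith [mul_le_mul_of_nonneg_left h1 h2]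

theorem poly_diff {g : Rd d → ℂ} {v t : Rd d} {P : Polynomial ℂ} {n s : ℕ} (hP : P.natDegree ≤ n) (hs : n < s)
    (h : ∀ j : ℕ, g (t + (j : ℝ) • v) = P.eval (j : ℂ)) : (fwdDiff v)^[s] g t = 0 := by
  have h1 := congrFun (Polynomial.fwdDiff_iter_eq_zero_of_degree_lt (hP.trans_lt hs)) (0 : ℂ)
  rw [fwdDiff_iter_eq_sum_shift] at h1 ⊢
  rw [← h1.trans (Pi.zero_apply _)]
  refine Finset.sum_congr rfl fun k _ => ?_
  rw [← Nat.cast_smul_eq_nsmul ℝ, h]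
  simp

theorem BB_growth {Ψ : Set (Sc d)} {γ : Rd d → Rd d} {N : Fin d → ℕ} {i : Fin d} {n : ℕ} {u : Rd d → SI d K → ℂ}
    (hu : Obj u) (hp : PM Ψ γ (Function.update N i (n + 1)) u) {ψ : Sc d} (hψ : ψ ∈ Ψ) :
    ∃ (C : ℝ) (H : ℕ), 0 ≤ C ∧ ∀ (j : ℕ) t,
      ‖BB ψ u u (t + (j : ℝ) • EuclideanSpace.single i (1:ℝ))‖ ≤ C * (1 + (j : ℝ)) ^ (2 * n) * (1 + ‖t‖) ^ H := by
  obtain ⟨C, H, hC, hsum⟩ := kap_sq_summable hu ψ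
  have hB : ∀ t, ‖BB ψ u u t‖ ≤ C * (1 + ‖t‖) ^ H := by
    intro t
    rw [BB_self, Complex.norm_real, Real.norm_eq_abs, abs_of_nonneg (tsum_nonneg fun _ => sq_nonneg _)]
    exact (hsum t).2
  set v : Rd d := EuclideanSpace.single i (1:ℝ) with hv
  set A : ℝ := (1 + ‖v‖) ^ H + 1 with hA
  have hA0 : 0 ≤ A := by positivity
  have hz : ∀ s t, 2 * n < s → (fwdDiff v)^[s] (BB ψ u u) t = 0 := by
    intro s t hs
    refine (isM_diff (fun t => isM_prod hu hu ψ t) v s t).eq_zero fun η => ?_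
    obtain ⟨q, hq, he⟩ := hp ψ hψ η
    obtain ⟨P, hP, hPe⟩ := BS_poly hq t
    refine poly_diff (P := P * P.map (starRingEnd ℂ)) (n := 2 * n) ?_ hs fun j => ?_
    · refine Polynomial.natDegree_mul_le.trans ?_
      have := Polynomial.natDegree_map_le (p := P) (f := starRingEnd ℂ)
      omega
    · have h1 := e2pi_mul_conj (γ η) (t + (j : ℝ) • v)
      rw [he, hPe, Polynomial.eval_mul, Polynomial.eval_natCast_map, map_mul]
      linear_combination (Polynomial.eval (j : ℂ) P * (starRingEnd ℂ) (Polynomial.eval (j : ℂ) P)) * h1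
  refine ⟨∑ k ∈ Finset.range (2 * n + 1), C * A ^ k, H, Finset.sum_nonneg fun _ _ => by positivity, fun j t => ?_⟩
  rw [Nat.cast_smul_eq_nsmul ℝ, shift_eq_sum_fwdDiff_iter v (BB ψ u u) j t]
  have h1 : ∑ k ∈ Finset.range (j + 1), j.choose k • (fwdDiff v)^[k] (BB ψ u u) t =
      ∑ k ∈ Finset.range (2 * n + 1), j.choose k • (fwdDiff v)^[k] (BB ψ u u) t := by
    rcases le_total j (2 * n) with h | h
    · refine Finset.sum_subset (Finset.range_subset_range.2 (by omega)) fun k _ hk => ?_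
      rw [Nat.choose_eq_zero_of_lt (by simpa using hk), zero_smul]
    · refine (Finset.sum_subset (Finset.range_subset_range.2 (by omega)) fun k _ hk => ?_).symm
      rw [hz _ _ (by simpa using hk), smul_zero]
  rw [h1, Finset.sum_mul, Finset.sum_mul]
  refine norm_sum_le_of_le _ fun k hk => ?_
  have hk' : k ≤ 2 * n := by simp at hk; omega
  rw [nsmul_eq_mul, norm_mul, Complex.norm_natCast]
  have h2 : (j.choose k : ℝ) ≤ (1 + (j : ℝ)) ^ (2 * n) := by
    have : (j.choose k : ℝ) ≤ (j : ℝ) ^ k := by exact_mod_cast Nat.choose_le_pow j k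
    refine this.trans ((pow_le_pow_left₀ (by positivity) (by linarith) k).trans (pow_le_pow_right₀ ?_ hk'))
    have : (0 : ℝ) ≤ j := by positivity
    linarith
  refine (mul_le_mul h2 (diff_bound hC hB v k t) (norm_nonneg _) (by positivity)).trans (le_of_eq (by ring))

theorem growth {Ψ : Set (Sc d)} (hΨ : ∀ i, ∀ ψ ∈ Ψ, xm i ψ ∈ Ψ) (h0 : ∃ ψ ∈ Ψ, ψ 0 ≠ 0)
    {γ : Rd d → Rd d} {N : Fin d → ℕ} {i : Fin d} {n : ℕ} {u : Rd d → SI d K → ℂ}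
    (hu : Obj u) (hp : PM Ψ γ (Function.update N i (n + 1)) u) :
    ∃ (C : ℝ) (H : ℕ), 0 ≤ C ∧ ∀ (j : ℕ) x,
      ‖u (x + (j : ℝ) • EuclideanSpace.single i (1:ℝ))‖ ≤ C * (1 + (j : ℝ)) ^ n * (1 + ‖x‖) ^ H := by
  obtain ⟨ψ, hψ, hinj⟩ := exists_family (K := K) hΨ h0
  let T : (SI d K → ℂ) →ₗ[ℂ] (SI d K → ℂ) := LinearMap.pi fun j => (kap (ψ j) 0 : (SI d K → ℂ) →L[ℂ] ℂ).toLinearMap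
  have hker : LinearMap.ker T = ⊥ := by
    rw [LinearMap.ker_eq_bot']
    intro p hp
    exact hinj p fun j => congrFun hp j
  obtain ⟨k, hk, hT⟩ := LinearMap.exists_antilipschitzWith T hker
  have hT' : ∀ p, ‖p‖ ≤ k * ‖T p‖ := fun p => by
    have := hT.le_mul_dist p 0
    simpa using this
  choose C H hC hB using fun j => BB_growth hu hp (hψ j)
  have key : ∀ (l : ℕ) x j, ‖kap (ψ j) 0 (u (x + (l : ℝ) • EuclideanSpace.single i (1:ℝ)))‖ ≤
      (∑ j, (1 + C j)) * (1 + (l : ℝ)) ^ n * (1 + ‖x‖) ^ (∑ j, H j) := by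
    intro l x j
    have h1 := (BB_ge hu (ψ j) (x + (l : ℝ) • EuclideanSpace.single i (1:ℝ))).trans (hB j l x)
    have h2 : C j * (1 + (l : ℝ)) ^ (2 * n) * (1 + ‖x‖) ^ (H j) ≤
        ((1 + C j) * (1 + (l : ℝ)) ^ n * (1 + ‖x‖) ^ (H j)) ^ 2 := by
      rw [mul_pow, mul_pow, ← pow_mul, ← pow_mul, mul_comm n 2]
      refine mul_le_mul (mul_le_mul_of_nonneg_right ?_ (by positivity)) (pow_le_pow_right₀ (by linarith [norm_nonneg x]) (by omega))
        (by positivity) (by positivity)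
      nlinarith [hC j]
    have h3 := abs_le_of_sq_le_sq (h1.trans h2) (by have := hC j; positivity)
    refine (le_abs_self _).trans (h3.trans ?_)
    have h4 : 1 + C j ≤ ∑ j, (1 + C j) := Finset.single_le_sum (f := fun j => 1 + C j) (fun j _ => by linarith [hC j]) (Finset.mem_univ j)
    have h5 : H j ≤ ∑ j, H j := Finset.single_le_sum (f := H) (fun j _ => Nat.zero_le _) (Finset.mem_univ j)
    have h6 := hC j
    refine mul_le_mul (mul_le_mul_of_nonneg_right h4 (by positivity)) (pow_le_pow_right₀ (by linarith [norm_nonneg x]) h5)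
      (by positivity) (mul_nonneg (by linarith) (by positivity))
  have hS : 0 ≤ ∑ j, (1 + C j) := Finset.sum_nonneg fun j _ => by linarith [hC j]
  refine ⟨k * ∑ j, (1 + C j), ∑ j, H j, by positivity, fun l x => (hT' _).trans ?_⟩
  have h7 : ‖T (u (x + (l : ℝ) • EuclideanSpace.single i (1:ℝ)))‖ ≤ (∑ j, (1 + C j)) * (1 + (l : ℝ)) ^ n * (1 + ‖x‖) ^ (∑ j, H j) := by
    rw [pi_norm_le_iff_of_nonneg (by positivity)]
    exact fun j => key l x j
  refine (mul_le_mul_of_nonneg_left h7 k.2).trans (le_of_eq ?_)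
  rw [← mul_assoc, ← mul_assoc]
  rfl

end PeelC

section PeelD
open Filter Topology
set_option linter.unusedSectionVars false
variable {d K : ℕ}

theorem BS_zero {N : Fin d → ℕ} {j : Fin d} (hj : N j = 0) {q : Rd d → ℂ} (hq : q ∈ BS N) : q = 0 := by
  have : {q : Rd d → ℂ | ∃ m : Fin d → ℕ, (∀ j, m j < N j) ∧ q = monom m} = ∅ := by
    refine Set.eq_empty_of_forall_notMem fun q hq => ?_
    obtain ⟨m, hm, _⟩ := hq
    have := hm j
    omega
  rw [BS, this, Submodule.span_empty] at hq
  simpa using hq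

theorem BS_one {N : Fin d → ℕ} (hN : ∀ j, N j ≤ 1) {q : Rd d → ℂ} (hq : q ∈ BS N) (t : Rd d) : q t = q 0 := by
  induction hq using Submodule.span_induction with
  | zero => rfl
  | add x y _ _ hx hy => rw [Pi.add_apply, Pi.add_apply, hx, hy]
  | smul c x _ hx => rw [Pi.smul_apply, Pi.smul_apply, hx]
  | mem q hq =>
    obtain ⟨m, hm, rfl⟩ := hq
    have h : ∀ j, m j = 0 := fun j => by have := hm j; have := hN j; omega
    simp [monom, h]

theorem lim_step {Ψ : Set (Sc d)} (hΨ : ∀ i, ∀ ψ ∈ Ψ, xm i ψ ∈ Ψ) (h0 : ∃ ψ ∈ Ψ, ψ 0 ≠ 0)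
    {γ : Rd d → Rd d} {N : Fin d → ℕ} {i : Fin d} {n : ℕ} {u : Rd d → SI d K → ℂ}
    (hu : Obj u) (hp : PM Ψ γ (Function.update N i (n + 1)) u)
    {ι : Type} {U : Ultrafilter ι} {m : ι → ℕ} (hs : IsSys U m) (g : Rd d → SI d K → ℂ)
    (hg : g = uLim U (fun k x => ((1 + (m k : ℂ)) ^ n)⁻¹ • u (x + (m k : ℝ) • EuclideanSpace.single i (1:ℝ)))) :
    Obj g ∧ ∀ ψ ∈ Ψ, ∀ η, ∃ q1 ∈ BS (Function.update N i 1), ∃ q2 ∈ BS (Function.update N i n), ∀ t,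
      aa u η t ψ = e2pi (γ η) t * (((t i : ℝ) : ℂ) ^ n * q1 t + q2 t) ∧ aa g η t ψ = e2pi (γ η) t * q1 t := by
  set e : Rd d := EuclideanSpace.single i (1:ℝ) with he
  obtain ⟨C, H, hC, hgr⟩ := growth hΨ h0 hu hp
  obtain ⟨D, hD⟩ := hu.1
  set w : ι → Rd d → SI d K → ℂ := fun k x => ((1 + (m k : ℂ)) ^ n)⁻¹ • u (x + (m k : ℝ) • e) with hw
  have hwD : ∀ k, BD D (Function.support (w k)) := fun k =>
    (hD.shift ((m k : ℝ) • e)).mono fun x hx h => hx (by simp only [hw, h, smul_zero])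
  have hn1 : ∀ k, ‖(1 + (m k : ℂ))‖ = 1 + (m k : ℝ) := fun k => by
    rw [add_comm, add_comm (1:ℝ)]
    exact_mod_cast Complex.norm_natCast (m k + 1)
  have hwg : ∀ k x, ‖w k x‖ ≤ C * (1 + ‖x‖) ^ H := by
    intro k x
    rw [hw]
    dsimp only
    rw [norm_smul, norm_inv, norm_pow, hn1]
    have h1 : (0:ℝ) < (1 + (m k : ℝ)) ^ n := by positivity
    rw [inv_mul_le_iff₀ h1]
    exact (hgr (m k) x).trans (le_of_eq (by ring))
  have hOg : Obj g := by
    rw [hg]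
    exact ⟨⟨D, uLim_bd hwD hwg hC⟩, D * C, H, uLim_norm_le hwD hwg hC⟩
  refine ⟨hOg, fun ψ hψ η => ?_⟩
  obtain ⟨q, hq, hqe⟩ := hp ψ hψ η
  obtain ⟨q1, hq1, q2, hq2, hsplit, hlim⟩ := BS_split hq
  refine ⟨q1, hq1, q2, hq2, fun t => ⟨by rw [hqe, hsplit], ?_⟩⟩
  obtain ⟨I, _, mm, b, hb, hexp⟩ := expand (K := K) ψ
  have hDec : Dec (fun y => ∑ l, monom (mm l) η • b l y) := Dec.sum _ fun l _ => (hb l).smul _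
  obtain ⟨C', hC', hdec⟩ := hDec.dec (H + d + 2)
  have hpr : ∀ (v : Rd d → SI d K → ℂ) x, prx v (Ph η t ψ) x =
      (e2pi η x • ∑ l, monom (mm l) η • b l (t - x)) (v x) := by
    intro v x
    rw [hexp]
    simp [mul_comm]
  have hcont : Continuous fun x : Rd d => e2pi η x := by
    unfold e2pi
    fun_prop
  have hL := uLim_pair (U := U) hwD hwg hC (fun x => e2pi η x • ∑ l, monom (mm l) η • b l (t - x))
    (hcont.smul (hDec.cont.comp (continuous_const.sub continuous_id))) (C' * (1 + ‖t‖) ^ (H + d + 2)) (by positivity)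
    (fun x => by
      rw [norm_smul, norm_e2pi, one_mul]
      refine (hdec (t - x)).trans ?_
      rw [mul_assoc]
      refine mul_le_mul_of_nonneg_left ?_ hC'
      rw [← div_eq_mul_inv, inv_eq_one_div, div_le_div_iff₀ (by positivity) (by positivity), one_mul, ← mul_pow]
      exact pow_le_pow_left₀ (by positivity) (one_add_norm_le x t) _)
  rw [← hg] at hL
  simp only [← hpr] at hL
  have hL' : Tendsto (fun k => aa (w k) η t ψ) U (𝓝 (aa g η t ψ)) := hL
  refine tendsto_nhds_unique hL' ?_
  have haw : ∀ k, aa (w k) η t ψ = (starRingEnd ℂ) (e2pi e η ^ m k) * (e2pi (γ η) t * e2pi e (γ η) ^ m k) *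
      (((1 + (m k : ℂ)) ^ n)⁻¹ * q (t + (m k : ℝ) • e)) := by
    intro k
    have : w k = ((1 + (m k : ℂ)) ^ n)⁻¹ • fun x => u (x + (m k : ℝ) • e) := rfl
    rw [this, aa_smul, aa_shift, hqe, e2pi_add_right, e2pi_comm η, e2pi_comm (γ η) ((m k : ℝ) • e), e2pi_nsmul_left,
      e2pi_nsmul_left]
    ring
  simp only [haw]
  have h1 := hs.one _ (norm_e2pi e η)
  have h2 := hs.one _ (norm_e2pi e (γ η))
  have h3 := (hlim t).comp hs.top
  have h4 := (((Complex.continuous_conj.tendsto _).comp h1).mul ((tendsto_const_nhds (x := e2pi (γ η) t)).mul h2)).mul h3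
  simpa using h4

theorem Xop_pow {Ψ : Set (Sc d)} (hΨ : ∀ i, ∀ ψ ∈ Ψ, xm i ψ ∈ Ψ) {γ : Rd d → Rd d} {N : Fin d → ℕ} {i : Fin d}
    {g : Rd d → SI d K → ℂ} (hg : Obj g) (hp : PM Ψ γ (Function.update N i 1) g) (n : ℕ) :
    Obj ((Xop i)^[n] g) ∧ ∀ ψ ∈ Ψ, ∀ η, ∀ q1 : Rd d → ℂ, (∀ t, aa g η t ψ = e2pi (γ η) t * q1 t) →
      ∃ r ∈ BS (Function.update N i n), ∀ t, aa ((Xop i)^[n] g) η t ψ =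
        e2pi (γ η) t * (((t i : ℝ) : ℂ) ^ n * q1 t + r t) := by
  induction n with
  | zero =>
    exact ⟨hg, fun ψ hψ η q1 h => ⟨0, Submodule.zero_mem _, fun t => by simpa using h t⟩⟩
  | succ n ih =>
    obtain ⟨ho, ih⟩ := ih
    rw [Function.iterate_succ_apply']
    refine ⟨Xop_obj i ho, fun ψ hψ η q1 h => ?_⟩
    obtain ⟨r, hr, h1⟩ := ih ψ hψ η q1 h
    obtain ⟨q', hq', h'⟩ := hp _ (hΨ i ψ hψ) η
    obtain ⟨r', hr', h2⟩ := ih _ (hΨ i ψ hψ) η q' h'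
    have hm : BS (Function.update N i n) ≤ BS (Function.update N i (n + 1)) :=
      BS_mono (update_le_update_iff.2 ⟨by omega, fun _ _ => le_rfl⟩)
    refine ⟨_, Submodule.sub_mem _ (BS_mul hr) (Submodule.add_mem _ (BS_pow hq') (hm hr')), fun t => ?_⟩
    rw [aa_Xop ho, h1, h2]
    simp only [Pi.sub_apply, Pi.add_apply]
    ring

theorem crys_base {Ψ : Set (Sc d)} (hΨ : ∀ i, ∀ ψ ∈ Ψ, xm i ψ ∈ Ψ) (h0 : ∃ ψ ∈ Ψ, ψ 0 ≠ 0)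
    {γ : Rd d → Rd d} {u : Rd d → SI d K → ℂ}
    (hu : Obj u) (hp : PM Ψ γ (fun _ => 1) u) : u ∈ Crys d (SI d K) := by
  obtain ⟨ψ, hψ, hinj⟩ := exists_family (K := K) hΨ h0
  have hdec : ∀ j, ∃ C, 0 ≤ C ∧ ∀ y, ‖(kap (ψ j) y : (SI d K → ℂ) →L[ℂ] ℂ)‖ ≤ C * ((1 + ‖y‖) ^ (d + 1))⁻¹ :=
    fun j => (Dec.kap (ψ j)).dec (d + 1)
  choose C hC hdec using hdec
  obtain ⟨D, hD⟩ := hu.1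
  refine crys_of_kernel (fun j => kap (ψ j)) u (A := ∑ j, C j ^ 2) (Finset.sum_nonneg fun _ _ => sq_nonneg _) ?_ hinj ?_ ?_ hD ?_
  · intro j y
    have hW : 0 ≤ W0 y := by unfold W0; positivity
    have hW1 : W0 y ≤ 1 := by
      unfold W0
      exact inv_le_one_of_one_le₀ (one_le_pow₀ (by linarith [norm_nonneg y]))
    have h1 : ‖(kap (ψ j) y : (SI d K → ℂ) →L[ℂ] ℂ)‖ ^ 2 ≤ (C j * W0 y) ^ 2 :=
      pow_le_pow_left₀ (norm_nonneg _) (hdec j y) 2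
    refine h1.trans ?_
    rw [mul_pow]
    refine mul_le_mul (Finset.single_le_sum (f := fun j => C j ^ 2) (fun j _ => sq_nonneg _) (Finset.mem_univ j))
      (by nlinarith) (by positivity) (Finset.sum_nonneg fun _ _ => sq_nonneg _)
  · intro j h
    obtain ⟨_, _, _, hk⟩ := kap_sq_summable (hu.shift h) (ψ j)
    have := (hk 0).1
    simpa using this
  · intro j t k
    have h1 := isM_prod hu (hu.shift k) (ψ j) t
    have h2 := isM_prod hu (hu.shift k) (ψ j) 0
    have h3 := (h1.add (h2.smul (-1))).eq_zero fun η => ?_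
    · simp only [BB, neg_one_mul, ← sub_eq_add_neg, sub_eq_zero, zero_sub] at h3
      exact h3
    · obtain ⟨q, hq, hqe⟩ := hp _ (hψ j) η
      have hq' : ∀ t, q t = q 0 := BS_one (fun _ => le_rfl) hq
      simp only [aa_shift, hqe, hq' t, hq' (t + k), hq' k, map_mul, zero_add, e2pi_add_right, e2pi_zero_right, one_mul, RingHomCompTriple.comp_apply]
      have h4 := e2pi_mul_conj (γ η) t
      simp only [RingHom.id_apply]
      linear_combination (q 0 * (e2pi η k) * (starRingEnd ℂ) (e2pi (γ η) k) * (starRingEnd ℂ) (q 0)) * h4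
  · intro i ι U m hs x
    obtain ⟨hg, h⟩ := lim_step hΨ h0 (N := fun _ => 1) (i := i) (n := 0) hu (by
      have : Function.update (fun _ : Fin d => 1) i (0 + 1) = fun _ => 1 := by simp
      rw [this]; exact hp) hs _ rfl
    simp only [pow_zero, inv_one, one_smul] at hg h
    set g := uLim U (fun n x => u (x + (m n : ℝ) • EuclideanSpace.single i 1)) with hgdef
    have h5 : g + (-1 : ℂ) • u = 0 := aa_unique hΨ h0 (hg.add (hu.smul (-1))) fun ψ hψ η t => by
      obtain ⟨q1, hq1, q2, hq2, hh⟩ := h ψ hψ η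
      have hz : q2 = 0 := BS_zero (j := i) (by simp) hq2
      rw [aa_add hg (hu.smul (-1)), aa_smul, (hh t).1, (hh t).2, hz]
      simp
    have h6 : g = u := by
      rw [neg_one_smul, ← sub_eq_add_neg, sub_eq_zero] at h5
      exact h5
    exact congrFun h6 x

theorem crys_main {Ψ : Set (Sc d)} (hΨ : ∀ i, ∀ ψ ∈ Ψ, xm i ψ ∈ Ψ) (h0 : ∃ ψ ∈ Ψ, ψ 0 ≠ 0)
    {γ : Rd d → Rd d} (M : ℕ) : ∀ (N : Fin d → ℕ) (u : Rd d → SI d K → ℂ), ∑ j, N j = M →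
    Obj u → PM Ψ γ N u → u ∈ Crys d (SI d K) := by
  induction M using Nat.strong_induction_on with
  | _ M ih =>
  intro N u hM hu hp
  by_cases hz : ∃ j, N j = 0
  · obtain ⟨j, hj⟩ := hz
    rw [aa_unique hΨ h0 hu fun ψ hψ η t => by
      obtain ⟨q, hq, he⟩ := hp ψ hψ η
      rw [he, BS_zero hj hq]; simp]
    exact Submodule.zero_mem _
  push Not at hz
  by_cases h1 : ∀ j, N j = 1
  · have : N = fun _ => 1 := funext h1
    subst this
    exact crys_base hΨ h0 hu hp
  push Not at h1
  obtain ⟨i, hi⟩ := h1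
  obtain ⟨n, hn⟩ : ∃ n, N i = n + 1 := ⟨N i - 1, by have := hz i; omega⟩
  have hsum : ∀ a, ∑ j, Function.update N i a j = a + ∑ j ∈ Finset.univ \ {i}, N j := fun a => by
    rw [Finset.sum_update_of_mem (Finset.mem_univ i)]
  have hself := hsum (n + 1)
  have hup : Function.update N i (n + 1) = N := by rw [← hn, Function.update_eq_self]
  rw [hup, hM] at hself
  have hn0 : 0 < n := by omega
  obtain ⟨U, m, hs⟩ := exists_isSys
  obtain ⟨hg, h⟩ := lim_step hΨ h0 hu (by rw [hup]; exact hp) hs _ rfl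
  set g := uLim U (fun k x => ((1 + (m k : ℂ)) ^ n)⁻¹ • u (x + (m k : ℝ) • EuclideanSpace.single i (1:ℝ)))
  have hpg : PM Ψ γ (Function.update N i 1) g := fun ψ hψ η => by
    obtain ⟨q1, hq1, q2, hq2, hh⟩ := h ψ hψ η
    exact ⟨q1, hq1, fun t => (hh t).2⟩
  obtain ⟨hox, hx⟩ := Xop_pow hΨ hg hpg n
  have hcg : g ∈ Crys d (SI d K) := ih _ (by rw [hself]; have := hsum 1; omega) _ g (hsum 1) hg hpg
  have hcx : ∀ s, (Xop i)^[s] g ∈ Crys d (SI d K) := by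
    intro s
    induction s with
    | zero => exact hcg
    | succ s ih => rw [Function.iterate_succ_apply']; exact Xop_crys i ih
  have hor : Obj (u + (-1 : ℂ) • (Xop i)^[n] g) := hu.add (hox.smul _)
  have hcr : u + (-1 : ℂ) • (Xop i)^[n] g ∈ Crys d (SI d K) := by
    refine ih _ (by rw [hself]; have := hsum n; omega) _ _ (hsum n) hor fun ψ hψ η => ?_
    obtain ⟨q1, hq1, q2, hq2, hh⟩ := h ψ hψ η
    obtain ⟨r, hr, hh2⟩ := hx ψ hψ η q1 fun t => (hh t).2
    refine ⟨q2 - r, Submodule.sub_mem _ hq2 hr, fun t => ?_⟩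
    rw [aa_add hu (hox.smul _), aa_smul, (hh t).1, hh2, Pi.sub_apply]
    ring
  have : u = (u + (-1 : ℂ) • (Xop i)^[n] g) + (Xop i)^[n] g := by simp
  rw [this]
  exact Submodule.add_mem _ hcr (hcx n)

end PeelD

section CutOff
open Filter Topology
set_option linter.unusedSectionVars false
variable {d K : ℕ}

theorem clm_bound (F : Sc d →L[ℂ] ℂ) : ∃ (C : ℝ) (k0 n0 : ℕ), 0 ≤ C ∧ ∀ (φ : Sc d) (B : ℝ), 0 ≤ B →
    (∀ k ≤ k0, ∀ j ≤ n0, ∀ z, ‖z‖ ^ k * ‖iteratedFDeriv ℝ j φ z‖ ≤ B) → ‖F φ‖ ≤ C * B := by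
  have hq : Continuous ((normSeminorm ℂ ℂ).comp F.toLinearMap) := by
    have : Continuous fun φ => ‖F φ‖ := by fun_prop
    exact this
  obtain ⟨s, C, -, hs⟩ := Seminorm.bound_of_continuous (schwartz_withSeminorms ℂ (Rd d) ℂ) _ hq
  refine ⟨C, s.sup Prod.fst, s.sup Prod.snd, C.2, fun φ B hB hb => ?_⟩
  have h1 := hs φ
  have h2 : (s.sup (schwartzSeminormFamily ℂ (Rd d) ℂ)) φ ≤ B := by
    refine Seminorm.finset_sup_apply_le hB fun i hi => ?_
    exact SchwartzMap.seminorm_le_bound ℂ i.1 i.2 φ hB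
      (hb _ (Finset.le_sup (f := Prod.fst) hi) _ (Finset.le_sup (f := Prod.snd) hi))
  calc ‖F φ‖ ≤ C * (s.sup (schwartzSeminormFamily ℂ (Rd d) ℂ)) φ := h1
    _ ≤ C * B := by gcongr

/-- base bump -/
def bmp (d : ℕ) : ContDiffBump (0 : Rd d) := ⟨1, 2, by norm_num, by norm_num⟩

/-- scaled cutoff -/
def chi (a : Rd d) (c : ℝ) (z : Rd d) : ℂ := ((bmp d (c • (z - a)) : ℝ) : ℂ)

theorem chi_smooth (a : Rd d) (c : ℝ) {n : ℕ∞} : ContDiff ℝ n (chi a c) := by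
  unfold chi
  exact Complex.ofRealCLM.contDiff.comp ((bmp d).contDiff.comp (by fun_prop))

theorem chi_one {a : Rd d} {c : ℝ} (hc : 0 < c) {z : Rd d} (hz : ‖z - a‖ ≤ 1 / c) : chi a c z = 1 := by
  unfold chi
  rw [(bmp d).one_of_mem_closedBall]; · simp
  rw [mem_closedBall_zero_iff, norm_smul, Real.norm_of_nonneg hc.le]
  rw [le_div_iff₀ hc] at hz
  rw [mul_comm]; exact hz

theorem chi_zero {a : Rd d} {c : ℝ} (hc : 0 < c) {z : Rd d} (hz : 2 / c ≤ ‖z - a‖) : chi a c z = 0 := by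
  unfold chi
  rw [(bmp d).zero_of_le_dist]; · simp
  rw [dist_zero_right, norm_smul, Real.norm_of_nonneg hc.le]
  rw [div_le_iff₀ hc] at hz
  rw [mul_comm]; exact hz

theorem chi_tsupport (a : Rd d) {c : ℝ} (hc : 0 < c) : tsupport (chi a c) ⊆ closedBall a (2 / c) := by
  refine closure_minimal (fun z hz => ?_) isClosed_closedBall
  rw [mem_closedBall, dist_eq_norm]
  by_contra h
  exact hz (chi_zero hc (le_of_lt (not_le.1 h)))

theorem chi_hcs (a : Rd d) {c : ℝ} (hc : 0 < c) : HasCompactSupport (chi a c) :=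
  (isCompact_closedBall a (2 / c)).of_isClosed_subset (isClosed_tsupport _) (chi_tsupport a hc)

theorem chi_htg (a : Rd d) {c : ℝ} (hc : 0 < c) : (chi a c).HasTemperateGrowth :=
  (chi_hcs a hc).hasTemperateGrowth (chi_smooth a c)

theorem chi_bound (d : ℕ) : ∃ M : ℕ → ℝ, (∀ j, 0 ≤ M j) ∧ ∀ (a : Rd d) (c : ℝ), 0 < c → ∀ j z,
    ‖iteratedFDeriv ℝ j (chi a c) z‖ ≤ c ^ j * M j := by
  have h1 : ∀ j, ∃ M, 0 ≤ M ∧ ∀ z : Rd d, ‖iteratedFDeriv ℝ j (chi (0 : Rd d) 1) z‖ ≤ M := by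
    intro j
    obtain ⟨M, hM⟩ := ((chi_hcs (0 : Rd d) one_pos).iteratedFDeriv (𝕜 := ℝ) j).exists_bound_of_continuous
      ((chi_smooth (0 : Rd d) 1 (n := j)).continuous_iteratedFDeriv le_rfl)
    exact ⟨M, (norm_nonneg _).trans (hM 0), hM⟩
  choose M hM0 hM using h1
  refine ⟨M, hM0, fun a c hc j z => ?_⟩
  have e : chi a c = fun z => (fun y => chi (0 : Rd d) 1 (c • y)) (z - a) := by
    funext z; simp [chi]
  have e2 := iteratedFDeriv_comp_sub (𝕜 := ℝ) (f := fun y => chi (0 : Rd d) 1 (c • y)) j a z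
  rw [e, e2, iteratedFDeriv_comp_const_smul]
  · rw [norm_smul, norm_pow, Real.norm_of_nonneg hc.le]
    gcongr
    exact hM _ _
  · exact chi_smooth _ _

/-- cutoff operator -/
def cut (a : Rd d) (c : ℝ) : Sc d →L[ℂ] Sc d := smulLeftCLM ℂ (chi a c)

theorem cut_apply (a : Rd d) {c : ℝ} (hc : 0 < c) (φ : Sc d) (z : Rd d) : cut a c φ z = chi a c z * φ z := by
  rw [cut, smulLeftCLM_apply_apply (chi_htg a hc)]; rfl

theorem cut_coe (a : Rd d) {c : ℝ} (hc : 0 < c) (φ : Sc d) : ⇑(cut a c φ) = fun z => chi a c z * φ z :=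
  funext (cut_apply a hc φ)

theorem cut_hcs (a : Rd d) {c : ℝ} (hc : 0 < c) (φ : Sc d) : HasCompactSupport ⇑(cut a c φ) := by
  rw [cut_coe a hc]; exact (chi_hcs a hc).mul_right

theorem cut_deriv (a : Rd d) {c : ℝ} (hc : 0 < c) (φ : Sc d) (j : ℕ) (z : Rd d) :
    ‖iteratedFDeriv ℝ j (cut a c φ) z‖ ≤ ∑ i ∈ Finset.range (j + 1), (j.choose i : ℝ) *
      ‖iteratedFDeriv ℝ i (chi a c) z‖ * ‖iteratedFDeriv ℝ (j - i) φ z‖ := by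
  rw [cut_coe a hc]
  exact norm_iteratedFDeriv_mul_le (chi_smooth a c (n := j)) (φ.smooth j) z le_rfl

theorem iter_zero_of_ev {g : Rd d → ℂ} {z : Rd d} (h : g =ᶠ[𝓝 z] fun _ => 0) (j : ℕ) :
    iteratedFDeriv ℝ j g z = 0 := by
  rw [(h.iteratedFDeriv ℝ j).eq_of_nhds]
  rw [iteratedFDeriv_fun_zero]
  rfl

theorem dens (g : Sc d →L[ℂ] ℂ) (hg : ∀ φ : Sc d, HasCompactSupport ⇑φ → g φ = 0) (φ : Sc d) : g φ = 0 := by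
  obtain ⟨C, k0, n0, hC, hb⟩ := clm_bound g
  obtain ⟨M, hM0, hM⟩ := chi_bound d
  have hS : ∀ k j, ∃ S, 0 ≤ S ∧ ∀ z, ‖z‖ ^ k * ‖iteratedFDeriv ℝ j φ z‖ ≤ S := by
    intro k j
    obtain ⟨S, hS⟩ := φ.decay k j
    exact ⟨S, hS.1.le, hS.2⟩
  choose S hS0 hS using hS
  set B : ℝ := ∑ k ∈ Finset.range (k0 + 1), ∑ j ∈ Finset.range (n0 + 1),
    (S (k + 1) j + ∑ i ∈ Finset.range (j + 1), (j.choose i : ℝ) * M i * S (k + 1) (j - i)) with hB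
  have hterm : ∀ k j, 0 ≤ S (k + 1) j + ∑ i ∈ Finset.range (j + 1), (j.choose i : ℝ) * M i * S (k + 1) (j - i) := by
    intro k j
    refine add_nonneg (hS0 _ _) (Finset.sum_nonneg fun i _ => ?_)
    have := hM0 i; have := hS0 (k + 1) (j - i); positivity
  have hB0 : 0 ≤ B := Finset.sum_nonneg fun k _ => Finset.sum_nonneg fun j _ => hterm k j
  have key : ∀ R : ℝ, 1 ≤ R → ‖g φ‖ ≤ C * (B / R) := by
    intro R hR
    have hR0 : 0 < R := by linarith
    have hc : 0 < 1 / R := by positivity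
    have e : g φ = g (φ - cut 0 (1 / R) φ) := by
      rw [map_sub, hg _ (cut_hcs 0 hc φ), sub_zero]
    rw [e]
    refine hb _ _ (by positivity) fun k hk j hj z => ?_
    by_cases hz : ‖z‖ < R
    · have : ⇑(φ - cut 0 (1 / R) φ) =ᶠ[𝓝 z] fun _ => 0 := by
        have ho : IsOpen {y : Rd d | ‖y‖ < R} := isOpen_lt continuous_norm continuous_const
        filter_upwards [ho.mem_nhds hz] with y hy
        have hy' : ‖y‖ < R := hy
        rw [sub_apply, cut_apply 0 hc, chi_one hc (by simpa using hy'.le)]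
        ring
      rw [iter_zero_of_ev this, norm_zero, mul_zero]
      positivity
    · push Not at hz
      have h1 : ‖iteratedFDeriv ℝ j (⇑(φ - cut 0 (1 / R) φ)) z‖ ≤ ‖iteratedFDeriv ℝ j φ z‖ +
          ∑ i ∈ Finset.range (j + 1), (j.choose i : ℝ) * M i * ‖iteratedFDeriv ℝ (j - i) φ z‖ := by
        have e2 : ⇑(φ - cut 0 (1 / R) φ) = ⇑φ - ⇑(cut 0 (1 / R) φ) := rfl
        rw [e2, iteratedFDeriv_sub_apply (φ.smooth j).contDiffAt ((cut 0 (1 / R) φ).smooth j).contDiffAt]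
        refine (norm_sub_le _ _).trans (add_le_add le_rfl ?_)
        refine (cut_deriv 0 hc φ j z).trans (Finset.sum_le_sum fun i _ => ?_)
        gcongr
        refine (hM 0 _ hc i z).trans ?_
        have : (1 / R) ^ i ≤ 1 := pow_le_one₀ hc.le (by rw [div_le_one hR0]; exact hR)
        exact mul_le_of_le_one_left (hM0 i) this
      have h2 : ‖z‖ ^ k ≤ ‖z‖ ^ (k + 1) / R := by
        rw [le_div_iff₀ hR0, pow_succ]; gcongr
      calc ‖z‖ ^ k * ‖iteratedFDeriv ℝ j (⇑(φ - cut 0 (1 / R) φ)) z‖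
          ≤ (‖z‖ ^ (k + 1) / R) * (‖iteratedFDeriv ℝ j φ z‖ +
          ∑ i ∈ Finset.range (j + 1), (j.choose i : ℝ) * M i * ‖iteratedFDeriv ℝ (j - i) φ z‖) := by gcongr
        _ = (‖z‖ ^ (k + 1) * ‖iteratedFDeriv ℝ j φ z‖ +
          ∑ i ∈ Finset.range (j + 1), (j.choose i : ℝ) * M i *
            (‖z‖ ^ (k + 1) * ‖iteratedFDeriv ℝ (j - i) φ z‖)) / R := by
            rw [div_mul_eq_mul_div, mul_add, Finset.mul_sum]
            congr 2
            refine Finset.sum_congr rfl fun i _ => ?_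
            ring
        _ ≤ (S (k + 1) j + ∑ i ∈ Finset.range (j + 1), (j.choose i : ℝ) * M i * S (k + 1) (j - i)) / R := by
            gcongr with i hi
            · exact hS _ _ _
            · exact mul_nonneg (by positivity) (hM0 i)
            · exact hS _ _ _
        _ ≤ B / R := by
            gcongr
            rw [hB]
            refine le_trans ?_ (Finset.single_le_sum (f := fun k => ∑ j ∈ Finset.range (n0 + 1),
              (S (k + 1) j + ∑ i ∈ Finset.range (j + 1), (j.choose i : ℝ) * M i * S (k + 1) (j - i)))
              (fun k _ => Finset.sum_nonneg fun j _ => hterm k j) (Finset.mem_range.2 (Nat.lt_succ_of_le hk)))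
            exact Finset.single_le_sum (f := fun j =>
              (S (k + 1) j + ∑ i ∈ Finset.range (j + 1), (j.choose i : ℝ) * M i * S (k + 1) (j - i)))
              (fun j _ => hterm k j) (Finset.mem_range.2 (Nat.lt_succ_of_le hj))
  have hlim : Tendsto (fun R : ℝ => C * (B / R)) atTop (𝓝 (C * 0)) :=
    (tendsto_const_nhds.div_atTop tendsto_id).const_mul _
  have := ge_of_tendsto hlim (by filter_upwards [eventually_ge_atTop 1] with R hR using key R hR)
  rw [mul_zero] at this
  exact norm_le_zero_iff.1 this

theorem T_clm {a : Rd d → ℂ} (ha : Obj a) : ∃ T : Sc d →L[ℂ] ℂ,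
    (∀ φ : Sc d, Summable fun x => a x * φ x) ∧ ∀ φ : Sc d, T φ = ∑' x, a x * φ x := by
  obtain ⟨⟨D, hD⟩, C, H, hC⟩ := ha
  have hC0 : 0 ≤ C := by
    have := (norm_nonneg _).trans (hC 0); simpa using this
  set N := H + (d + 1)
  set P : Sc d → ℝ := fun φ => 2 ^ N * ((Finset.Iic (N, 0)).sup fun m => SchwartzMap.seminorm ℂ m.1 m.2) φ with hP
  have hb : ∀ φ : Sc d, Summable (fun x => ‖a x * φ x‖) ∧ ∑' x, ‖a x * φ x‖ ≤ C * P φ * D := by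
    intro φ
    have hp : 0 ≤ P φ := by
      rw [hP]; exact mul_nonneg (by positivity) (apply_nonneg _ _)
    refine hD.summable _ (fun x hx => ?_) (C * P φ) (by positivity) 0 fun x => ?_
    · exact fun h => hx (by simp [h])
    · have h1 := one_add_le_sup_seminorm_apply (𝕜 := ℂ) (m := (N, 0)) (k := N) (n := 0) le_rfl le_rfl φ x
      rw [norm_iteratedFDeriv_zero] at h1
      unfold W0
      rw [zero_sub, norm_neg, norm_mul]
      rw [← div_eq_mul_inv, le_div_iff₀ (by positivity)]
      calc ‖a x‖ * ‖φ x‖ * (1 + ‖x‖) ^ (d + 1) ≤ (C * (1 + ‖x‖) ^ H) * ‖φ x‖ * (1 + ‖x‖) ^ (d + 1) := by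
            gcongr; exact hC x
        _ = C * ((1 + ‖x‖) ^ N * ‖φ x‖) := by rw [pow_add]; ring
        _ ≤ C * P φ := by gcongr
  refine ⟨mkCLMtoNormedSpace (fun φ => ∑' x, a x * φ x) (fun φ ψ => ?_) (fun c φ => ?_)
    ⟨Finset.Iic (N, 0), C * 2 ^ N * D, ?_, fun φ => ?_⟩, fun φ => (hb φ).1.of_norm, fun φ => rfl⟩
  · rw [← Summable.tsum_add (hb φ).1.of_norm (hb ψ).1.of_norm]
    exact tsum_congr fun x => by rw [add_apply]; ring
  · rw [smul_eq_mul, ← tsum_mul_left]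
    exact tsum_congr fun x => by rw [smul_apply, smul_eq_mul, RingHom.id_apply]; ring
  · have := hD.nonneg; positivity
  · refine (norm_tsum_le_tsum_norm (hb φ).1).trans ((hb φ).2.trans (le_of_eq ?_))
    have e : P φ = 2 ^ N * ((Finset.Iic (N, 0)).sup (schwartzSeminormFamily ℂ (Rd d) ℂ)) φ := rfl
    rw [e]
    ring

theorem pr_clm {u : Rd d → SI d K → ℂ} (hu : Obj u) : ∃ T : Sc d →L[ℂ] ℂ, ∀ φ, T φ = pr u φ := by
  have h1 : ∀ k : SI d K, Obj (fun x => u x k) := by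
    intro k
    obtain ⟨⟨D, hD⟩, C, H, hC⟩ := hu
    refine ⟨⟨D, hD.mono fun x hx => ?_⟩, C, H, fun x => (norm_le_pi_norm (u x) k).trans (hC x)⟩
    intro h0
    exact hx (by dsimp only; rw [h0]; rfl)
  choose T hTs hT using fun k => T_clm (h1 k)
  refine ⟨∑ k : SI d K, ((-1 : ℂ) ^ (∑ i, k.1 i)) • (T k).comp (Dk k.1), fun φ => ?_⟩
  rw [pr]
  simp only [prx, dkDelta_eq]
  rw [Summable.tsum_finsetSum]
  · rw [sum_apply]
    refine Finset.sum_congr rfl fun k _ => ?_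
    rw [smul_apply, ContinuousLinearMap.comp_apply, hT, smul_eq_mul, ← tsum_mul_left]
    exact tsum_congr fun x => by ring
  · intro k _
    refine ((hTs k (Dk k.1 φ)).mul_left ((-1 : ℂ) ^ (∑ i, k.1 i))).congr fun x => by ring

theorem f_eq_pr (f : TemperedDist d) {u : Rd d → SI d K → ℂ} (hu : Obj u)
    (h : ∀ φ : Sc d, HasCompactSupport ⇑φ → f φ = pr u φ) (φ : Sc d) : f φ = pr u φ := by
  obtain ⟨T, hT⟩ := pr_clm hu
  have := dens (f - T) (fun φ hφ => by rw [sub_apply, hT, h φ hφ, sub_self]) φ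
  rw [sub_apply, hT] at this
  exact sub_eq_zero.1 this

end CutOff

section Vanish
open Filter Topology
set_option linter.unusedSectionVars false
variable {d K : ℕ}

theorem loc_vanish (F : TemperedDist d) (φ : Sc d) (hφ : HasCompactSupport ⇑φ)
    (hd : ∀ x ∈ tsupport ⇑φ, x ∉ tdSupport F) : F φ = 0 := by
  have h1 : ∀ x : Rd d, ∃ U : Set (Rd d), IsOpen U ∧ x ∈ U ∧ (x ∈ tsupport ⇑φ →
      ∀ ψ : Sc d, HasCompactSupport ⇑ψ → tsupport ⇑ψ ⊆ U → F ψ = 0) := by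
    intro x
    by_cases hx : x ∈ tsupport ⇑φ
    · have := hd x hx
      simp only [tdSupport, mem_ofPred_eq] at this
      push Not at this
      obtain ⟨U, hU, hxU, h⟩ := this
      exact ⟨U, hU, hxU, fun _ ψ h1 h2 => h ψ h1 h2⟩
    · exact ⟨univ, isOpen_univ, trivial, fun h => absurd h hx⟩
  choose U hUo hxU hU using h1
  obtain ⟨t, ht, htc⟩ := hφ.isCompact.elim_nhds_subcover U fun x _ => (hUo x).mem_nhds (hxU x)
  obtain ⟨ρ, hρ⟩ := SmoothPartitionOfUnity.exists_isSubordinate (modelWithCornersSelf ℝ (Rd d))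
    (isClosed_tsupport ⇑φ) (fun i : t => U i.1) (fun i => hUo i.1) (by
      intro x hx
      obtain ⟨i, hi, hxi⟩ := mem_iUnion₂.1 (htc hx)
      exact mem_iUnion.2 ⟨⟨i, hi⟩, hxi⟩)
  have hsm : ∀ i : t, ContDiff ℝ ((⊤ : ℕ∞) : WithTop ℕ∞) (fun x => ((ρ i x : ℝ) : ℂ) * φ x) := by
    intro i
    refine ContDiff.mul ?_ (φ.smooth ⊤)
    exact Complex.ofRealCLM.contDiff.comp (ρ i).contMDiff.contDiff
  have hcs : ∀ i : t, HasCompactSupport (fun x => ((ρ i x : ℝ) : ℂ) * φ x) := fun i => hφ.mul_left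
  have hsum : φ = ∑ i : t, (hcs i).toSchwartzMap (hsm i) := by
    ext x
    rw [sum_apply]
    change φ x = ∑ i : t, ((ρ i x : ℝ) : ℂ) * φ x
    rw [← Finset.sum_mul]
    by_cases hx : x ∈ tsupport ⇑φ
    · have h2 := ρ.sum_eq_one hx
      rw [finsum_eq_sum_of_fintype] at h2
      rw [← Complex.ofReal_sum, h2]; simp
    · rw [image_eq_zero_of_notMem_tsupport hx, mul_zero]
  rw [hsum, map_sum]
  refine Finset.sum_eq_zero fun i _ => ?_
  refine hU i.1 (ht i.1 i.2) _ (hcs i) ?_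
  refine Subset.trans (closure_mono ?_) (hρ i)
  intro x hx
  rw [Function.mem_support] at hx ⊢
  intro h0
  apply hx
  change ((ρ i x : ℝ) : ℂ) * φ x = 0
  rw [h0]; simp

theorem taylor_bound (H : Sc d) (a : Rd d) (n : ℕ) (h : ∀ j ≤ n, iteratedFDeriv ℝ j H a = 0) :
    ∃ M, 0 ≤ M ∧ ∀ i ≤ n + 1, ∀ z, ‖iteratedFDeriv ℝ (n + 1 - i) H z‖ ≤ M * ‖z - a‖ ^ i := by
  obtain ⟨M, hM⟩ := H.decay 0 (n + 1)
  refine ⟨M, hM.1.le, fun i => ?_⟩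
  induction i with
  | zero => intro _ z; simpa using hM.2 z
  | succ i ih =>
    intro hi z
    have e : n + 1 - i = (n + 1 - (i + 1)) + 1 := by omega
    set m := n + 1 - (i + 1) with hm
    have hdiff : Differentiable ℝ (iteratedFDeriv ℝ m H) :=
      (H.smooth (m + 1 : ℕ)).differentiable_iteratedFDeriv (by exact_mod_cast Nat.lt_succ_self m)
    have h1 := Convex.norm_image_sub_le_of_norm_fderiv_le (𝕜 := ℝ) (f := iteratedFDeriv ℝ m H)
      (s := closedBall a ‖z - a‖) (C := M * ‖z - a‖ ^ i) (x := a) (y := z) (fun x _ => hdiff x) (fun x hx => by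
        rw [norm_fderiv_iteratedFDeriv, ← e]
        refine (ih (by omega) x).trans ?_
        have : ‖x - a‖ ≤ ‖z - a‖ := by rwa [mem_closedBall, dist_eq_norm] at hx
        have := hM.1.le
        gcongr) (convex_closedBall _ _) (by simp) (by simp [dist_eq_norm])
    rw [h m (by omega), sub_zero] at h1
    rw [pow_succ, ← mul_assoc]
    exact h1

theorem vanish (F : TemperedDist d) {C : ℝ} {k0 n0 : ℕ} (_hC : 0 ≤ C)
    (hb : ∀ (φ : Sc d) (B : ℝ), 0 ≤ B →
      (∀ k ≤ k0, ∀ j ≤ n0, ∀ z, ‖z‖ ^ k * ‖iteratedFDeriv ℝ j φ z‖ ≤ B) → ‖F φ‖ ≤ C * B)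
    (H : Sc d) (hH : HasCompactSupport ⇑H) (a : Rd d)
    (hs : ∀ x ∈ tsupport ⇑H, x ∈ tdSupport F → x = a)
    (h0 : ∀ j ≤ n0, iteratedFDeriv ℝ j H a = 0) : F H = 0 := by
  obtain ⟨M, hM0, hM⟩ := taylor_bound H a n0 h0
  obtain ⟨N, hN0, hN⟩ := chi_bound d
  set B : ℝ := (3 + ‖a‖) ^ k0 * ∑ j ∈ Finset.range (n0 + 1), ∑ i ∈ Finset.range (j + 1),
    (j.choose i : ℝ) * N i * (M * 2 ^ (n0 + 1)) with hB
  have hterm : ∀ j, 0 ≤ ∑ i ∈ Finset.range (j + 1), (j.choose i : ℝ) * N i * (M * 2 ^ (n0 + 1)) := by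
    intro j
    refine Finset.sum_nonneg fun i _ => ?_
    have := hN0 i; positivity
  have hB0 : 0 ≤ B := mul_nonneg (by positivity) (Finset.sum_nonneg fun j _ => hterm j)
  have key : ∀ ε : ℝ, 0 < ε → ε ≤ 1 → ‖F H‖ ≤ C * (B * ε) := by
    intro ε hε hε1
    have hc : 0 < 1 / ε := by positivity
    have e : F H = F (cut a (1 / ε) H) := by
      rw [← sub_eq_zero, ← map_sub]
      have hsub : tsupport ⇑(H - cut a (1 / ε) H) ⊆ tsupport ⇑H := by
        refine closure_mono fun x hx => ?_
        rw [Function.mem_support] at hx ⊢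
        intro h; apply hx
        rw [sub_apply, cut_apply a hc, h]; ring
      refine loc_vanish F _ (hH.isCompact.of_isClosed_subset (isClosed_tsupport _) hsub) fun x hx hxF => ?_
      have hxa := hs x (hsub hx) hxF
      subst hxa
      refine absurd hx (notMem_tsupport_iff_eventuallyEq.2 ?_)
      filter_upwards [ball_mem_nhds x hε] with y hy
      rw [sub_apply, cut_apply x hc, chi_one hc]
      · simp
      · rw [one_div_one_div, ← dist_eq_norm]; exact (mem_ball.1 hy).le
    rw [e]
    refine hb _ _ (by positivity) fun k hk j hj z => ?_
    by_cases hz : 2 * ε < ‖z - a‖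
    · have : ⇑(cut a (1 / ε) H) =ᶠ[𝓝 z] fun _ => 0 := by
        have ho : IsOpen {y : Rd d | 2 * ε < ‖y - a‖} := isOpen_lt continuous_const (by fun_prop)
        filter_upwards [ho.mem_nhds hz] with y hy
        have hy' : 2 * ε < ‖y - a‖ := hy
        rw [cut_apply a hc, chi_zero hc (by rw [div_div_eq_mul_div, div_one]; exact hy'.le)]
        ring
      rw [iter_zero_of_ev this, norm_zero, mul_zero]
      positivity
    · push Not at hz
      have h1 : ‖z‖ ^ k ≤ (3 + ‖a‖) ^ k0 := by
        have : ‖z‖ ≤ 3 + ‖a‖ := by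
          have := norm_le_norm_add_norm_sub' z a
          linarith
        calc ‖z‖ ^ k ≤ (3 + ‖a‖) ^ k := by gcongr
          _ ≤ (3 + ‖a‖) ^ k0 := pow_le_pow_right₀ (by linarith [norm_nonneg a]) hk
      have h2 : ‖iteratedFDeriv ℝ j (cut a (1 / ε) H) z‖ ≤ (∑ i ∈ Finset.range (j + 1),
          (j.choose i : ℝ) * N i * (M * 2 ^ (n0 + 1))) * ε := by
        refine (cut_deriv a hc H j z).trans ?_
        rw [Finset.sum_mul]
        refine Finset.sum_le_sum fun i hi => ?_
        have hi' : i ≤ j := Nat.lt_succ_iff.1 (Finset.mem_range.1 hi)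
        have h3 := hM (n0 + 1 - (j - i)) (by omega) z
        rw [show n0 + 1 - (n0 + 1 - (j - i)) = j - i by omega] at h3
        have h4 : ‖z - a‖ ^ (n0 + 1 - (j - i)) ≤ 2 ^ (n0 + 1) * (ε * ε ^ i) := by
          calc ‖z - a‖ ^ (n0 + 1 - (j - i)) ≤ (2 * ε) ^ (n0 + 1 - (j - i)) := by gcongr
            _ = 2 ^ (n0 + 1 - (j - i)) * ε ^ (n0 + 1 - (j - i)) := mul_pow _ _ _
            _ ≤ 2 ^ (n0 + 1) * (ε * ε ^ i) := by
              rw [← pow_succ']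
              have p1 : (2:ℝ) ^ (n0 + 1 - (j - i)) ≤ 2 ^ (n0 + 1) :=
                pow_le_pow_right₀ (by norm_num) (by omega)
              have p2 : ε ^ (n0 + 1 - (j - i)) ≤ ε ^ (i + 1) := pow_le_pow_of_le_one hε.le hε1 (by omega)
              gcongr
        have h5 := hN a (1 / ε) hc i z
        calc (j.choose i : ℝ) * ‖iteratedFDeriv ℝ i (chi a (1 / ε)) z‖ * ‖iteratedFDeriv ℝ (j - i) H z‖
            ≤ (j.choose i : ℝ) * ((1 / ε) ^ i * N i) * (M * (2 ^ (n0 + 1) * (ε * ε ^ i))) := by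
              have := hN0 i
              have h6 := h3.trans (mul_le_mul_of_nonneg_left h4 hM0)
              gcongr
          _ = (j.choose i : ℝ) * N i * (M * 2 ^ (n0 + 1)) * ε * ((1 / ε) ^ i * ε ^ i) := by ring
          _ = (j.choose i : ℝ) * N i * (M * 2 ^ (n0 + 1)) * ε := by
              rw [← mul_pow, one_div_mul_cancel hε.ne', one_pow, mul_one]
      have h7 : (∑ i ∈ Finset.range (j + 1), (j.choose i : ℝ) * N i * (M * 2 ^ (n0 + 1))) ≤
          ∑ j ∈ Finset.range (n0 + 1), ∑ i ∈ Finset.range (j + 1),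
            (j.choose i : ℝ) * N i * (M * 2 ^ (n0 + 1)) :=
        Finset.single_le_sum (f := fun j => ∑ i ∈ Finset.range (j + 1),
            (j.choose i : ℝ) * N i * (M * 2 ^ (n0 + 1))) (fun j _ => hterm j)
          (Finset.mem_range.2 (Nat.lt_succ_of_le hj))
      calc ‖z‖ ^ k * ‖iteratedFDeriv ℝ j (cut a (1 / ε) H) z‖
          ≤ (3 + ‖a‖) ^ k0 * ((∑ j ∈ Finset.range (n0 + 1), ∑ i ∈ Finset.range (j + 1),
            (j.choose i : ℝ) * N i * (M * 2 ^ (n0 + 1))) * ε) := by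
            have h8 := h2.trans (mul_le_mul_of_nonneg_right h7 hε.le)
            gcongr
        _ = B * ε := by rw [hB]; ring
  have hlim : Tendsto (fun ε : ℝ => C * (B * ε)) (𝓝[>] 0) (𝓝 (C * (B * 0))) := by
    refine Tendsto.mono_left ?_ nhdsWithin_le_nhds
    exact (tendsto_id.const_mul B).const_mul C
  have := ge_of_tendsto hlim (by
    filter_upwards [Ioc_mem_nhdsGT (show (0:ℝ) < 1 by norm_num)] with ε hε using key ε hε.1 hε.2)
  rw [mul_zero, mul_zero] at this
  exact norm_le_zero_iff.1 this

end Vanish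

section FourierPart
open Filter Topology
open scoped FourierTransform
set_option linter.unusedSectionVars false
variable {d K : ℕ}

/-- exponential remainder -/
def rho (n : ℕ) (s : ℝ) : ℂ := Complex.exp (((2 * Real.pi : ℝ) : ℂ) * Complex.I * (s : ℂ)) -
  ∑ q ∈ Finset.range n, (((2 * Real.pi : ℝ) : ℂ) * Complex.I) ^ q / (q.factorial : ℂ) * (s : ℂ) ^ q

theorem rho_deriv (n : ℕ) (s : ℝ) :
    HasDerivAt (rho (n + 1)) ((((2 * Real.pi : ℝ) : ℂ) * Complex.I) * rho n s) s := by
  set c := (((2 * Real.pi : ℝ) : ℂ) * Complex.I)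
  have h1 : HasDerivAt (fun s : ℝ => (s : ℂ)) 1 s := Complex.ofRealCLM.hasDerivAt (x := s)
  have h2 : HasDerivAt (fun s : ℝ => Complex.exp (c * (s : ℂ))) (Complex.exp (c * (s : ℂ)) * (c * 1)) s :=
    (h1.const_mul c).cexp
  have h3 : ∀ n, HasDerivAt (fun s : ℝ => ∑ q ∈ Finset.range (n + 1), c ^ q / (q.factorial : ℂ) * (s : ℂ) ^ q)
      (c * ∑ q ∈ Finset.range n, c ^ q / (q.factorial : ℂ) * (s : ℂ) ^ q) s := by
    intro n
    induction n with
    | zero => simpa using hasDerivAt_const s (1 : ℂ)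
    | succ n ih =>
      have h4 : HasDerivAt (fun s : ℝ => c ^ (n + 1) / ((n + 1).factorial : ℂ) * (s : ℂ) ^ (n + 1))
          (c ^ (n + 1) / ((n + 1).factorial : ℂ) * (((n + 1 : ℕ) : ℂ) * (s : ℂ) ^ n * 1)) s :=
        (h1.pow (n + 1)).const_mul _
      have h5 := ih.add h4
      have e : (fun s : ℝ => ∑ q ∈ Finset.range (n + 1 + 1), c ^ q / (q.factorial : ℂ) * (s : ℂ) ^ q) =
        (fun s : ℝ => ∑ q ∈ Finset.range (n + 1), c ^ q / (q.factorial : ℂ) * (s : ℂ) ^ q) +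
        (fun s : ℝ => c ^ (n + 1) / ((n + 1).factorial : ℂ) * (s : ℂ) ^ (n + 1)) := by
        funext s; rw [Finset.sum_range_succ]; rfl
      rw [e]
      refine h5.congr_deriv ?_
      rw [Finset.sum_range_succ, mul_add]
      refine congrArg₂ (· + ·) rfl ?_
      rw [Nat.factorial_succ]
      have : (n.factorial : ℂ) ≠ 0 := by exact_mod_cast n.factorial_ne_zero
      have : ((n + 1 : ℕ) : ℂ) ≠ 0 := by exact_mod_cast n.succ_ne_zero
      push_cast at *
      field_simp
      ring
  have h6 := h2.sub (h3 n)
  refine HasDerivAt.congr_deriv (f := rho (n + 1)) h6 ?_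
  unfold rho
  ring

theorem rho_smooth (n : ℕ) {m : ℕ∞} : ContDiff ℝ m (rho n) := by
  unfold rho
  have h : ContDiff ℝ m (fun s : ℝ => (s : ℂ)) := Complex.ofRealCLM.contDiff
  refine ContDiff.sub (contDiff_const.mul h).cexp (ContDiff.sum fun q _ => contDiff_const.mul (h.pow q))

theorem rho_iter (j n : ℕ) (s : ℝ) :
    iteratedDeriv j (rho (n + j)) s = (((2 * Real.pi : ℝ) : ℂ) * Complex.I) ^ j * rho n s := by
  have : ∀ j n, iteratedDeriv j (rho (n + j)) = fun s => (((2 * Real.pi : ℝ) : ℂ) * Complex.I) ^ j * rho n s := by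
    intro j
    induction j with
    | zero => intro n; simp
    | succ j ih =>
      intro n
      rw [iteratedDeriv_succ, show n + (j + 1) = (n + 1) + j by ring, ih]
      funext s
      rw [((rho_deriv n s).const_mul _).deriv]
      ring
  rw [this]

theorem rho_zero (n : ℕ) : rho (n + 1) 0 = 0 := by
  unfold rho
  rw [Finset.sum_range_succ']
  simp

theorem rho_comp_zero (a t : Rd d) {j n : ℕ} (h : j < n) :
    iteratedFDeriv ℝ j (fun z : Rd d => rho n ⟪t, z - a⟫) a = 0 := by
  have e2 := iteratedFDeriv_comp_sub (𝕜 := ℝ) (f := fun y : Rd d => rho n ⟪t, y⟫) j a a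
  rw [e2]
  have e3 : (fun y : Rd d => rho n ⟪t, y⟫) = rho n ∘ (innerSL ℝ t) := rfl
  rw [e3, ContinuousLinearMap.iteratedFDeriv_comp_right (innerSL ℝ t) (rho_smooth n (m := j)) _ le_rfl]
  have h0 : iteratedFDeriv ℝ j (rho n) ((innerSL ℝ t) (a - a)) = 0 := by
    rw [sub_self, map_zero, ← norm_eq_zero, norm_iteratedFDeriv_eq_norm_iteratedDeriv]
    obtain ⟨m, rfl⟩ : ∃ m, n = (m + 1) + j := ⟨n - j - 1, by omega⟩
    rw [rho_iter, rho_zero]; simp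
  rw [h0]
  rfl

theorem BS_mul' {n : ℕ} (i : Fin d) {q : Rd d → ℂ} (hq : q ∈ BS (fun _ : Fin d => n)) :
    (fun t : Rd d => ((t i : ℝ) : ℂ) * q t) ∈ BS (fun _ : Fin d => n + 1) := by
  have h1 : q ∈ BS (Function.update (fun _ : Fin d => n) i n) := by
    rwa [Function.update_eq_self_iff.2 rfl]
  refine BS_mono ?_ (BS_mul h1)
  intro j
  by_cases hj : j = i
  · subst hj; simp
  · simp [Function.update_of_ne hj]

/-- directional multiplication -/
def Bop (a t : Rd d) : Sc d →L[ℂ] Sc d := ∑ i, (t i : ℂ) • (xm i - (a i : ℂ) • ContinuousLinearMap.id ℂ (Sc d))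

theorem Bop_apply (a t : Rd d) (φ : Sc d) (z : Rd d) : Bop a t φ z = ((⟪t, z - a⟫ : ℝ) : ℂ) * φ z := by
  rw [Bop, sum_apply, sum_apply, PiLp.inner_apply]
  push_cast
  rw [Finset.sum_mul]
  refine Finset.sum_congr rfl fun i _ => ?_
  change (t i : ℂ) * (xm i φ z - (a i : ℂ) * φ z) = _
  rw [xm_apply]
  simp
  ring

theorem Bop_pow_apply (a t : Rd d) (φ : Sc d) (q : ℕ) (z : Rd d) :
    (Bop a t ^ q) φ z = ((⟪t, z - a⟫ : ℝ) : ℂ) ^ q * φ z := by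
  induction q generalizing φ with
  | zero => simp
  | succ q ih =>
    rw [pow_succ, mul_apply_eq_comp, ih, Bop_apply]; ring

theorem Bop_BS (F : TemperedDist d) (a : Rd d) (q : ℕ) : ∀ G : Sc d,
    (fun t => F ((Bop a t ^ q) G)) ∈ BS (fun _ : Fin d => q + 1) := by
  induction q with
  | zero =>
    intro G
    have : (fun t : Rd d => F ((Bop a t ^ 0) G)) = F G • monom (0 : Fin d → ℕ) := by
      funext t; simp [monom]
    rw [this]
    exact Submodule.smul_mem _ _ (Submodule.subset_span ⟨0, fun j => by simp, rfl⟩)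
  | succ q ih =>
    intro G
    have : (fun t : Rd d => F ((Bop a t ^ (q + 1)) G)) =
        ∑ i, fun t : Rd d => ((t i : ℝ) : ℂ) * F ((Bop a t ^ q)
          ((xm i - (a i : ℂ) • ContinuousLinearMap.id ℂ (Sc d)) G)) := by
      funext t
      rw [pow_succ, mul_apply_eq_comp]
      conv_lhs => rw [show Bop a t G = ∑ i, (t i : ℂ) •
        (xm i - (a i : ℂ) • ContinuousLinearMap.id ℂ (Sc d)) G by rw [Bop, sum_apply]; rfl]
      rw [map_sum, map_sum, Finset.sum_apply]
      refine Finset.sum_congr rfl fun i _ => ?_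
      rw [map_smul, map_smul, smul_eq_mul]
    rw [this]
    exact Submodule.sum_mem _ fun i _ => BS_mul' i (ih _)

theorem emd_poly (F : TemperedDist d) {C : ℝ} {k0 n0 : ℕ} (hC : 0 ≤ C)
    (hb : ∀ (φ : Sc d) (B : ℝ), 0 ≤ B →
      (∀ k ≤ k0, ∀ j ≤ n0, ∀ z, ‖z‖ ^ k * ‖iteratedFDeriv ℝ j φ z‖ ≤ B) → ‖F φ‖ ≤ C * B)
    (G : Sc d) (hG : HasCompactSupport ⇑G) (a : Rd d)
    (hs : ∀ x ∈ tsupport ⇑G, x ∈ tdSupport F → x = a) :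
    ∃ q ∈ BS (fun _ : Fin d => n0 + 1), ∀ t, F (emd t G) = e2pi a t * q t := by
  refine ⟨∑ q ∈ Finset.range (n0 + 1), ((((2 * Real.pi : ℝ) : ℂ) * Complex.I) ^ q / (q.factorial : ℂ)) •
    fun t => F ((Bop a t ^ q) G), Submodule.sum_mem _ fun q hq => Submodule.smul_mem _ _
      (BS_mono (fun _ => ?_) (Bop_BS F a q G)), fun t => ?_⟩
  · have := Finset.mem_range.1 hq
    exact this
  set S : Sc d := ∑ q ∈ Finset.range (n0 + 1), ((((2 * Real.pi : ℝ) : ℂ) * Complex.I) ^ q / (q.factorial : ℂ)) •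
    (Bop a t ^ q) G with hS
  set H : Sc d := e2pi (-a) t • emd t G - S with hH
  have hHz : ⇑H = fun z => rho (n0 + 1) ⟪t, z - a⟫ * G z := by
    funext z
    rw [hH, hS, sub_apply, smul_apply, emd_apply, sum_apply, rho, sub_mul, Finset.sum_mul]
    congr 1
    · rw [smul_eq_mul, ← mul_assoc]
      congr 1
      rw [e2pi_comm (-a), ← e2pi_add_right, e2pi, neg_add_eq_sub]
    · refine Finset.sum_congr rfl fun q _ => ?_
      rw [smul_apply, Bop_pow_apply, smul_eq_mul]
      ring
  have hsub : tsupport ⇑H ⊆ tsupport ⇑G := by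
    refine closure_mono fun x hx => ?_
    rw [Function.mem_support] at hx ⊢
    intro h; apply hx
    rw [hHz]; dsimp only; rw [h, mul_zero]
  have h0 : F H = 0 := by
    refine vanish F hC hb H (hG.isCompact.of_isClosed_subset (isClosed_tsupport _) hsub) a
      (fun x hx => hs x (hsub hx)) fun j hj => ?_
    rw [hHz, ← norm_le_zero_iff]
    have hsm : ContDiff ℝ j (fun z : Rd d => rho (n0 + 1) ⟪t, z - a⟫) :=
      (rho_smooth (n0 + 1) (m := j)).comp
        ((innerSL ℝ t).contDiff.comp (contDiff_id.sub contDiff_const))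
    refine (norm_iteratedFDeriv_mul_le hsm (G.smooth j) a le_rfl).trans
      (le_of_eq (Finset.sum_eq_zero fun i hi => ?_))
    have := Finset.mem_range.1 hi
    rw [rho_comp_zero a t (by omega)]
    simp
  rw [hH, map_sub, map_smul, smul_eq_mul, sub_eq_zero] at h0
  have h1 : F (emd t G) = e2pi a t * (e2pi (-a) t * F (emd t G)) := by
    rw [← mul_assoc, e2pi_neg_left, e2pi_mul_conj, one_mul]
  rw [h1, h0, hS, map_sum, Finset.sum_apply]
  congr 1
  refine Finset.sum_congr rfl fun q _ => ?_
  rw [map_smul, Pi.smul_apply]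

/-- test functions with small spectrum -/
def Psi (d : ℕ) (r : ℝ) : Set (Sc d) := {ψ | ∀ z, (𝓕 ψ : Sc d) z ≠ 0 → ‖z‖ ≤ r}

theorem Psi_xm {r : ℝ} (i : Fin d) (ψ : Sc d) (hψ : ψ ∈ Psi d r) : xm i ψ ∈ Psi d r := by
  intro z hz
  by_contra hzr
  push Not at hzr
  apply hz
  have h1 := lineDerivOp_fourier_eq ψ (EuclideanSpace.single i (1:ℝ) : Rd d)
  have h2 : smulLeftCLM ℂ (fun y : Rd d => inner ℝ y (EuclideanSpace.single i (1:ℝ))) ψ = xm i ψ := by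
    ext x
    have : (fun y : Rd d => inner ℝ y (EuclideanSpace.single i (1:ℝ))).HasTemperateGrowth := by fun_prop
    rw [smulLeftCLM_apply_apply this, xm_apply, EuclideanSpace.inner_single_right]
    simp
  rw [h2, FourierTransform.fourier_smul] at h1
  have h3 : pd i (𝓕 ψ : Sc d) z = 0 := by
    rw [pd_apply]
    have : (⇑(𝓕 ψ : Sc d)) =ᶠ[𝓝 z] fun _ => 0 := by
      have ho : IsOpen {y : Rd d | r < ‖y‖} := isOpen_lt continuous_const (by fun_prop)
      filter_upwards [ho.mem_nhds hzr] with y hy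
      by_contra h
      exact absurd (hψ y h) (not_le.2 hy)
    rw [this.fderiv_eq]
    simp
  have h4 : pd i (𝓕 ψ : Sc d) z = (-(2 * Real.pi * Complex.I)) * (𝓕 (xm i ψ) : Sc d) z := by
    have := DFunLike.congr_fun h1 z
    rw [smul_apply] at this
    exact this
  rw [h3] at h4
  have h5 : (-(2 * Real.pi * Complex.I) : ℂ) ≠ 0 := neg_ne_zero.2 Complex.two_pi_I_ne_zero
  exact (mul_eq_zero.1 h4.symm).resolve_left h5

theorem Psi_ne (d : ℕ) {r : ℝ} (hr : 0 < r) : ∃ ψ ∈ Psi d r, ψ 0 ≠ 0 := by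
  set b : ContDiffBump (0 : Rd d) := ⟨r / 2, r, by positivity, by linarith⟩ with hb
  have h1 : ContDiff ℝ ((⊤ : ℕ∞) : WithTop ℕ∞) (fun x => ((b x : ℝ) : ℂ)) :=
    Complex.ofRealCLM.contDiff.comp b.contDiff
  have h2 : HasCompactSupport (fun x => ((b x : ℝ) : ℂ)) :=
    b.hasCompactSupport.comp_left (g := fun s : ℝ => (s : ℂ)) (by simp)
  refine ⟨𝓕⁻ (h2.toSchwartzMap h1), fun z hz => ?_, ?_⟩
  · rw [FourierTransform.fourier_fourierInv_eq] at hz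
    by_contra h
    apply hz
    change ((b z : ℝ) : ℂ) = 0
    rw [b.zero_of_le_dist]
    · simp
    · rw [dist_zero_right]; exact (not_le.1 h).le
  · rw [fourierInv_coe, Real.fourierInv_eq]
    simp only [inner_zero_right, AddChar.map_zero_eq_one, one_smul]
    change ∫ z, ((b z : ℝ) : ℂ) ≠ 0
    rw [integral_complex_ofReal]
    exact_mod_cast (b.integral_pos (μ := volume)).ne'

theorem Ph_fourier (η t : Rd d) (ψ : Sc d) :
    Ph η t ψ = 𝓕 (e2pi η t • emd t (rf (-η) (rf 0 (𝓕 ψ)))) := by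
  have h : 𝓕⁻ (Ph η t ψ) = e2pi η t • emd t (rf (-η) (rf 0 (𝓕 ψ))) := by
    ext z
    rw [fourierInv_coe, Real.fourierInv_eq, smul_apply, emd_apply, rf_apply, rf_apply, fourier_coe,
      Real.fourier_eq, smul_eq_mul, ← mul_assoc, ← integral_const_mul]
    rw [← integral_sub_left_eq_self _ volume t]
    refine integral_congr_ae (Eventually.of_forall fun y => ?_)
    dsimp only
    rw [Ph_apply, sub_sub_cancel, Circle.smul_def, Circle.smul_def, smul_eq_mul, smul_eq_mul, ← mul_assoc,
      ← mul_assoc]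
    congr 1
    have e : ∀ s : ℝ, ((Real.fourierChar s : Circle) : ℂ) =
        Complex.exp (((2 * Real.pi : ℝ) : ℂ) * Complex.I * (s : ℂ)) := by
      intro s; rw [Real.fourierChar_apply]; congr 1; push_cast; ring
    rw [e, e]
    unfold e2pi
    rw [← Complex.exp_add, ← Complex.exp_add, ← Complex.exp_add]
    congr 1
    simp only [inner_sub_left, inner_sub_right, inner_neg_right, inner_neg_left, inner_zero_right, zero_sub, real_inner_comm]
    push_cast
    ring
  rw [← h, FourierTransform.fourier_fourierInv_eq]

theorem pm_main (f : TemperedDist d) {u : Rd d → SI d K → ℂ} (hf : ∀ φ, f φ = pr u φ)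
    (hΓ : UniformlyDiscrete (tdSupport (fourierTD f))) :
    ∃ (r : ℝ) (γ : Rd d → Rd d) (N : Fin d → ℕ), 0 < r ∧ PM (Psi d r) γ N u := by
  obtain ⟨δ, hδ, hsep⟩ := hΓ
  obtain ⟨C, k0, n0, hC, hb⟩ := clm_bound (fourierTD f)
  have ha : ∀ η : Rd d, ∃ a, ∀ x ∈ tdSupport (fourierTD f), ‖x + η‖ ≤ δ / 3 → x = a := by
    intro η
    by_cases h : ∃ x ∈ tdSupport (fourierTD f), ‖x + η‖ ≤ δ / 3
    · obtain ⟨a, ha, ha'⟩ := h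
      refine ⟨a, fun x hx hx' => ?_⟩
      by_contra hne
      have h1 := hsep x hx a ha hne
      have h2 : dist x a ≤ ‖x + η‖ + ‖a + η‖ := by
        rw [dist_eq_norm, show x - a = (x + η) - (a + η) by abel]
        exact norm_sub_le _ _
      linarith
    · push Not at h
      exact ⟨0, fun x hx hx' => absurd hx' (not_le.2 (h x hx))⟩
  choose a ha using ha
  refine ⟨δ / 3, fun η => η + a η, fun _ => n0 + 1, by positivity, fun ψ hψ η => ?_⟩
  set G : Sc d := rf (-η) (rf 0 (𝓕 ψ)) with hG
  have hGs : tsupport ⇑G ⊆ closedBall (-η) (δ / 3) := by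
    refine closure_minimal (fun z hz => ?_) isClosed_closedBall
    have h1 : 𝓕 ψ (z + η) ≠ 0 := by
      rw [Function.mem_support, hG, rf_apply, rf_apply] at hz
      rwa [show (0 : Rd d) - (-η - z) = z + η by abel] at hz
    rw [mem_closedBall, dist_eq_norm, sub_neg_eq_add]
    exact hψ _ h1
  obtain ⟨q, hq, hqt⟩ := emd_poly (fourierTD f) hC hb G
    ((isCompact_closedBall _ _).of_isClosed_subset (isClosed_tsupport _) hGs) (a η) (fun x hx hxF => by
      refine ha η x hxF ?_
      have := hGs hx
      rwa [mem_closedBall, dist_eq_norm, sub_neg_eq_add] at this)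
  refine ⟨q, hq, fun t => ?_⟩
  rw [aa, ← hf, Ph_fourier, ← hG, e2pi_add_left, mul_assoc, ← hqt]
  have : f (𝓕 (e2pi η t • emd t G)) = fourierTD f (e2pi η t • emd t G) := rfl
  rw [this, map_smul, smul_eq_mul]

end FourierPart

/-- (Theorem 11.) Let `f = Σ_{λ∈Λ} Σ_k p_k(λ) D^k δ_λ` be a
tempered distribution on `ℝ^d` with uniformly discrete support `Λ` and
uniformly discrete spectrum, whose coefficients satisfy
`0 < c ≤ sup_k |p_k(λ)| (1+|λ|)^{-h(k)} ≤ C < ∞` on `Λ` for some nonnegative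
integers `h(k)`. Then
`f = Σ_{j=1}^J Σ_{λ ∈ λ_j + L_j} Σ_{(k,m,ω)} c(j,k,m,ω) λ^m e^{2πi⟨λ,ω⟩} D^k δ_λ`
for full-rank lattices `L_j`, points `λ_j`, a finite set of triples `(k,m,ω)`
and complex numbers `c(j,k,m,ω)`. -/
theorem statement6 {d : ℕ} (f : TemperedDist d) (Λ : Set (Rd d)) (K : ℕ)
    (p : (Fin d → ℕ) → Rd d → ℂ)
    (hp0 : ∀ k ∉ mIdx d K, ∀ x, p k x = 0)
    (hsupp : ∀ k x, p k x ≠ 0 → x ∈ Λ)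
    (hΛ : UniformlyDiscrete Λ)
    (hrep : ∀ φ : SchwartzMap (Rd d) ℂ, HasCompactSupport (⇑φ) →
      f φ = ∑' x : Rd d, ∑ k ∈ mIdx d K, p k x * dkDelta k x φ)
    (hΓ : UniformlyDiscrete (tdSupport (fourierTD f)))
    (h : (Fin d → ℕ) → ℕ) (c C : ℝ) (hc : 0 < c)
    (hbound : ∀ x ∈ Λ, (∃ k, c * (1 + ‖x‖) ^ (h k) ≤ ‖p k x‖) ∧
      ∀ k, ‖p k x‖ ≤ C * (1 + ‖x‖) ^ (h k)) :
    ∃ (J : ℕ) (L : Fin J → Set (Rd d)) (v : Fin J → Rd d)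
      (n : ℕ) (kk mm : Fin n → (Fin d → ℕ)) (w : Fin n → Rd d) (cc : Fin J → Fin n → ℂ),
      (∀ j, IsFullRankLattice (L j)) ∧
      ∀ φ : SchwartzMap (Rd d) ℂ, HasCompactSupport (⇑φ) →
        f φ = ∑ j, ∑' x : ((fun y => v j + y) '' (L j) : Set (Rd d)),
          ∑ i, cc j i * monom (mm i) (x : Rd d) * e2pi (x : Rd d) (w i) *
            dkDelta (kk i) (x : Rd d) φ := by
  classical
  set u : Rd d → SI d K → ℂ := fun x k => p k.1 x with hu
  have hC0 : 0 ≤ |C| := abs_nonneg C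
  have hObj : Obj u := by
    obtain ⟨D, hD⟩ := hΛ.bd
    refine ⟨⟨D, hD.mono fun x hx => ?_⟩, |C|, ∑ k : SI d K, h k.1, fun x => ?_⟩
    · by_contra hxΛ
      apply hx
      funext k
      by_contra hk
      exact hxΛ (hsupp k.1 x hk)
    · refine (pi_norm_le_iff_of_nonneg (by positivity)).2 fun k => ?_
      by_cases hxΛ : x ∈ Λ
      · refine ((hbound x hxΛ).2 k.1).trans ?_
        have h1 : (1 + ‖x‖) ^ (h k.1) ≤ (1 + ‖x‖) ^ (∑ k : SI d K, h k.1) :=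
          pow_le_pow_right₀ (by linarith [norm_nonneg x])
            (Finset.single_le_sum (f := fun k : SI d K => h k.1) (fun _ _ => Nat.zero_le _) (Finset.mem_univ k))
        have h2 : C ≤ |C| := le_abs_self C
        gcongr
      · have : p k.1 x = 0 := by
          by_contra hk
          exact hxΛ (hsupp k.1 x hk)
        rw [hu]; dsimp only
        rw [this, norm_zero]
        positivity
  have hf : ∀ φ, f φ = pr u φ := by
    refine f_eq_pr f hObj fun φ hφ => ?_
    rw [hrep φ hφ, pr]
    refine tsum_congr fun x => ?_
    rw [prx]
    exact (Finset.sum_coe_sort (mIdx d K) (fun k => p k x * dkDelta k x φ)).symm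
  obtain ⟨r, γ, N, hr, hPM⟩ := pm_main f hf hΓ
  have hcr := crys_main (Ψ := Psi d r) (fun i ψ hψ => Psi_xm i ψ hψ) (Psi_ne d hr) _ N u rfl hObj hPM
  obtain ⟨J, L, v, n, kk, mm, w, cc, hL, hcc⟩ := crys_conv hcr
  exact ⟨J, L, v, n, kk, mm, w, cc, hL, fun φ hφ => by rw [hf]; exact hcc φ hφ⟩
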